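/- arXiv:2205.12553 — 6 statements merged into one kernel-verified Lean document; each statement's English description precedes it below -/
import Mathlib

section
/- Let G be a finite group having property (I_p) with respect to a subgroup H. Then for any normal subgroup N ⊴ G, the quotient G/N has property (I_p) with respect to HN/N, and N has property (I_p) with respect to N ∩ H. -/
/-- A module is indecomposable if it is nonzero and admits no nontrivial direct sum
decomposition. -/
def IsIndecomposableModule (R M : Type*) [Ring R] [AddCommMonoid M] [Module R M] : Prop :=
  Nontrivial M ∧ ∀ N N' : Submodule R M, IsCompl N N' → N = ⊥ ∨ N' = ⊥

/-- The permutation module `k[G/H]`, as a module over the group algebra `k[G]`. -/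
abbrev PermMod (k : Type*) [Field k] {G : Type*} [Group G] (H : Subgroup G) :=
  (Representation.ofMulAction k G (G ⧸ H)).asModule

/-- A finite group `G` has property `(I_p)` with respect to a subgroup `H` if `H` is a
`p'`-subgroup and the permutation module `k[G/H]` is indecomposable (equivalently, it is the
projective cover of the trivial `k[G]`-module). -/
def HasIp (k : Type*) [Field k] {G : Type*} [Group G] (p : ℕ) (H : Subgroup G) : Prop :=
  ¬ (p ∣ Nat.card H) ∧ IsIndecomposableModule (MonoidAlgebra k G) (PermMod k H)


section IpAux

variable {k : Type*} [Field k]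

/-- The linear action of a group element on finitely supported functions on a `G`-set. -/
noncomputable def ipAct (k : Type*) [Field k] {G Ω : Type*} [Group G] [MulAction G Ω] (g : G) :
    (Ω →₀ k) →ₗ[k] (Ω →₀ k) := Finsupp.lmapDomain k k (g • ·)

/-- The augmentation map. -/
noncomputable def ipAug (k : Type*) [Field k] (Ω : Type*) : (Ω →₀ k) →ₗ[k] k :=
  Finsupp.linearCombination k (fun _ => (1 : k))

/-- Every stable subspace on which the augmentation is nonzero is everything. -/
def IpCyc (k : Type*) [Field k] (G Ω : Type*) [Group G] [MulAction G Ω] : Prop :=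
  ∀ W : Submodule k (Ω →₀ k), (∀ g : G, ∀ v ∈ W, ipAct k g v ∈ W) →
    (∃ v ∈ W, ipAug k Ω v ≠ 0) → W = ⊤

section
variable {G Ω : Type*} [Group G] [MulAction G Ω]

lemma ipAct_single (g : G) (x : Ω) (a : k) :
    ipAct k g (Finsupp.single x a) = Finsupp.single (g • x) a := by
  simp [ipAct]

lemma ipAug_single (x : Ω) (a : k) : ipAug k Ω (Finsupp.single x a) = a := by
  simp [ipAug]

lemma ipAct_mul (g h : G) (v : Ω →₀ k) : ipAct k (g * h) v = ipAct k g (ipAct k h v) := by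
  induction v using Finsupp.induction_linear with
  | zero => simp
  | add x y hx hy => simp [hx, hy]
  | single x a => simp [ipAct_single, mul_smul]

lemma ipAct_one (v : Ω →₀ k) : ipAct k (1 : G) v = v := by
  induction v using Finsupp.induction_linear with
  | zero => simp
  | add x y hx hy => simp [hx, hy]
  | single x a => simp [ipAct_single]

lemma ipAct_inv_act (g : G) (v : Ω →₀ k) : ipAct k g⁻¹ (ipAct k g v) = v := by
  rw [← ipAct_mul, inv_mul_cancel, ipAct_one]

lemma ipAct_act_inv (g : G) (v : Ω →₀ k) : ipAct k g (ipAct k g⁻¹ v) = v := by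
  rw [← ipAct_mul, mul_inv_cancel, ipAct_one]

lemma ipAug_act (g : G) (v : Ω →₀ k) : ipAug k Ω (ipAct k g v) = ipAug k Ω v := by
  induction v using Finsupp.induction_linear with
  | zero => simp
  | add x y hx hy => simp [hx, hy]
  | single x a => simp [ipAct_single, ipAug_single]

lemma ipAug_map {Ω' : Type*} (f : Ω → Ω') (v : Ω →₀ k) :
    ipAug k Ω' (Finsupp.lmapDomain k k f v) = ipAug k Ω v := by
  induction v using Finsupp.induction_linear with
  | zero => simp
  | add x y hx hy => rw [map_add, map_add, hx, hy, map_add]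
  | single x a => simp [ipAug_single]

/-- averaging over a subgroup of invertible order -/
lemma ip_average (H : Subgroup G) [Fintype H] (hH : (Nat.card H : k) ≠ 0)
    (v : Ω →₀ k) (hv : ipAug k Ω v = 1) :
    ∃ w : Ω →₀ k, w = (Nat.card H : k)⁻¹ • ∑ h : H, ipAct k (h : G) v ∧
      ipAug k Ω w = 1 ∧ ∀ h ∈ H, ipAct k h w = w := by
  refine ⟨_, rfl, ?_, ?_⟩
  · simp only [map_smul, map_sum, ipAug_act, hv]
    simp only [Finset.sum_const, Finset.card_univ, nsmul_eq_mul, mul_one, smul_eq_mul]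
    rw [← Nat.card_eq_fintype_card]
    exact inv_mul_cancel₀ hH
  · intro h hh
    simp only [map_smul, map_sum, ← ipAct_mul]
    congr 1
    exact Fintype.sum_equiv (Equiv.mulLeft (⟨h, hh⟩ : H)) _ _ (fun x => by simp)

end

section
variable {G : Type*} [Group G]

/-- comparison of the permutation module with finitely supported functions -/
noncomputable def ipTheta (k : Type*) [Field k] {G : Type*} [Group G] (H : Subgroup G) :
    PermMod k H ≃ₗ[k] ((G ⧸ H) →₀ k) :=
  (Representation.asModuleEquiv _).trans (MonoidAlgebra.coeffLinearEquiv k)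

lemma ipTheta_smul (H : Subgroup G) (g : G) (a : k) (v : PermMod k H) :
    ipTheta k H ((MonoidAlgebra.single g a : MonoidAlgebra k G) • v)
      = a • ipAct k g (ipTheta k H v) := by
  have h1 := Representation.single_smul (ρ := Representation.ofMulAction k G (G ⧸ H)) a g v
  have h2 : ipTheta k H ((MonoidAlgebra.single g a : MonoidAlgebra k G) • v)
    = MonoidAlgebra.coeffLinearEquiv k (a • (Representation.ofMulAction k G (G ⧸ H)) g
        ((Representation.ofMulAction k G (G ⧸ H)).asModuleEquiv v)) := by
    rw [← h1]; rfl
  rw [h2, map_smul, Representation.ofMulAction_def]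
  rfl

lemma ip_toSub (H : Subgroup G) (W : Submodule k ((G ⧸ H) →₀ k))
    (hW : ∀ g : G, ∀ v ∈ W, ipAct k g v ∈ W) :
    ∃ S : Submodule (MonoidAlgebra k G) (PermMod k H), ∀ v, v ∈ S ↔ ipTheta k H v ∈ W := by
  refine ⟨{ carrier := {v | ipTheta k H v ∈ W}
            add_mem' := ?_
            zero_mem' := ?_
            smul_mem' := ?_ }, fun v => Iff.rfl⟩
  · intro a b ha hb
    simp only [Set.mem_ofPred_eq] at *
    rw [map_add]; exact W.add_mem ha hb
  · simp
  · intro c v hv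
    simp only [Set.mem_ofPred_eq] at *
    induction c using MonoidAlgebra.induction_linear with
    | zero => rw [zero_smul, map_zero]; exact W.zero_mem
    | add x y hx hy => rw [add_smul, map_add]; exact W.add_mem hx hy
    | single g a => rw [ipTheta_smul]; exact W.smul_mem _ (hW _ _ hv)

lemma ip_compl (H : Subgroup G)
    (hI : IsIndecomposableModule (MonoidAlgebra k G) (PermMod k H))
    (W W' : Submodule k ((G ⧸ H) →₀ k))
    (hW : ∀ g : G, ∀ v ∈ W, ipAct k g v ∈ W) (hW' : ∀ g : G, ∀ v ∈ W', ipAct k g v ∈ W')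
    (hc : IsCompl W W') : W = ⊥ ∨ W' = ⊥ := by
  obtain ⟨S, hS⟩ := ip_toSub H W hW
  obtain ⟨S', hS'⟩ := ip_toSub H W' hW'
  have key : ∀ (T : Submodule (MonoidAlgebra k G) (PermMod k H)) (Z : Submodule k ((G ⧸ H) →₀ k)),
      (∀ v, v ∈ T ↔ ipTheta k H v ∈ Z) → T = ⊥ → Z = ⊥ := by
    intro T Z hT h
    rw [eq_bot_iff]
    intro v hv
    have := (hT ((ipTheta k H).symm v)).2 (by simpa using hv)
    rw [h, Submodule.mem_bot] at this
    simpa using this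
  have hcc : IsCompl S S' := by
    constructor
    · rw [Submodule.disjoint_def]
      intro v hv hv'
      have := (Submodule.disjoint_def.1 hc.disjoint) _ ((hS v).1 hv) ((hS' v).1 hv')
      simpa using this
    · rw [codisjoint_iff, eq_top_iff]
      intro v _
      have : ipTheta k H v ∈ W ⊔ W' := by rw [hc.sup_eq_top]; trivial
      obtain ⟨a, ha, b, hb, hab⟩ := Submodule.mem_sup.1 this
      refine Submodule.mem_sup.2 ⟨(ipTheta k H).symm a, (hS _).2 (by simpa using ha),
        (ipTheta k H).symm b, (hS' _).2 (by simpa using hb), ?_⟩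
      rw [← map_add, hab, LinearEquiv.symm_apply_apply]
  rcases hI.2 S S' hcc with h | h
  · exact Or.inl (key S W hS h)
  · exact Or.inr (key S' W' hS' h)

lemma ip_cyc_of_indec [Finite G] (H : Subgroup G) (hH : (Nat.card H : k) ≠ 0)
    (hI : IsIndecomposableModule (MonoidAlgebra k G) (PermMod k H)) :
    IpCyc k G (G ⧸ H) := by
  classical
  rintro W hW ⟨v, hv, hv0⟩
  have := Fintype.ofFinite H
  obtain ⟨w, hw, hw1, hwH⟩ := ip_average H hH ((ipAug k (G ⧸ H) v)⁻¹ • v)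
    (by rw [map_smul, smul_eq_mul, inv_mul_cancel₀ hv0])
  have hwW : w ∈ W := by
    rw [hw]
    exact W.smul_mem _ (W.sum_mem fun h _ => hW _ _ (W.smul_mem _ hv))
  let f : G ⧸ H → ((G ⧸ H) →₀ k) := Quotient.lift (fun g : G => ipAct k g w) (by
    intro a b hab
    have hab' : a⁻¹ * b ∈ H := QuotientGroup.leftRel_apply.1 hab
    have := hwH _ hab'
    show ipAct k a w = ipAct k b w
    conv_lhs => rw [← this]
    rw [← ipAct_mul, mul_inv_cancel_left])
  have hf : ∀ g : G, f (g : G ⧸ H) = ipAct k g w := fun g => rfl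
  let φ : Module.End k ((G ⧸ H) →₀ k) := Finsupp.linearCombination k f
  have hφ : ∀ (g : G) (a : k), φ (Finsupp.single (g : G ⧸ H) a) = a • ipAct k g w := by
    intro g a
    simp [φ, hf]
  have hφact : ∀ (g : G) v, φ (ipAct k g v) = ipAct k g (φ v) := by
    intro g v
    induction v using Finsupp.induction_linear with
    | zero => simp
    | add x y hx hy => simp [hx, hy]
    | single x a =>
      induction x using QuotientGroup.induction_on with
      | H x =>
        rw [ipAct_single, hφ, map_smul, ← ipAct_mul, ← hφ]
        rfl
  have hφaug : ∀ v, ipAug k _ (φ v) = ipAug k _ v := by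
    intro v
    induction v using Finsupp.induction_linear with
    | zero => simp
    | add x y hx hy => simp [hx, hy]
    | single x a =>
      induction x using QuotientGroup.induction_on with
      | H x => rw [hφ, map_smul, ipAug_act, hw1, ipAug_single]; simp
  have hφW : ∀ v, φ v ∈ W := by
    intro v
    induction v using Finsupp.induction_linear with
    | zero => simp
    | add x y hx hy => rw [map_add]; exact W.add_mem hx hy
    | single x a =>
      induction x using QuotientGroup.induction_on with
      | H x => rw [hφ]; exact W.smul_mem _ (hW _ _ hwW)
  have hpact : ∀ n : ℕ, ∀ (g : G) v, (φ ^ n) (ipAct k g v) = ipAct k g ((φ ^ n) v) := by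
    intro n g v
    induction n with
    | zero => simp
    | succ n ih => rw [pow_succ', Module.End.mul_apply, ih, hφact, Module.End.mul_apply]
  have hpaug : ∀ n : ℕ, ∀ v, ipAug k _ ((φ ^ n) v) = ipAug k _ v := by
    intro n v
    induction n with
    | zero => simp
    | succ n ih => rw [pow_succ', Module.End.mul_apply, hφaug, ih]
  obtain ⟨n, hn, hn1⟩ := ((LinearMap.eventually_isCompl_ker_pow_range_pow φ).and
    (Filter.eventually_ge_atTop 1)).exists
  have kst : ∀ g : G, ∀ v ∈ LinearMap.ker (φ ^ n), ipAct k g v ∈ LinearMap.ker (φ ^ n) := by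
    intro g v hv
    rw [LinearMap.mem_ker] at *
    rw [hpact, hv, map_zero]
  have rst : ∀ g : G, ∀ v ∈ LinearMap.range (φ ^ n), ipAct k g v ∈ LinearMap.range (φ ^ n) := by
    rintro g _ ⟨u, rfl⟩
    exact ⟨ipAct k g u, hpact n g u⟩
  rcases ip_compl H hI _ _ kst rst hn with h | h
  · rw [eq_top_iff]
    have h2 := hn.sup_eq_top
    rw [h, bot_sup_eq] at h2
    rw [← h2]
    rintro _ ⟨u, rfl⟩
    obtain ⟨m, rfl⟩ := Nat.exists_eq_add_of_le' hn1
    rw [pow_succ', Module.End.mul_apply]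
    exact hφW _
  · exfalso
    have h1 : (φ ^ n) (Finsupp.single ((1 : G) : G ⧸ H) 1) ∈ LinearMap.range (φ ^ n) := ⟨_, rfl⟩
    rw [h, Submodule.mem_bot] at h1
    have h2 := hpaug n (Finsupp.single ((1 : G) : G ⧸ H) 1)
    rw [h1, ipAug_single, map_zero] at h2
    exact zero_ne_one h2

lemma ip_indec_of_cyc (H : Subgroup G) (hC : IpCyc k G (G ⧸ H)) :
    IsIndecomposableModule (MonoidAlgebra k G) (PermMod k H) := by
  have hnt : Nontrivial ((G ⧸ H) →₀ k) := inferInstance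
  refine ⟨(ipTheta k H).toEquiv.nontrivial, ?_⟩
  intro S S' hc

  have push : ∀ T : Submodule (MonoidAlgebra k G) (PermMod k H),
      (∃ v ∈ T, ipAug k _ (ipTheta k H v) ≠ 0) → T = ⊤ := by
    rintro T ⟨v, hv, hv0⟩
    let W : Submodule k ((G ⧸ H) →₀ k) :=
      { carrier := {u | (ipTheta k H).symm u ∈ T}
        add_mem' := by
          intro a b ha hb
          simp only [Set.mem_ofPred_eq] at *
          rw [map_add]; exact T.add_mem ha hb
        zero_mem' := by simp
        smul_mem' := by
          intro c u hu
          simp only [Set.mem_ofPred_eq] at *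
          have h := T.smul_mem (MonoidAlgebra.single 1 c) hu
          have e : (ipTheta k H).symm (c • u)
              = (MonoidAlgebra.single (1 : G) c : MonoidAlgebra k G) • (ipTheta k H).symm u := by
            rw [LinearEquiv.symm_apply_eq, ipTheta_smul, ipAct_one, LinearEquiv.apply_symm_apply]
          rw [e]; exact h }
    have hWm : ∀ u, u ∈ W ↔ (ipTheta k H).symm u ∈ T := fun _ => Iff.rfl
    have hW := hC W (by
      intro g u hu
      rw [hWm] at *
      have h := T.smul_mem (MonoidAlgebra.single g 1) hu
      have e : (ipTheta k H).symm (ipAct k g u)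
          = (MonoidAlgebra.single g 1 : MonoidAlgebra k G) • (ipTheta k H).symm u := by
        rw [LinearEquiv.symm_apply_eq, ipTheta_smul, one_smul, LinearEquiv.apply_symm_apply]
      rw [e]; exact h)
      ⟨ipTheta k H v, by rw [hWm, LinearEquiv.symm_apply_apply]; exact hv, hv0⟩
    rw [eq_top_iff]
    intro u _
    have : ipTheta k H u ∈ W := by rw [hW]; trivial
    rw [hWm, LinearEquiv.symm_apply_apply] at this
    exact this
  by_cases h1 : ∃ v ∈ S, ipAug k _ (ipTheta k H v) ≠ 0
  · right
    have := push S h1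
    subst this
    exact top_disjoint.1 hc.disjoint
  by_cases h2 : ∃ v ∈ S', ipAug k _ (ipTheta k H v) ≠ 0
  · left
    have := push S' h2
    subst this
    exact disjoint_top.1 hc.disjoint
  exfalso
  push Not at h1 h2
  have h3 : (ipTheta k H).symm (Finsupp.single ((1 : G) : G ⧸ H) 1) ∈ S ⊔ S' := by
    rw [hc.sup_eq_top]; trivial
  obtain ⟨a, ha, b, hb, hab⟩ := Submodule.mem_sup.1 h3
  have h4 := congrArg (fun v => ipAug k _ (ipTheta k H v)) hab
  simp only [map_add, h1 a ha, h2 b hb, LinearEquiv.apply_symm_apply, ipAug_single] at h4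
  simp at h4

/-- Passing to a quotient. -/
lemma ip_cyc_quot {G' Ω Ω' : Type*} [Group G'] [MulAction G Ω] [MulAction G' Ω']
    (f : G → G') (q : Ω → Ω') (hq : Function.Surjective q)
    (hfq : ∀ g x, q (g • x) = f g • q x) (hC : IpCyc k G Ω) : IpCyc k G' Ω' := by
  rintro W hW ⟨v, hv, hv0⟩
  have hsurj : Function.Surjective (Finsupp.lmapDomain k k q) :=
    Finsupp.mapDomain_surjective hq
  have hcomm : ∀ (g : G) (u : Ω →₀ k), Finsupp.lmapDomain k k q (ipAct k g u)
      = ipAct k (f g) (Finsupp.lmapDomain k k q u) := by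
    intro g u
    induction u using Finsupp.induction_linear with
    | zero => simp
    | add x y hx hy => simp only [map_add, hx, hy]
    | single x a => simp [ipAct_single, hfq]
  have hT := hC (W.comap (Finsupp.lmapDomain k k q)) (by
    intro g u hu
    rw [Submodule.mem_comap] at *
    rw [hcomm]; exact hW _ _ hu) (by
    obtain ⟨u, rfl⟩ := hsurj v
    exact ⟨u, hv, by rwa [ipAug_map] at hv0⟩)
  rw [eq_top_iff]
  intro u _
  obtain ⟨u, rfl⟩ := hsurj u
  have : u ∈ W.comap (Finsupp.lmapDomain k k q) := by rw [hT]; trivial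
  exact this

set_option maxHeartbeats 2000000 in
/-- The core of the restriction to a normal subgroup. -/
lemma ip_core [Finite G] (H N : Subgroup G) [N.Normal] (hH : (Nat.card H : k) ≠ 0)
    (hC : IpCyc k G (G ⧸ H)) (W : Submodule k ((G ⧸ H) →₀ k))
    (hWU : W ≤ Finsupp.supported k k {x : G ⧸ H | ∃ n ∈ N, x = (n : G ⧸ H)})
    (hWN : ∀ n ∈ N, ∀ v ∈ W, ipAct k n v ∈ W) (hW : ∃ v ∈ W, ipAug k _ v ≠ 0) :
    W = Finsupp.supported k k {x : G ⧸ H | ∃ n ∈ N, x = (n : G ⧸ H)} := by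
  classical
  have := Fintype.ofFinite H
  have hNn : N.Normal := inferInstance
  set S : Set (G ⧸ H) := {x : G ⧸ H | ∃ n ∈ N, x = (n : G ⧸ H)} with hS
  set U := Finsupp.supported k k S with hU
  let Nst : Submodule k ((G ⧸ H) →₀ k) → Prop := fun W => ∀ n ∈ N, ∀ v ∈ W, ipAct k n v ∈ W
  have Nst_sup : ∀ A B, Nst A → Nst B → Nst (A ⊔ B) := by
    intro A B hA hB n hn v hv
    obtain ⟨a, ha, b, hb, rfl⟩ := Submodule.mem_sup.1 hv
    rw [map_add]
    exact Submodule.add_mem_sup (hA n hn a ha) (hB n hn b hb)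
  have actU : ∀ g : G, (∀ x ∈ S, g • x ∈ S) → ∀ v ∈ U, ipAct k g v ∈ U := by
    intro g hg v hv
    have : U ≤ U.comap (ipAct k g) := by
      rw [hU, Finsupp.supported_eq_span_single, Submodule.span_le]
      rintro _ ⟨x, hx, rfl⟩
      rw [SetLike.mem_coe, Submodule.mem_comap, ipAct_single]
      exact Submodule.subset_span ⟨_, hg x hx, rfl⟩
    exact this hv
  have US_N : Nst U := by
    intro n hn
    apply actU
    rintro _ ⟨m, hm, rfl⟩
    exact ⟨n * m, N.mul_mem hn hm, rfl⟩
  have US_H : ∀ h ∈ H, ∀ v ∈ U, ipAct k h v ∈ U := by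
    intro h hh
    apply actU
    rintro _ ⟨m, hm, rfl⟩
    refine ⟨h * m * h⁻¹, hNn.conj_mem m hm h, ?_⟩
    show ((h * m : G) : G ⧸ H) = _
    rw [QuotientGroup.eq]
    have e : (h * m)⁻¹ * (h * m * h⁻¹) = h⁻¹ := by group
    rw [e]
    exact H.inv_mem hh
  have oneU : Finsupp.single ((1 : G) : G ⧸ H) (1 : k) ∈ U :=
    Finsupp.single_mem_supported _ _ ⟨1, N.one_mem, rfl⟩
  -- minimal subspace
  obtain ⟨C, ⟨hCU, hCN, c₀, hc₀, hc₀'⟩, hCmin⟩ := (wellFounded_lt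
    (α := Submodule k ((G ⧸ H) →₀ k))).has_min
      {C : Submodule k ((G ⧸ H) →₀ k) | C ≤ U ∧ Nst C ∧ ∃ v ∈ C, ipAug k (G ⧸ H) v ≠ 0}
      ⟨U, le_rfl, US_N, _, oneU, by rw [ipAug_single]; exact one_ne_zero⟩
  set C0 := C ⊓ LinearMap.ker (ipAug k (G ⧸ H)) with hC0
  have C0N : Nst C0 := by
    rintro n hn v ⟨hv, hv'⟩
    refine ⟨hCN n hn v hv, ?_⟩
    rw [SetLike.mem_coe, LinearMap.mem_ker] at *
    rw [ipAug_act, hv']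
  let Sf : Submodule k ((G ⧸ H) →₀ k) → Prop := fun X =>
    ∀ W, W ≤ U → Nst W → W ⊔ X = U → W = U
  have sf0 : Sf C0 := by
    intro W hWU hWN hsup
    have hc₀U := hCU hc₀
    rw [← hsup] at hc₀U
    obtain ⟨w, hw, c, hc, hwc⟩ := Submodule.mem_sup.1 hc₀U
    have hwe : w = c₀ - c := by rw [← hwc]; simp
    have hmem : C ⊓ W ∈ {C : Submodule k ((G ⧸ H) →₀ k) | C ≤ U ∧ Nst C ∧ ∃ v ∈ C, ipAug k _ v ≠ 0} := by
      refine ⟨inf_le_left.trans hCU, fun n hn v hv => ⟨hCN n hn v hv.1, hWN n hn v hv.2⟩, w,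
        ⟨?_, hw⟩, ?_⟩
      · rw [hwe]; exact C.sub_mem hc₀ hc.1
      · rw [hwe, map_sub, LinearMap.mem_ker.1 hc.2, sub_zero]; exact hc₀'
    have h1 := hCmin _ hmem
    have h2 : C ⊓ W = C := by
      by_contra hne
      exact h1 (lt_of_le_of_ne inf_le_left hne)
    have h3 : C ≤ W := inf_eq_left.1 h2
    rw [← hsup]
    exact (sup_eq_left.2 (inf_le_left.trans h3)).symm
  have sfH : ∀ h ∈ H, Sf (C0.map (ipAct k h)) := by
    intro h hh W hWU hWN hsup
    have h1 := sf0 (W.map (ipAct k h⁻¹)) (by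
      rintro _ ⟨w, hw, rfl⟩
      exact US_H _ (H.inv_mem hh) _ (hWU hw)) (by
      rintro n hn _ ⟨w, hw, rfl⟩
      refine ⟨ipAct k (h * n * h⁻¹) w, hWN _ (hNn.conj_mem n hn h) _ hw, ?_⟩
      rw [← ipAct_mul, ← ipAct_mul]
      congr 2
      group) (by
      apply le_antisymm
      · apply sup_le
        · rintro _ ⟨w, hw, rfl⟩
          exact US_H _ (H.inv_mem hh) _ (hWU hw)
        · exact inf_le_left.trans hCU
      · intro u hu
        have hu' := US_H h hh u hu
        rw [← hsup] at hu'
        obtain ⟨w, hw, _, ⟨c, hc, rfl⟩, hwc⟩ := Submodule.mem_sup.1 hu'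
        refine Submodule.mem_sup.2 ⟨_, ⟨w, hw, rfl⟩, c, hc, ?_⟩
        rw [← ipAct_inv_act (k := k) h u, ← hwc, map_add, ipAct_inv_act])
    apply le_antisymm hWU
    intro u hu
    have hu' := US_H _ (H.inv_mem hh) u hu
    rw [← h1] at hu'
    obtain ⟨w, hw, hwe⟩ := hu'
    have : w = u := by
      rw [← ipAct_act_inv (k := k) h u, ← hwe, ipAct_act_inv]
    rwa [← this]
  have mapN : ∀ h : G, Nst (C0.map (ipAct k h)) := by
    rintro h n hn _ ⟨w, hw, rfl⟩
    refine ⟨ipAct k (h⁻¹ * n * h) w, C0N _ ?_ _ hw, ?_⟩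
    · simpa using hNn.conj_mem n hn h⁻¹
    · rw [← ipAct_mul, ← ipAct_mul]
      congr 2
      group
  have mapU : ∀ h ∈ H, C0.map (ipAct k h) ≤ U := by
    rintro h hh _ ⟨w, hw, rfl⟩
    exact US_H h hh w (hCU hw.1)
  have all : ∀ s : Finset H, Nst (s.sup fun h => C0.map (ipAct k (h : G))) ∧
      (s.sup fun h => C0.map (ipAct k (h : G))) ≤ U ∧
      Sf (s.sup fun h => C0.map (ipAct k (h : G))) := by
    intro s
    induction s using Finset.induction_on with
    | empty =>
      refine ⟨?_, by simp, ?_⟩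
      · intro n hn v hv
        simp only [Finset.sup_empty, Submodule.mem_bot] at hv ⊢
        rw [hv, map_zero]
      · intro W _ _ h
        simpa using h
    | insert a s ha ih =>
      obtain ⟨i1, i2, i3⟩ := ih
      rw [Finset.sup_insert]
      refine ⟨Nst_sup _ _ (mapN _) i1, sup_le (mapU _ a.2) i2, ?_⟩
      intro W hWU hWN hsup
      refine i3 W hWU hWN (sfH _ a.2 _ (sup_le hWU i2) (Nst_sup _ _ hWN i1) ?_)
      rw [← hsup, sup_assoc, sup_comm (Finset.sup _ _)]
  obtain ⟨XN, XU, Xsf⟩ := all Finset.univ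
  set X := (Finset.univ : Finset H).sup fun h => C0.map (ipAct k (h : G)) with hX
  have leX : ∀ h : H, C0.map (ipAct k (h : G)) ≤ X := fun h =>
    Finset.le_sup (f := fun h : H => C0.map (ipAct k (h : G))) (Finset.mem_univ h)
  have Xaug : X ≤ LinearMap.ker (ipAug k (G ⧸ H)) := by
    apply Finset.sup_le
    rintro h - _ ⟨w, hw, rfl⟩
    rw [LinearMap.mem_ker, ipAug_act]
    exact hw.2
  have XH : ∀ h ∈ H, ∀ v ∈ X, ipAct k h v ∈ X := by
    intro h hh
    have : X ≤ X.comap (ipAct k h) := by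
      apply Finset.sup_le
      rintro h' - _ ⟨w, hw, rfl⟩
      rw [Submodule.mem_comap, ← ipAct_mul]
      exact leX (⟨h, hh⟩ * h') ⟨w, hw, rfl⟩
    exact fun v hv => this hv
  -- averaged generator
  obtain ⟨c, hcC, hc1⟩ : ∃ c ∈ C, ipAug k _ c = 1 :=
    ⟨(ipAug k _ c₀)⁻¹ • c₀, C.smul_mem _ hc₀, by
      rw [map_smul, smul_eq_mul, inv_mul_cancel₀ hc₀']⟩
  obtain ⟨d, hd, hd1, hdH⟩ := ip_average H hH c hc1
  have dU : d ∈ U := by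
    rw [hd]
    exact U.smul_mem _ (U.sum_mem fun h _ => US_H _ h.2 _ (hCU hcC))
  have dN : ∀ n ∈ N, ipAct k n d - d ∈ X := by
    intro n hn
    rw [hd, map_smul, ← smul_sub, map_sum, ← Finset.sum_sub_distrib]
    refine X.smul_mem _ (X.sum_mem fun h _ => leX h ?_)
    have hn' : (h : G)⁻¹ * n * h ∈ N := by simpa using hNn.conj_mem n hn (h : G)⁻¹
    refine ⟨ipAct k ((h : G)⁻¹ * n * h) c - c, ⟨C.sub_mem (hCN _ hn' _ hcC) hcC, ?_⟩, ?_⟩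
    · rw [SetLike.mem_coe, LinearMap.mem_ker, map_sub, ipAug_act, sub_self]
    · rw [map_sub, ← ipAct_mul, ← ipAct_mul]
      congr 3
      group
  set Z := X ⊔ Submodule.span k {d} with hZ
  have dZ : d ∈ Z := Submodule.mem_sup_right (Submodule.mem_span_singleton_self d)
  have ZU : Z ≤ U := sup_le XU (by rw [Submodule.span_singleton_le_iff_mem]; exact dU)
  -- the induced subspace
  let r : ((G ⧸ H) →₀ k) →ₗ[k] ((G ⧸ H) →₀ k) :=
    Finsupp.linearCombination k (fun x => if x ∈ S then Finsupp.single x (1 : k) else 0)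
  have r_single : ∀ x a, r (Finsupp.single x a) = if x ∈ S then Finsupp.single x a else 0 := by
    intro x a
    simp only [r, Finsupp.linearCombination_single]
    split_ifs <;> simp
  have rU : ∀ v ∈ U, r v = v := by
    intro v hv
    have : U ≤ LinearMap.eqLocus r LinearMap.id := by
      rw [hU, Finsupp.supported_eq_span_single, Submodule.span_le]
      rintro _ ⟨x, hx, rfl⟩
      show r (Finsupp.single x 1) = Finsupp.single x 1
      rw [r_single, if_pos hx]
    exact this hv
  have hY := hC (⨅ g : G, Z.comap (r ∘ₗ ipAct k g)) (by
    intro g v hv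
    simp only [Submodule.mem_iInf, Submodule.mem_comap, LinearMap.comp_apply] at *
    intro g'
    rw [← ipAct_mul]
    exact hv _) (by
    refine ⟨d, ?_, by rw [hd1]; exact one_ne_zero⟩
    simp only [Submodule.mem_iInf, Submodule.mem_comap, LinearMap.comp_apply]
    intro g
    by_cases hg : ∃ x ∈ S, g • x ∈ S
    · obtain ⟨_, ⟨n, hn, rfl⟩, n', hn', he⟩ := hg
      have he' : ((g * n : G) : G ⧸ H) = (n' : G ⧸ H) := he
      rw [eq_comm, QuotientGroup.eq] at he'
      obtain ⟨h, hh, rfl⟩ : ∃ h ∈ H, g = n' * h * n⁻¹ := ⟨_, he', by group⟩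
      have key : ipAct k (n' * h * n⁻¹) d ∈ Z := by
        have e : n' * h * n⁻¹ = (n' * (h * n⁻¹ * h⁻¹)) * h := by group
        rw [e, ipAct_mul, hdH h hh]
        have := dN _ (N.mul_mem hn' (hNn.conj_mem _ (N.inv_mem hn) h))
        rw [← sub_add_cancel (ipAct k (n' * (h * n⁻¹ * h⁻¹)) d) d]
        exact Z.add_mem (Submodule.mem_sup_left this) dZ
      rw [rU _ (ZU key)]
      exact key
    · have : U ≤ LinearMap.ker (r ∘ₗ ipAct k g) := by
        rw [hU, Finsupp.supported_eq_span_single, Submodule.span_le]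
        rintro _ ⟨x, hx, rfl⟩
        show r (ipAct k g (Finsupp.single x 1)) = 0
        rw [ipAct_single, r_single, if_neg]
        exact fun h => hg ⟨x, hx, h⟩
      have h0 : r (ipAct k g d) = 0 := this dU
      rw [h0]
      exact Z.zero_mem)
  have UZ : U ≤ Z := by
    intro u hu
    have h1 : u ∈ (⨅ g : G, Z.comap (r ∘ₗ ipAct k g)) := by rw [hY]; trivial
    simp only [Submodule.mem_iInf, Submodule.mem_comap, LinearMap.comp_apply] at h1
    have h2 := h1 1
    rwa [ipAct_one, rU u hu] at h2
  have kerX : ∀ u ∈ U, ipAug k _ u = 0 → u ∈ X := by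
    intro u hu hu0
    obtain ⟨x, hx, y, hy, rfl⟩ := Submodule.mem_sup.1 (UZ hu)
    obtain ⟨a, rfl⟩ := Submodule.mem_span_singleton.1 hy
    rw [map_add, LinearMap.mem_ker.1 (Xaug hx), map_smul, hd1] at hu0
    have : a = 0 := by simpa using hu0
    rw [this, zero_smul, add_zero]
    exact hx
  obtain ⟨w, hw, hw0⟩ := hW
  refine Xsf W hWU hWN (le_antisymm (sup_le hWU XU) ?_)
  intro u hu
  refine Submodule.mem_sup.2 ⟨(ipAug k _ u * (ipAug k _ w)⁻¹) • w, W.smul_mem _ hw,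
    u - (ipAug k _ u * (ipAug k _ w)⁻¹) • w, kerX _ ?_ ?_, by simp⟩
  · exact U.sub_mem hu (U.smul_mem _ (hWU hw))
  · rw [map_sub, map_smul, smul_eq_mul, mul_assoc, inv_mul_cancel₀ hw0, mul_one, sub_self]

lemma ip_cyc_normal [Finite G] (H N : Subgroup G) [N.Normal] (hH : (Nat.card H : k) ≠ 0)
    (hC : IpCyc k G (G ⧸ H)) : IpCyc k N (N ⧸ (N ⊓ H).subgroupOf N) := by
  let i : N ⧸ (N ⊓ H).subgroupOf N → G ⧸ H :=
    Quotient.map' (fun n : N => (n : G)) (by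
      intro a b hab
      rw [QuotientGroup.leftRel_apply] at *
      exact (Subgroup.mem_subgroupOf.1 hab).2)
  have hi : ∀ n : N, i (n : N ⧸ (N ⊓ H).subgroupOf N) = ((n : G) : G ⧸ H) := fun n => rfl
  have inj : Function.Injective i := by
    intro x y hxy
    induction x using QuotientGroup.induction_on with
    | H x =>
      induction y using QuotientGroup.induction_on with
      | H y =>
        rw [hi, hi, QuotientGroup.eq] at hxy
        rw [QuotientGroup.eq, Subgroup.mem_subgroupOf]
        exact ⟨(x⁻¹ * y).2, hxy⟩
  have hmap : ∀ (n : N) u, Finsupp.lmapDomain k k i (ipAct k n u)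
      = ipAct k (n : G) (Finsupp.lmapDomain k k i u) := by
    intro n u
    induction u using Finsupp.induction_linear with
    | zero => simp
    | add x y hx hy => simp only [map_add, hx, hy]
    | single x a =>
      induction x using QuotientGroup.induction_on with
      | H x =>
        simp only [ipAct_single, Finsupp.lmapDomain_apply, Finsupp.mapDomain_single]
        rfl
  have hsupp : ∀ u, Finsupp.lmapDomain k k i u ∈
      Finsupp.supported k k {x : G ⧸ H | ∃ n ∈ N, x = (n : G ⧸ H)} := by
    intro u
    induction u using Finsupp.induction_linear with
    | zero => simp
    | add x y hx hy => rw [map_add]; exact Submodule.add_mem _ hx hy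
    | single x a =>
      induction x using QuotientGroup.induction_on with
      | H x =>
        rw [Finsupp.lmapDomain_apply, Finsupp.mapDomain_single]
        exact Finsupp.single_mem_supported _ _ ⟨x, x.2, rfl⟩
  rintro W hW ⟨v, hv, hv0⟩
  have h := ip_core H N hH hC (W.map (Finsupp.lmapDomain k k i)) (by
    rintro _ ⟨u, _, rfl⟩
    exact hsupp u) (by
    rintro n hn _ ⟨u, hu, rfl⟩
    exact ⟨_, hW ⟨n, hn⟩ u hu, hmap ⟨n, hn⟩ u⟩)
    ⟨_, ⟨v, hv, rfl⟩, by rwa [ipAug_map]⟩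
  rw [eq_top_iff]
  intro u _
  have hu := hsupp u
  rw [← h] at hu
  obtain ⟨u', hu', he⟩ := hu
  have : u' = u := Finsupp.mapDomain_injective inj he
  rwa [← this]

end

end IpAux

/-- If `G` has property `(I_p)` with respect to `H` and `N ⊴ G`, then `G/N` has property
`(I_p)` with respect to `HN/N` and `N` has property `(I_p)` with respect to `N ∩ H`. -/
theorem stmt3 (k : Type) [Field k] (p : ℕ) [Fact p.Prime] [IsAlgClosed k] [CharP k p]
    (G : Type) [Group G] [Finite G] (H : Subgroup G) (hG : HasIp k p H)
    (N : Subgroup G) [N.Normal] :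
    HasIp k p (H.map (QuotientGroup.mk' N)) ∧ HasIp k p ((N ⊓ H).subgroupOf N) := by
  obtain ⟨hp, hI⟩ := hG
  have hH : (Nat.card H : k) ≠ 0 := by
    rwa [Ne, CharP.cast_eq_zero_iff k p]
  have hC := ip_cyc_of_indec H hH hI
  refine ⟨⟨fun h => hp (h.trans (Subgroup.card_map_dvd H _)), ?_⟩, ⟨fun h => hp (h.trans ?_), ?_⟩⟩
  · apply ip_indec_of_cyc
    let q : G ⧸ H → (G ⧸ N) ⧸ H.map (QuotientGroup.mk' N) :=
      Quotient.map' (QuotientGroup.mk' N) (by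
        intro a b hab
        rw [QuotientGroup.leftRel_apply] at *
        exact ⟨_, hab, by simp⟩)
    refine ip_cyc_quot (QuotientGroup.mk' N) q ?_ ?_ hC
    · intro y
      induction y using QuotientGroup.induction_on with
      | H y =>
        obtain ⟨g, rfl⟩ := QuotientGroup.mk'_surjective N y
        exact ⟨(g : G ⧸ H), rfl⟩
    · intro g x
      induction x using QuotientGroup.induction_on with
      | H x => rfl
  · have h1 : Nat.card ((N ⊓ H).subgroupOf N) = Nat.card (N ⊓ H : Subgroup G) :=
      Nat.card_congr (Subgroup.subgroupOfEquivOfLe inf_le_left).toEquiv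
    rw [h1]
    exact Subgroup.card_dvd_of_le inf_le_right
  · exact ip_indec_of_cyc _ (ip_cyc_normal H N hH hC)
end

section
/- Let G be a finite group having property (I_p) with respect to a subgroup H. Then the number l(G) of isomorphism classes of simple kG-modules satisfies l(G) ≤ |H|. -/
open Module

lemma fitting_aux {R M : Type*} [Ring R] [AddCommGroup M] [Module R M]
    [IsNoetherian R M] [IsArtinian R M] (h : IsIndecomposableModule R M)
    (φ : Module.End R M) (hn : ∀ n : ℕ, φ ^ n ≠ 0) : Function.Injective φ := by
  obtain ⟨n, hn1, hc⟩ := ((Filter.eventually_ge_atTop 1).and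
    φ.eventually_isCompl_ker_pow_range_pow).exists
  rcases h.2 _ _ hc with h0 | h0
  · have h1 : Function.Injective (φ ^ n) := LinearMap.ker_eq_bot.mp h0
    obtain ⟨m, rfl⟩ : ∃ m, n = m + 1 := ⟨n - 1, by omega⟩
    intro x y hxy
    apply h1
    rw [pow_succ, Module.End.mul_apply, Module.End.mul_apply, hxy]
  · exact absurd (LinearMap.range_eq_bot.mp h0) (hn n)

lemma key_rep {k : Type*} [Field k] {G : Type*} [Group G] [Fintype G] (H : Subgroup G)
    (hH : (Nat.card H : k) ≠ 0)
    {P S X : Type*} [AddCommGroup P] [AddCommGroup S] [AddCommGroup X]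
    [Module k P] [Module k S] [Module k X] [FiniteDimensional k P] [FiniteDimensional k S]
    [Nontrivial S]
    (ρ : Representation k G P) (σ : Representation k G S) (τ : Representation k G X)
    (b : Basis (G ⧸ H) k X) (hb : ∀ g c, τ g (b c) = b (g • c))
    (f : P →ₗ[k] S) (hf : ∀ g x, f (ρ g x) = σ g (f x)) (hs : Function.Surjective f)
    (θ : P →ₗ[k] P) (hθ : ∀ x, ∑ g : G, ρ g (θ (ρ g⁻¹ x)) = x)
    (hX : ∀ φ : Module.End k X, (∀ g x, φ (τ g x) = τ g (φ x)) → (∀ n : ℕ, φ ^ n ≠ 0) →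
      Function.Injective φ) :
    Nat.card (G ⧸ H) ≤ finrank k S * finrank k P := by
  classical
  have : Fintype H := Fintype.ofFinite _
  obtain ⟨s, hsec⟩ := f.exists_rightInverse_of_surjective (LinearMap.range_eq_top.mpr hs)
  obtain ⟨x0, hx0⟩ := exists_ne (0 : S)
  obtain ⟨ξ, hξ⟩ := Module.Projective.exists_dual_ne_zero k hx0
  -- trace functional
  let t : (S →ₗ[k] P) →ₗ[k] k := LinearMap.trace k S ∘ₗ LinearMap.llcomp k S P S f
  have ht : ∀ q, t q = LinearMap.trace k S (f ∘ₗ q) := fun q => rfl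
  let c : G → (S →ₗ[k] P) →ₗ[k] (S →ₗ[k] P) := fun g =>
    LinearMap.llcomp k S P P (ρ g) ∘ₗ LinearMap.lcomp k P (σ g⁻¹)
  have hc : ∀ g q x, c g q x = ρ g (q (σ g⁻¹ x)) := fun g q x => rfl
  have hcmul : ∀ g h q, c (g * h) q = c g (c h q) := by
    intro g h q; ext x; simp [hc]
  have hc1 : ∀ q, c 1 q = q := by intro q; ext x; simp [hc]
  have htc : ∀ g q, t (c g q) = t q := by
    intro g q
    have : f ∘ₗ c g q = σ g ∘ₗ (f ∘ₗ q) ∘ₗ σ g⁻¹ := by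
      ext x; simp [hc, hf]
    rw [ht, this, LinearMap.trace_comp_comm', LinearMap.comp_assoc, ← Module.End.mul_eq_comp (σ g⁻¹), ← map_mul]
    simp [ht, Module.End.one_eq_id]
  let q1 : S →ₗ[k] P := (ξ x0)⁻¹ • (s ∘ₗ ξ.smulRight x0)
  have hq1 : t q1 = 1 := by
    rw [ht]
    have : f ∘ₗ q1 = (ξ x0)⁻¹ • ξ.smulRight x0 := by
      ext y
      have := LinearMap.congr_fun hsec x0
      simp at this
      simp [q1, this]
    rw [this, map_smul, LinearMap.trace_smulRight, smul_eq_mul, inv_mul_cancel₀ hξ]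
  let q0 : S →ₗ[k] P := (Nat.card H : k)⁻¹ • ∑ h : H, c h q1
  have hq0 : t q0 = 1 := by
    simp only [q0, map_smul, map_sum, htc, hq1]
    simp at hH ⊢
    exact inv_mul_cancel₀ hH
  have hq0H : ∀ h ∈ H, c h q0 = q0 := by
    intro h hh
    simp only [q0, map_smul, map_sum, ← hcmul]
    congr 1
    exact Fintype.sum_equiv (Equiv.mulLeft (⟨h, hh⟩ : H)) _ _ (fun x => rfl)
  let F0 : G ⧸ H → (S →ₗ[k] P) := Quotient.lift (fun g => c g q0) (by
    intro a a' haa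
    have : a⁻¹ * a' ∈ H := QuotientGroup.leftRel_apply.mp haa
    have := hq0H _ this
    show c a q0 = c a' q0
    rw [← this, ← hcmul, this]
    simp)
  have hF0 : ∀ g : G, F0 (g : G ⧸ H) = c g q0 := fun g => rfl
  let F : X →ₗ[k] (S →ₗ[k] P) := b.constr k F0
  have hFb : ∀ d, F (b d) = F0 d := fun d => b.constr_basis k F0 d
  have hFeq : ∀ g x, F (τ g x) = c g (F x) := by
    intro g x
    have : F ∘ₗ τ g = c g ∘ₗ F := by
      apply b.ext
      intro d
      induction d using QuotientGroup.induction_on with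
      | H a =>
        simp only [LinearMap.comp_apply, hb, hFb]
        rw [hF0, ← hcmul]; rfl
    exact LinearMap.congr_fun this x
  let Γ : (S →ₗ[k] P) →ₗ[k] X := ∑ g : G,
    (t ∘ₗ LinearMap.llcomp k S P P θ ∘ₗ c g⁻¹).smulRight (b (g : G ⧸ H))
  have hΓ : ∀ q, Γ q = ∑ g : G, t (θ ∘ₗ c g⁻¹ q) • b (g : G ⧸ H) := by
    intro q; simp [Γ]; rfl
  have hΓeq : ∀ g q, Γ (c g q) = τ g (Γ q) := by
    intro g q
    rw [hΓ, hΓ, map_sum]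
    refine Fintype.sum_equiv (Equiv.mulLeft g⁻¹) _ _ (fun x => ?_)
    simp only [Equiv.coe_mulLeft, map_smul, hb, ← hcmul]
    congr 2
    · simp
    · show (x : G ⧸ H) = ((g * (g⁻¹ * x) : G) : G ⧸ H)
      simp
  let ε : X →ₗ[k] k := b.constr k (fun _ => (1 : k))
  have hεb : ∀ d, ε (b d) = 1 := fun d => b.constr_basis k _ d
  have hεF : ∀ x, t (F x) = ε x := by
    intro x
    have : t ∘ₗ F = ε := by
      apply b.ext
      intro d
      induction d using QuotientGroup.induction_on with
      | H a =>
        simp only [LinearMap.comp_apply, hFb, hεb]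
        rw [hF0, htc, hq0]
    exact LinearMap.congr_fun this x
  have hεΓ : ∀ q, ε (Γ q) = t q := by
    intro q
    rw [hΓ, map_sum]
    simp only [map_smul, hεb, smul_eq_mul, mul_one]
    have h1 : ∀ g : G, t (θ ∘ₗ c g⁻¹ q) = t (c g (θ ∘ₗ c g⁻¹ q)) := fun g => (htc _ _).symm
    rw [Finset.sum_congr rfl (fun g _ => h1 g), ← map_sum]
    congr 1
    ext x
    simp only [LinearMap.sum_apply, hc, LinearMap.comp_apply]
    have := hθ (q x)
    simpa using this
  let φ : Module.End k X := Γ ∘ₗ F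
  have hφ : ∀ x, ε (φ x) = ε x := fun x => by
    show ε (Γ (F x)) = _
    rw [hεΓ, hεF]
  have hφn : ∀ n : ℕ, ∀ x, ε ((φ ^ n) x) = ε x := by
    intro n
    induction n with
    | zero => intro x; simp
    | succ n ih => intro x; rw [pow_succ, Module.End.mul_apply, ih, hφ]
  have hinj := hX φ (fun g x => by
    show Γ (F _) = τ g (Γ (F _))
    rw [hFeq, hΓeq]) (fun n h0 => by
      have := hφn n (b ((1 : G) : G ⧸ H))
      rw [h0, hεb] at this
      simp at this)
  have hFinj : Function.Injective F := fun x y hxy => hinj (by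
    show Γ (F x) = Γ (F y)
    rw [hxy])
  have h2 := LinearMap.finrank_le_finrank_of_injective hFinj
  rw [Module.finrank_linearMap, Module.finrank_eq_nat_card_basis b] at h2
  exact h2

lemma higman {k : Type*} [Field k] {G : Type*} [Group G] [Fintype G]
    {P : Type*} [AddCommGroup P] [Module k P] [Module (MonoidAlgebra k G) P]
    [IsScalarTower k (MonoidAlgebra k G) P] [Module.Projective (MonoidAlgebra k G) P] :
    ∃ θ : P →ₗ[k] P, ∀ x, ∑ g : G, (MonoidAlgebra.single g (1 : k)) •
      (θ ((MonoidAlgebra.single g⁻¹ (1 : k)) • x)) = x := by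
  classical
  obtain ⟨s, hs⟩ := Module.projective_def'.mp
    (inferInstance : Module.Projective (MonoidAlgebra k G) P)
  let e : MonoidAlgebra k G →ₗ[k] k :=
    Finsupp.lapply (1 : G) ∘ₗ (MonoidAlgebra.coeffLinearEquiv k).toLinearMap
  have he : ∀ a, e a = a.coeff 1 := fun a => rfl
  let θ : P →ₗ[k] P := Finsupp.linearCombination k id ∘ₗ
    Finsupp.mapRange.linearMap e ∘ₗ s.restrictScalars k
  have hθ : ∀ x, θ x = (s x).sum (fun p a => e a • p) := by
    intro x
    simp only [θ, LinearMap.comp_apply, Finsupp.linearCombination_apply]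
    simp only [Finsupp.mapRange.linearMap_apply]
    rw [Finsupp.sum_mapRange_index (by simp)]
    rfl
  have hA : ∀ a : MonoidAlgebra k G, ∑ g : G, a.coeff g • MonoidAlgebra.single g (1 : k) = a := by
    intro a
    ext g
    simp [MonoidAlgebra.coeff_sum]
  refine ⟨θ, fun x => ?_⟩
  have h1 : ∀ g : G, (MonoidAlgebra.single g (1 : k)) •
      (θ ((MonoidAlgebra.single g⁻¹ (1 : k)) • x)) =
      ∑ p ∈ (s x).support, ((s x p).coeff g • MonoidAlgebra.single g (1 : k)) • p := by
    intro g
    rw [hθ, map_smul, Finsupp.sum_of_support_subset (s := (s x).support), Finset.smul_sum]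
    · refine Finset.sum_congr rfl fun p _ => ?_
      rw [Finsupp.smul_apply, smul_eq_mul, he, smul_assoc, smul_comm]
      have : (MonoidAlgebra.single g⁻¹ (1 : k) * (s x) p).coeff 1 = ((s x) p).coeff g := by
        simp
      rw [this]
    · exact Finsupp.support_smul
    · simp
  rw [Finset.sum_congr rfl (fun g _ => h1 g), Finset.sum_comm]
  simp only [← Finset.sum_smul, hA]
  have := LinearMap.congr_fun hs x
  simpa [Finsupp.linearCombination_apply, Finsupp.sum] using this

lemma key_abs {k : Type*} [Field k] {G : Type*} [Group G] [Finite G] (H : Subgroup G)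
    (hH : (Nat.card H : k) ≠ 0)
    {X : Type*} [AddCommGroup X] [Module k X] [Module (MonoidAlgebra k G) X]
    [IsScalarTower k (MonoidAlgebra k G) X]
    (hX : IsIndecomposableModule (MonoidAlgebra k G) X)
    (b : Basis (G ⧸ H) k X)
    (hb : ∀ (g : G) (c : G ⧸ H), MonoidAlgebra.single g (1 : k) • b c = b (g • c))
    {P S : Type*} [AddCommGroup P] [AddCommGroup S]
    [Module k P] [Module k S] [Module (MonoidAlgebra k G) P] [Module (MonoidAlgebra k G) S]
    [IsScalarTower k (MonoidAlgebra k G) P] [IsScalarTower k (MonoidAlgebra k G) S]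
    [FiniteDimensional k P] [FiniteDimensional k S]
    [Module.Projective (MonoidAlgebra k G) P] [IsSimpleModule (MonoidAlgebra k G) S]
    (f : P →ₗ[MonoidAlgebra k G] S) (hf : f ≠ 0) :
    Nat.card (G ⧸ H) ≤ finrank k S * finrank k P := by
  have : Fintype G := Fintype.ofFinite _
  have := IsSimpleModule.nontrivial (MonoidAlgebra k G) S
  obtain ⟨θ, hθ⟩ := higman (k := k) (G := G) (P := P)
  have : FiniteDimensional k X := Module.Finite.of_basis b
  have : IsNoetherian (MonoidAlgebra k G) X := isNoetherian_of_tower k inferInstance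
  have : IsArtinian (MonoidAlgebra k G) X := isArtinian_of_tower k inferInstance
  refine key_rep H hH (Representation.ofModule' P) (Representation.ofModule' S)
    (Representation.ofModule' X) b hb (f.restrictScalars k) ?_ ?_ θ hθ ?_
  · intro g x
    exact f.map_smul _ _
  · exact f.surjective_of_ne_zero hf
  · intro φ hφ hn
    let ψ : Module.End (MonoidAlgebra k G) X :=
      MonoidAlgebra.equivariantOfLinearOfComm φ (fun g v => hφ g v)
    have hpow : ∀ n : ℕ, ∀ x, (ψ ^ n) x = (φ ^ n) x := by
      intro n
      induction n with
      | zero => intro x; rfl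
      | succ n ih =>
        intro x
        rw [pow_succ, pow_succ, Module.End.mul_apply, Module.End.mul_apply]
        exact ih _
    exact fitting_aux hX ψ (fun n h0 => hn n (by
      ext x
      rw [← hpow, h0]; rfl))

lemma key_mod {k : Type*} [Field k] {G : Type*} [Group G] [Finite G] (H : Subgroup G)
    (hH : (Nat.card H : k) ≠ 0)
    (hX : IsIndecomposableModule (MonoidAlgebra k G) (PermMod k H))
    {P S : Type*} [AddCommGroup P] [AddCommGroup S]
    [Module k P] [Module k S] [Module (MonoidAlgebra k G) P] [Module (MonoidAlgebra k G) S]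
    [IsScalarTower k (MonoidAlgebra k G) P] [IsScalarTower k (MonoidAlgebra k G) S]
    [FiniteDimensional k P] [FiniteDimensional k S]
    [Module.Projective (MonoidAlgebra k G) P] [IsSimpleModule (MonoidAlgebra k G) S]
    (f : P →ₗ[MonoidAlgebra k G] S) (hf : f ≠ 0) :
    Nat.card (G ⧸ H) ≤ finrank k S * finrank k P := by
  let b : Basis (G ⧸ H) k (PermMod k H) := Basis.ofRepr
    ((Representation.asModuleEquiv _).trans (MonoidAlgebra.coeffLinearEquiv k))
  have hb : ∀ (g : G) (c : G ⧸ H), MonoidAlgebra.single g (1 : k) • b c = b (g • c) := by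
    intro g c
    rw [Representation.single_smul, one_smul]
    exact Representation.ofMulAction_single g c (1 : k)
  have ht : IsScalarTower k (MonoidAlgebra k G) (PermMod k H) := inferInstance
  exact @key_abs k _ G _ _ H hH (PermMod k H) _ _ _ ht hX b hb P S _ _ _ _ _ _ _ _ _ _ _ _ f hf

section
variable {k A : Type*} [Field k] [Ring A] [Algebra k A]

lemma hom_finite {P S : Type*} [AddCommGroup P] [AddCommGroup S]
    [Module k P] [Module k S] [Module A P] [Module A S]
    [IsScalarTower k A P] [IsScalarTower k A S]
    [FiniteDimensional k P] [FiniteDimensional k S] : FiniteDimensional k (P →ₗ[A] S) :=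
  FiniteDimensional.of_injective (LinearMap.restrictScalarsₗ k A P S k)
    (LinearMap.restrictScalars_injective k)

/-- Two nonzero maps from an indecomposable projective to simples have the same kernel. -/
lemma ker_eq {P S T : Type*} [AddCommGroup P] [AddCommGroup S] [AddCommGroup T]
    [Module A P] [Module A S] [Module A T] [IsNoetherian A P] [IsArtinian A P]
    [Module.Projective A P] [IsSimpleModule A S] [IsSimpleModule A T]
    (hP : IsIndecomposableModule A P) (f : P →ₗ[A] S) (g : P →ₗ[A] T) (hf : f ≠ 0) (hg : g ≠ 0) :
    LinearMap.ker f = LinearMap.ker g := by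
  have hfs := f.surjective_of_ne_zero hf
  have hgs := g.surjective_of_ne_zero hg
  by_contra hne
  have hcf : IsCoatom (LinearMap.ker f) := LinearMap.isCoatom_ker_of_surjective hfs
  have hcg : IsCoatom (LinearMap.ker g) := LinearMap.isCoatom_ker_of_surjective hgs
  have hsup := hcf.sup_eq_top_of_ne hcg hne
  have hsur : Function.Surjective (f.prod g) := by
    rintro ⟨s, t⟩
    obtain ⟨x, rfl⟩ := hfs s
    obtain ⟨y, rfl⟩ := hgs t
    have hx : x - y ∈ LinearMap.ker f ⊔ LinearMap.ker g := hsup ▸ Submodule.mem_top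
    obtain ⟨u, hu, v, hv, huv⟩ := Submodule.mem_sup.mp hx
    refine ⟨x - u, ?_⟩
    have h2 : x - u = y + v := by rw [sub_eq_iff_eq_add, add_assoc, add_comm v, huv]; abel
    have hu' : f u = 0 := hu
    have hv' : g v = 0 := hv
    ext
    · simp [hu']
    · simp only [LinearMap.prod_apply]
      rw [h2]; simp [hv']
  obtain ⟨h, hh⟩ := Module.projective_lifting_property (f.prod g) (f.prod 0) hsur
  have h1 : ∀ x, f (h x) = f x := fun x => congrArg Prod.fst (LinearMap.congr_fun hh x)
  have h2 : ∀ x, g (h x) = 0 := fun x => congrArg Prod.snd (LinearMap.congr_fun hh x)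
  have hn : ∀ n : ℕ, ∀ x, f ((h ^ n : Module.End A P) x) = f x := by
    intro n
    induction n with
    | zero => intro x; rfl
    | succ n ih => intro x; rw [pow_succ, Module.End.mul_apply, ih, h1]
  have hinj := fitting_aux hP h (fun n h0 => hf (by ext x; rw [← hn n x, h0]; simp))
  have hsurj : Function.Surjective h := IsArtinian.surjective_of_injective_endomorphism h hinj
  exact hg (by ext x; obtain ⟨y, rfl⟩ := hsurj x; rw [h2]; rfl)

lemma equiv_of_ker_eq {P S T : Type*} [AddCommGroup P] [AddCommGroup S] [AddCommGroup T]
    [Module A P] [Module A S] [Module A T]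
    (f : P →ₗ[A] S) (g : P →ₗ[A] T) (hf : Function.Surjective f) (hg : Function.Surjective g)
    (h : LinearMap.ker f = LinearMap.ker g) : ∃ e : S ≃ₗ[A] T, ∀ x, e (f x) = g x := by
  refine ⟨(f.quotKerEquivOfSurjective hf).symm.trans ((Submodule.quotEquivOfEq _ _ h).trans
    (g.quotKerEquivOfSurjective hg)), fun x => ?_⟩
  have : (f.quotKerEquivOfSurjective hf).symm (f x) = Submodule.Quotient.mk x := by
    rw [LinearEquiv.symm_apply_eq]; rfl
  simp [this]

lemma hom_le_one [IsAlgClosed k] {P S : Type*} [AddCommGroup P] [AddCommGroup S]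
    [Module k P] [Module k S] [Module A P] [Module A S]
    [IsScalarTower k A P] [IsScalarTower k A S]
    [FiniteDimensional k P] [FiniteDimensional k S]
    [Module.Projective A P] [IsSimpleModule A S]
    (hP : IsIndecomposableModule A P) : finrank k (P →ₗ[A] S) ≤ 1 := by
  have : IsNoetherian A P := isNoetherian_of_tower k inferInstance
  have : IsArtinian A P := isArtinian_of_tower k inferInstance
  by_cases h : ∃ f : P →ₗ[A] S, f ≠ 0
  · obtain ⟨f, hf⟩ := h
    refine finrank_le_one f fun g => ?_
    by_cases hg : g = 0
    · exact ⟨0, by simp [hg]⟩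
    obtain ⟨e, he⟩ := equiv_of_ker_eq f g (f.surjective_of_ne_zero hf)
      (g.surjective_of_ne_zero hg) (ker_eq hP f g hf hg)
    obtain ⟨c, hc⟩ := (IsSimpleModule.algebraMap_end_bijective_of_isAlgClosed
      (A := A) (V := S) k).2 e.toLinearMap
    refine ⟨c, ?_⟩
    ext x
    rw [← he x]
    exact LinearMap.congr_fun hc (f x)
  · push Not at h
    refine finrank_le_one 0 fun g => ⟨0, by simp [h g]⟩

lemma hom_add {P S : Type*} [AddCommGroup P] [AddCommGroup S]
    [Module k P] [Module k S] [Module A P] [Module A S]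
    [IsScalarTower k A P] [IsScalarTower k A S]
    [FiniteDimensional k P] [FiniteDimensional k S] (N N' : Submodule A P) (h : N ⊔ N' = ⊤) :
    finrank k (P →ₗ[A] S) ≤ finrank k (N →ₗ[A] S) + finrank k (N' →ₗ[A] S) := by
  have : FiniteDimensional k N := FiniteDimensional.of_injective (N.subtype.restrictScalars k) N.subtype_injective
  have : FiniteDimensional k N' := FiniteDimensional.of_injective (N'.subtype.restrictScalars k) N'.subtype_injective
  have : FiniteDimensional k (N →ₗ[A] S) := hom_finite
  have : FiniteDimensional k (N' →ₗ[A] S) := hom_finite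
  let Φ : (P →ₗ[A] S) →ₗ[k] (N →ₗ[A] S) × (N' →ₗ[A] S) :=
    { toFun := fun f => (f ∘ₗ N.subtype, f ∘ₗ N'.subtype)
      map_add' := fun _ _ => rfl
      map_smul' := fun _ _ => rfl }
  rw [← Module.finrank_prod]
  refine LinearMap.finrank_le_finrank_of_injective (f := Φ) fun f g hfg => ?_
  have h1 : f ∘ₗ N.subtype = g ∘ₗ N.subtype := congrArg Prod.fst hfg
  have h2 : f ∘ₗ N'.subtype = g ∘ₗ N'.subtype := congrArg Prod.snd hfg
  ext x
  obtain ⟨u, hu, v, hv, rfl⟩ := Submodule.mem_sup.mp (h ▸ Submodule.mem_top : x ∈ N ⊔ N')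
  rw [map_add, map_add]
  exact congrArg₂ _ (LinearMap.congr_fun h1 ⟨u, hu⟩) (LinearMap.congr_fun h2 ⟨v, hv⟩)

lemma compl_dim {P : Type*} [AddCommGroup P]
    [Module k P] [Module A P] [IsScalarTower k A P]
    [FiniteDimensional k P] (N N' : Submodule A P) (h : IsCompl N N') :
    FiniteDimensional k N ∧ FiniteDimensional k N' ∧
    finrank k N + finrank k N' = finrank k P := by
  have h1 : FiniteDimensional k N := FiniteDimensional.of_injective (N.subtype.restrictScalars k) N.subtype_injective
  have h2 : FiniteDimensional k N' := FiniteDimensional.of_injective (N'.subtype.restrictScalars k) N'.subtype_injective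
  refine ⟨h1, h2, ?_⟩
  rw [← Module.finrank_prod]
  exact ((N.prodEquivOfIsCompl N' h).restrictScalars k).finrank_eq

lemma proj_compl {P : Type*} [AddCommGroup P] [Module A P] [Module.Projective A P]
    (N N' : Submodule A P) (h : IsCompl N N') : Module.Projective A N :=
  Module.Projective.of_split N.subtype (N.projectionOnto N' h) (by ext x; simp)

lemma main_ind [IsAlgClosed k] (c : ℕ) {m : ℕ} (S : Fin m → Type*) [∀ i, AddCommGroup (S i)]
    [∀ i, Module k (S i)] [∀ i, Module A (S i)] [∀ i, IsScalarTower k A (S i)]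
    [∀ i, FiniteDimensional k (S i)] [∀ i, IsSimpleModule A (S i)]
    (hnoniso : ∀ i j, i ≠ j → IsEmpty (S i ≃ₗ[A] S j)) 
    (n : ℕ) : ∀ (P : Type*) [AddCommGroup P] [Module k P] [Module A P] [IsScalarTower k A P]
      [FiniteDimensional k P] [Module.Projective A P]
      (_ : ∀ (Q : Submodule A P), Module.Projective A Q → ∀ i, (∃ f : Q →ₗ[A] S i, f ≠ 0) →
        c ≤ finrank k (S i) * finrank k Q)
      (_ : finrank k P = n),
      ∑ i, (finrank k (P →ₗ[A] S i) : ℚ) * (c / finrank k (S i)) ≤ finrank k P := by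
  induction n using Nat.strong_induction_on with
  | _ n ih =>
  intro P _ _ _ _ _ _ hc hn
  by_cases hdec : ∃ N N' : Submodule A P, IsCompl N N' ∧ N ≠ ⊥ ∧ N' ≠ ⊥
  · obtain ⟨N, N', hcomp, hN, hN'⟩ := hdec
    obtain ⟨h1, h2, h3⟩ := compl_dim (k := k) N N' hcomp
    have p1 := proj_compl N N' hcomp
    have p2 := proj_compl N' N hcomp.symm
    have e1 : Nontrivial N := Submodule.nontrivial_iff_ne_bot.mpr hN
    have e2 : Nontrivial N' := Submodule.nontrivial_iff_ne_bot.mpr hN'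
    have d1 : 0 < finrank k N := finrank_pos
    have d2 : 0 < finrank k N' := finrank_pos
    have key : ∀ (M : Submodule A P) (Q : Submodule A M), Module.Projective A Q →
        ∀ i, (∃ f : Q →ₗ[A] S i, f ≠ 0) → c ≤ finrank k (S i) * finrank k Q := by
      intro M Q hQ i ⟨f, hf⟩
      let e : Q ≃ₗ[A] Q.map M.subtype :=
        Submodule.equivMapOfInjective M.subtype M.subtype_injective Q
      rw [(e.restrictScalars k).finrank_eq]
      refine hc (Q.map M.subtype) (Module.Projective.of_equiv e) i
        ⟨f ∘ₗ e.symm.toLinearMap, fun h0 => hf ?_⟩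
      ext x
      have := LinearMap.congr_fun h0 (e x)
      simpa using this
    have i1 := ih (finrank k N) (by omega) N (key N) rfl
    have i2 := ih (finrank k N') (by omega) N' (key N') rfl
    have h3' : (finrank k N : ℚ) + finrank k N' = finrank k P := by exact_mod_cast h3
    rw [← h3']
    refine le_trans ?_ (add_le_add i1 i2)
    rw [← Finset.sum_add_distrib]
    refine Finset.sum_le_sum fun i _ => ?_
    rw [← add_mul]
    refine mul_le_mul_of_nonneg_right ?_ (by positivity)
    exact_mod_cast hom_add (k := k) (S := S i) N N' hcomp.sup_eq_top
  · push Not at hdec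
    by_cases hex : ∃ i, ∃ f : P →ₗ[A] S i, f ≠ 0
    · obtain ⟨i, f, hf⟩ := hex
      have hP : IsIndecomposableModule A P := by
        refine ⟨?_, fun N N' h => ?_⟩
        · by_contra hnt
          rw [not_nontrivial_iff_subsingleton] at hnt
          exact hf (Subsingleton.elim _ _)
        · by_contra hh
          push Not at hh
          exact hh.2 (hdec N N' h hh.1)
      have : IsNoetherian A P := isNoetherian_of_tower k inferInstance
      have : IsArtinian A P := isArtinian_of_tower k inferInstance
      rw [Finset.sum_eq_single i]
      · have h1 : (finrank k (P →ₗ[A] S i) : ℚ) ≤ 1 := by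
          exact_mod_cast hom_le_one (k := k) (S := S i) hP
        have h2 : c ≤ finrank k (S i) * finrank k P := by
          have := hc ⊤ (Module.Projective.of_equiv Submodule.topEquiv.symm) i
            ⟨f ∘ₗ Submodule.topEquiv.toLinearMap, fun h0 => hf (by
              ext x
              exact LinearMap.congr_fun h0 ⟨x, trivial⟩)⟩
          rwa [((Submodule.topEquiv (R := A) (M := P)).restrictScalars k).finrank_eq] at this
        have := IsSimpleModule.nontrivial A (S i)
        have d1 : 0 < finrank k (S i) := finrank_pos
        have d1' : (0 : ℚ) < finrank k (S i) := by exact_mod_cast d1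
        refine le_trans (mul_le_of_le_one_left (by positivity) h1) ?_
        rw [div_le_iff₀ d1', mul_comm]
        exact_mod_cast h2
      · intro j _ hj
        have : finrank k (P →ₗ[A] S j) = 0 := by
          have hz : ∀ g : P →ₗ[A] S j, g = 0 := by
            intro g
            by_contra hg
            obtain ⟨e, -⟩ := equiv_of_ker_eq f g (f.surjective_of_ne_zero hf)
              (g.surjective_of_ne_zero hg) (ker_eq hP f g hf hg)
            exact (hnoniso i j hj.symm).false e
          have : Subsingleton (P →ₗ[A] S j) := ⟨fun a b => by rw [hz a, hz b]⟩
          exact finrank_zero_of_subsingleton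
        simp [this]
      · simp
    · push Not at hex
      have hz : ∀ i, finrank k (P →ₗ[A] S i) = 0 := by
        intro i
        have : Subsingleton (P →ₗ[A] S i) := ⟨fun a b => by rw [hex i a, hex i b]⟩
        exact finrank_zero_of_subsingleton
      simp [hz]
end

/-- If `G` has property `(I_p)` with respect to `H`, then the number of isomorphism classes of
simple `k[G]`-modules is at most `|H|`: any family of pairwise non-isomorphic simple
`k[G]`-modules has size at most `|H|`. -/
theorem stmt6 (k : Type) [Field k] (p : ℕ) [Fact p.Prime] [IsAlgClosed k] [CharP k p]
    (G : Type) [Group G] [Finite G] (H : Subgroup G) (hG : HasIp k p H)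
    (m : ℕ) (S : Fin m → Type) [∀ i, AddCommGroup (S i)]
    [∀ i, Module (MonoidAlgebra k G) (S i)]
    (hsimple : ∀ i, IsSimpleModule (MonoidAlgebra k G) (S i))
    (hnoniso : ∀ i j, i ≠ j → IsEmpty (S i ≃ₗ[MonoidAlgebra k G] S j)) :
    m ≤ Nat.card H := by
  classical
  have hH : (Nat.card H : k) ≠ 0 := fun h => hG.1 ((CharP.cast_eq_zero_iff k p _).mp h)
  have : Fintype G := Fintype.ofFinite _
  letI : ∀ i, Module k (S i) := fun i => Module.compHom (S i) (algebraMap k (MonoidAlgebra k G))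
  haveI : ∀ i, IsScalarTower k (MonoidAlgebra k G) (S i) := fun i =>
    ⟨fun a x y => by
      rw [Algebra.smul_def, mul_smul]; rfl⟩
  let bA : Module.Basis G k (MonoidAlgebra k G) :=
    Module.Basis.ofRepr (MonoidAlgebra.coeffLinearEquiv k)
  haveI : FiniteDimensional k (MonoidAlgebra k G) := Module.Finite.of_basis bA
  haveI : ∀ i, FiniteDimensional k (S i) := fun i => by
    haveI := hsimple i
    exact Module.Finite.trans (MonoidAlgebra k G) (S i)
  have hmain := main_ind (k := k) (A := MonoidAlgebra k G) (Nat.card (G ⧸ H)) S hnoniso _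
    (MonoidAlgebra k G) (fun Q hQ i ⟨f, hf⟩ => by
      haveI : FiniteDimensional k Q := FiniteDimensional.of_injective
        (Q.subtype.restrictScalars k) Q.subtype_injective
      exact key_mod H hH hG.2 f hf) rfl
  have hdim : ∀ i, (finrank k (MonoidAlgebra k G →ₗ[MonoidAlgebra k G] S i) : ℚ) *
      ((Nat.card (G ⧸ H) : ℚ) / finrank k (S i)) = Nat.card (G ⧸ H) := by
    intro i
    rw [(LinearMap.ringLmapEquivSelf (MonoidAlgebra k G) k (S i)).finrank_eq]
    have := IsSimpleModule.nontrivial (MonoidAlgebra k G) (S i)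
    have d1 : finrank k (S i) ≠ 0 := finrank_pos.ne'
    field_simp
  rw [Finset.sum_congr rfl (fun i _ => hdim i), Module.finrank_eq_nat_card_basis bA,
    Subgroup.card_eq_card_quotient_mul_card_subgroup H] at hmain
  simp only [Finset.sum_const, Finset.card_univ, Fintype.card_fin, nsmul_eq_mul] at hmain
  have h2 : m * Nat.card (G ⧸ H) ≤ Nat.card (G ⧸ H) * Nat.card H := by exact_mod_cast hmain
  rw [mul_comm] at h2
  exact Nat.le_of_mul_le_mul_left h2 Nat.card_pos
end

section
/- Let G be a finite group having property (I_p) with respect to a subgroup H. Then for every simple kG-module S that is projective as a kG-module (i.e. corresponds to a p-defect zero character), the index satisfies |G : H| ≤ (dim_k S)^2. -/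
/-- Linear extension of a map on a basis to the free module `k[X]`. -/
noncomputable def mlc (k : Type) [Field k] {X V : Type} [AddCommGroup V] [Module k V] (F : X → V) :
    MonoidAlgebra k X →ₗ[k] V :=
  Finsupp.linearCombination k F ∘ₗ (MonoidAlgebra.coeffLinearEquiv k).toLinearMap

theorem mlc_single (k : Type) [Field k] {X V : Type} [AddCommGroup V] [Module k V] (F : X → V)
    (x : X) (r : k) : mlc k F (MonoidAlgebra.single x r) = r • F x := by
  simp [mlc]

theorem aux_theta (k : Type) [Field k] 
    (G : Type) [Group G] [Fintype G] 
    (S : Type) [AddCommGroup S] [Module k S] [Module (MonoidAlgebra k G) S]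
    [IsScalarTower k (MonoidAlgebra k G) S]
    [IsSimpleModule (MonoidAlgebra k G) S] (hproj : Module.Projective (MonoidAlgebra k G) S) :
    ∃ (T : G →* Module.End k S) (θ : Module.End k S),
      ∑ g, T g * θ * T g⁻¹ = 1 := by
  obtain ⟨v0, hv0⟩ := @exists_ne S (IsSimpleModule.nontrivial (MonoidAlgebra k G) S) 0
  have hs := IsSimpleModule.toSpanSingleton_surjective (MonoidAlgebra k G) hv0
  obtain ⟨s, hs⟩ := Module.projective_lifting_property _
    (LinearMap.id : S →ₗ[MonoidAlgebra k G] S) hs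
  let T : G →* Module.End k S :=
    ((Algebra.lsmul k k S).toMonoidHom : MonoidAlgebra k G →* Module.End k S).comp
      (MonoidAlgebra.of k G)
  have hT : ∀ g v, T g v = MonoidAlgebra.single g (1 : k) • v := fun g v => rfl
  let c : MonoidAlgebra k G →ₗ[k] k :=
    { toFun := fun a => a.coeff 1
      map_add' := fun a b => by simp
      map_smul' := fun a b => by simp }
  let θ : Module.End k S := (c ∘ₗ s.restrictScalars k).smulRight v0
  refine ⟨T, θ, ?_⟩
  ext v
  have h1 : ∀ g, (T g * θ * T g⁻¹) v = (MonoidAlgebra.single g ((s v).coeff g)) • v0 := by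
    intro g
    have : θ (T g⁻¹ v) = ((s v).coeff g) • v0 := by
      change (s (T g⁻¹ v)).coeff 1 • v0 = _
      rw [hT, map_smul, smul_eq_mul, MonoidAlgebra.coeff_single_mul_apply]
      simp
    rw [Module.End.mul_apply, Module.End.mul_apply, this, map_smul, hT, ← smul_assoc]
    simp
  rw [LinearMap.sum_apply, Finset.sum_congr rfl (fun g _ => h1 g), ← Finset.sum_smul]
  have h2 : ∑ g, MonoidAlgebra.single g ((s v).coeff g) = s v := by
    ext x
    classical
    simp
  rw [h2]
  exact DFunLike.congr_fun hs v

theorem aux_maps (k : Type) [Field k] (p : ℕ) [CharP k p]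
    (G : Type) [Group G] [Fintype G] (H : Subgroup G) (hH : ¬ p ∣ Nat.card H)
    (S : Type) [AddCommGroup S] [Module k S] [Nontrivial S] [Module.Finite k S]
    (T : G →* Module.End k S) (θ : Module.End k S) (hθ : ∑ g, T g * θ * T g⁻¹ = 1) :
    ∃ (f : MonoidAlgebra k (G ⧸ H) →ₗ[k] Module.End k S) (e : Module.End k S →ₗ[k] MonoidAlgebra k (G ⧸ H)),
      (∀ g v, f (Representation.ofMulAction k G (G ⧸ H) g v) = T g * f v * T g⁻¹) ∧
      (∀ g m, e (T g * m * T g⁻¹) = Representation.ofMulAction k G (G ⧸ H) g (e m)) ∧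
      (∀ v, mlc k (fun _ => (1:k)) (e (f v)) =
        mlc k (fun _ => (1:k)) v) := by
  classical
  have hcan : ∀ g, T g * T g⁻¹ = 1 := fun g => by rw [← map_mul]; simp
  have hcan' : ∀ g, T g⁻¹ * T g = 1 := fun g => by rw [← map_mul]; simp
  have htr : ∀ g m, LinearMap.trace k S (T g * m * T g⁻¹) = LinearMap.trace k S m := by
    intro g m
    rw [LinearMap.trace_mul_comm, ← mul_assoc, hcan', one_mul]
  obtain ⟨y, hy⟩ : ∃ y : Module.End k S, LinearMap.trace k S y = 1 := by
    obtain ⟨v0, hv0⟩ := exists_ne (0 : S)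
    obtain ⟨φ, hφ⟩ := Module.Projective.exists_dual_ne_zero k hv0
    refine ⟨φ.smulRight ((φ v0)⁻¹ • v0), ?_⟩
    rw [LinearMap.trace_smulRight]
    simp [hφ]
  have hHk : (Nat.card H : k) ≠ 0 := by
    rwa [Ne, CharP.cast_eq_zero_iff k p]
  let x : Module.End k S := (Nat.card H : k)⁻¹ • ∑ h : H, T h * y * T (h : G)⁻¹
  have hx : LinearMap.trace k S x = 1 := by
    simp only [x, map_smul, map_sum, htr, hy]
    simp only [Finset.sum_const, Finset.card_univ, nsmul_eq_mul, mul_one, smul_eq_mul,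
      ← Nat.card_eq_fintype_card]
    exact inv_mul_cancel₀ hHk
  have hxH : ∀ h : H, T h * x * T (h : G)⁻¹ = x := by
    intro h
    simp only [x, mul_smul_comm, smul_mul_assoc, Finset.mul_sum, Finset.sum_mul]
    congr 1
    refine Fintype.sum_equiv (Equiv.mulLeft h) _ _ (fun h' => ?_)
    simp [mul_assoc]
  let F : G ⧸ H → Module.End k S := fun q => T q.out * x * T (q.out)⁻¹
  have hF : ∀ g : G, F (g : G ⧸ H) = T g * x * T g⁻¹ := by
    intro g
    obtain ⟨h, hh⟩ := QuotientGroup.mk_out_eq_mul H g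
    simp only [F, hh]
    conv_rhs => rw [← hxH h]
    simp [mul_assoc]
  let f : MonoidAlgebra k (G ⧸ H) →ₗ[k] Module.End k S := mlc k F
  let e : Module.End k S →ₗ[k] MonoidAlgebra k (G ⧸ H) :=
    ∑ g : G, (LinearMap.trace k S ∘ₗ LinearMap.mulLeft k (T g * θ * T g⁻¹)).smulRight
      (MonoidAlgebra.single (g : G ⧸ H) (1 : k))
  have he : ∀ m, e m = ∑ g : G, MonoidAlgebra.single (g : G ⧸ H)
      (LinearMap.trace k S (T g * θ * T g⁻¹ * m)) := by
    intro m
    simp [e, LinearMap.sum_apply, mul_assoc]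
  have heps : ∀ m, mlc k (fun _ => (1:k)) (e m) = LinearMap.trace k S m := by
    intro m
    rw [he]
    simp only [map_sum, mlc_single, smul_eq_mul, mul_one]
    rw [← map_sum, ← Finset.sum_mul, hθ, one_mul]
  refine ⟨f, e, ?_, ?_, ?_⟩
  · intro g v
    induction v using MonoidAlgebra.induction_linear with
    | zero => simp
    | add a b ha hb => simp only [map_add, ha, hb, mul_add, add_mul]
    | single q r =>
      induction q using QuotientGroup.induction_on with
      | H a =>
        rw [Representation.ofMulAction_single]
        simp only [f, mlc_single, mul_smul_comm, smul_mul_assoc]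
        rw [MulAction.Quotient.smul_coe, hF, hF]
        simp [mul_assoc]
  · intro g m
    rw [he, he, map_sum]
    symm
    refine Fintype.sum_equiv (Equiv.mulLeft g) _ _ (fun a => ?_)
    rw [Representation.ofMulAction_single, MulAction.Quotient.smul_coe]
    simp only [Equiv.coe_mulLeft, smul_eq_mul]
    congr 1
    rw [← htr g]
    congr 1
    simp only [map_mul, mul_inv_rev, mul_assoc]
    congr 4
    rw [← mul_assoc (T g⁻¹), hcan', one_mul]
  · intro v
    rw [heps]
    induction v using MonoidAlgebra.induction_linear with
    | zero => simp
    | add a b ha hb => simp only [map_add, ha, hb]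
    | single q r =>
      simp only [f, F, mlc_single, map_smul, htr, hx]

/-- If `G` has property `(I_p)` with respect to `H`, then for every simple projective
`k[G]`-module `S` (i.e. one affording a `p`-defect zero character),
`|G : H| ≤ (dim_k S)^2`. -/
theorem stmt7 (k : Type) [Field k] (p : ℕ) [Fact p.Prime] [IsAlgClosed k] [CharP k p]
    (G : Type) [Group G] [Finite G] (H : Subgroup G) (hG : HasIp k p H)
    (S : Type) [AddCommGroup S] [Module k S] [Module (MonoidAlgebra k G) S]
    [IsScalarTower k (MonoidAlgebra k G) S]
    [IsSimpleModule (MonoidAlgebra k G) S] (hproj : Module.Projective (MonoidAlgebra k G) S) :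
    H.index ≤ (Module.finrank k S) ^ 2 := by
  have := Fintype.ofFinite G
  have : Nontrivial S := IsSimpleModule.nontrivial (MonoidAlgebra k G) S
  have : Module.Finite k (MonoidAlgebra k G) := inferInstance
  have : Module.Finite k S := Module.Finite.trans (MonoidAlgebra k G) S
  obtain ⟨T, θ, hθ⟩ := aux_theta k G S hproj
  obtain ⟨hH, hnt, hind⟩ := hG
  obtain ⟨f, e, hf, he, hfe⟩ := aux_maps k p G H hH S T θ hθ
  let ρ := Representation.ofMulAction k G (G ⧸ H)
  let h0 : PermMod k H →ₗ[k] PermMod k H :=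
    ρ.asModuleEquiv.symm.toLinearMap ∘ₗ e ∘ₗ f ∘ₗ ρ.asModuleEquiv.toLinearMap
  let h : Module.End (MonoidAlgebra k G) (PermMod k H) :=
    MonoidAlgebra.equivariantOfLinearOfComm h0 (by
      intro g v
      rw [Representation.single_smul, Representation.single_smul, one_smul, one_smul]
      exact (congrArg e (hf g (ρ.asModuleEquiv v))).trans (he g (f (ρ.asModuleEquiv v))))
  have hh : ∀ v, h v = e (f v) := fun v => rfl
  have hN : IsNoetherian (MonoidAlgebra k G) (PermMod k H) := isNoetherian_of_tower k inferInstance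
  have hA : IsArtinian (MonoidAlgebra k G) (PermMod k H) := isArtinian_of_tower k inferInstance
  let ε : MonoidAlgebra k (G ⧸ H) →ₗ[k] k := mlc k (fun _ => (1:k))
  have hpow : ∀ (n : ℕ) (v : PermMod k H), ε ((h ^ n) v) = ε v := by
    intro n
    induction n with
    | zero => intro v; rfl
    | succ n ih =>
      intro v
      rw [pow_succ, Module.End.mul_apply, ih, hh]
      exact hfe v
  obtain ⟨n, hn⟩ := Filter.eventually_atTop.mp h.eventually_isCompl_ker_pow_range_pow
  have hinj : Function.Injective f := by
    rcases hind _ _ (hn (n+1) (by omega)) with h1 | h1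
    · rw [LinearMap.ker_eq_bot] at h1
      intro a b hab
      have key : ∀ a b : PermMod k H, h a = h b → a = b := by
        intro a b hab
        apply h1
        rw [pow_succ, Module.End.mul_apply, Module.End.mul_apply, hab]
      exact key a b (congrArg e hab)
    · exfalso
      rw [LinearMap.range_eq_bot] at h1
      have := hpow (n+1) (MonoidAlgebra.single ((1 : G) : G ⧸ H) (1:k))
      rw [h1] at this
      have h2 : ε (MonoidAlgebra.single ((1 : G) : G ⧸ H) (1:k)) = 1 := by simp [ε, mlc_single]
      rw [h2] at this
      exact zero_ne_one ((map_zero ε).symm.trans this)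
  have := LinearMap.finrank_le_finrank_of_injective hinj
  rw [Module.finrank_linearMap] at this
  have := Fintype.ofFinite (G ⧸ H)
  rw [(MonoidAlgebra.coeffLinearEquiv k : MonoidAlgebra k (G ⧸ H) ≃ₗ[k] _).finrank_eq,
    Module.finrank_finsupp_self, ← Nat.card_eq_fintype_card] at *
  rw [sq]
  exact ‹_›
end

section
/- Let q be a prime power, n ≥ 2, and let p be a prime with p ∣ q−1 and p not dividing n! (so p is coprime to the order of the Weyl group S_n of PSL_n). If G = PSL_n(q) has property (I_p) with respect to a subgroup H, then the full preimage of H in SL_n(F_q) acts irreducibly on the natural module F_q^n, i.e. it stabilizes no subspace of F_q^n other than 0 and F_q^n; equivalently, H is not contained in any proper parabolic subgroup of G. -/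
/-- The projective special linear group `PSL_n(F)`. -/
abbrev PSL (n : ℕ) (F : Type) [Field F] :=
  Matrix.SpecialLinearGroup (Fin n) F ⧸ Subgroup.center (Matrix.SpecialLinearGroup (Fin n) F)


lemma fitting_dichotomy (k : Type) [Field k] {G : Type} [Group G] {V : Type} [AddCommGroup V]
    [Module k V] [Module.Finite k V] (ρ : Representation k G V)
    (hind : IsIndecomposableModule (MonoidAlgebra k G) ρ.asModule)
    (φ : V →ₗ[k] V) (hφ : ∀ g x, φ (ρ g x) = ρ g (φ x)) :
    (∃ N, ∀ x, (φ^[N]) x = 0) ∨ Function.Surjective φ := by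
  let φ' : ρ.asModule →ₗ[k] ρ.asModule :=
    ρ.asModuleEquiv.symm.toLinearMap ∘ₗ φ ∘ₗ ρ.asModuleEquiv.toLinearMap
  have hc : ∀ (g : G) (v : ρ.asModule),
      φ' (MonoidAlgebra.single g (1 : k) • v) = MonoidAlgebra.single g (1 : k) • φ' v := by
    intro g v
    rw [Representation.single_smul, Representation.single_smul, one_smul, one_smul]
    exact hφ g v
  let Φ : Module.End (MonoidAlgebra k G) ρ.asModule :=
    MonoidAlgebra.equivariantOfLinearOfComm φ' hc
  have hΦ : ∀ x : V, Φ x = φ x := fun x => rfl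
  have hpow : ∀ (N : ℕ) (x : V), (Φ ^ N) x = φ^[N] x := by
    intro N x
    exact Module.End.pow_apply Φ N x
  have : IsArtinian (MonoidAlgebra k G) ρ.asModule := isArtinian_of_tower k inferInstance
  have : IsNoetherian (MonoidAlgebra k G) ρ.asModule := isNoetherian_of_tower k inferInstance
  obtain ⟨N, hN⟩ := Filter.eventually_atTop.mp (LinearMap.eventually_isCompl_ker_pow_range_pow Φ)
  have h := hN (N + 1) (Nat.le_succ N)
  rcases hind.2 _ _ h with h1 | h1
  · right
    rw [h1] at h
    have h2 := eq_top_of_bot_isCompl h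
    intro y
    have : (y : ρ.asModule) ∈ LinearMap.range (Φ ^ (N + 1)) := by rw [h2]; trivial
    obtain ⟨x, hx⟩ := this
    rw [pow_succ'] at hx
    exact ⟨(Φ ^ N) x, hx⟩
  · left
    refine ⟨N + 1, fun x => ?_⟩
    rw [LinearMap.range_eq_bot] at h1
    rw [← hpow, h1]
    rfl

lemma not_indecomposable (k : Type) [Field k] (p : ℕ) [CharP k p] {G : Type} [Group G] [Finite G]
    (H P : Subgroup G) (hHP : H ≤ P) (hH : ¬ p ∣ Nat.card H) (hP : ¬ p ∣ P.index) (hPT : P ≠ ⊤) :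
    ¬ IsIndecomposableModule (MonoidAlgebra k G) (PermMod k H) := by
  classical
  intro hind
  have := Fintype.ofFinite G
  have := Fintype.ofFinite (G ⧸ P)
  have := Fintype.ofFinite (G ⧸ H)
  have := Fintype.ofFinite H
  have hHk : (Nat.card H : k) ≠ 0 := fun h => hH ((CharP.cast_eq_zero_iff k p _).1 h)
  have hPk : (P.index : k) ≠ 0 := fun h => hP ((CharP.cast_eq_zero_iff k p _).1 h)
  let ρ := Representation.ofMulAction k G (G ⧸ H)
  let π : G ⧸ H → G ⧸ P := Subgroup.quotientMapOfLE hHP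
  have hπ : ∀ (g : G) (x : G ⧸ H), π (g • x) = g • π x := by
    intro g x
    induction x using QuotientGroup.induction_on with
    | H x => rfl
  let C : MonoidAlgebra k (G ⧸ H) ≃ₗ[k] (G ⧸ H →₀ k) := MonoidAlgebra.coeffLinearEquiv k
  let f : MonoidAlgebra k (G ⧸ H) →ₗ[k] (G ⧸ P →₀ k) := Finsupp.lmapDomain k k π ∘ₗ C.toLinearMap
  have hf : ∀ x c, f (MonoidAlgebra.single x c) = Finsupp.single (π x) c := by
    intro x c
    simp [f, C]
  let c : k := (P.index : k)⁻¹ * (Nat.card H : k)⁻¹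
  let v : MonoidAlgebra k (G ⧸ H) :=
    ∑ h : H, ∑ y : G ⧸ P, MonoidAlgebra.single ((h : G) • ((y.out : G) : G ⧸ H)) c
  let a : G ⧸ P →₀ k := ∑ y : G ⧸ P, Finsupp.single y (P.index : k)⁻¹
  have hρs : ∀ g x c, ρ g (MonoidAlgebra.single x c) = MonoidAlgebra.single (g • x) c :=
    fun g x c => Representation.ofMulAction_single g x c
  have hv : ∀ h : G, h ∈ H → ρ h v = v := by
    intro h hh
    simp only [v, map_sum, hρs, smul_smul]
    exact Fintype.sum_equiv (Equiv.mulLeft (⟨h, hh⟩ : H)) _ _ (fun h' => rfl)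
  have hga : ∀ g : G, ∑ y : G ⧸ P, Finsupp.single (g • y) (P.index : k)⁻¹ = a := by
    intro g
    exact Fintype.sum_equiv (MulAction.toPerm g) _ _ (fun y => rfl)
  have hfv : ∀ g, f (ρ g v) = a := by
    intro g
    have : ∀ y : G ⧸ P, π ((y.out : G) : G ⧸ H) = y := fun y => Quotient.out_eq' y
    simp only [v, map_sum, hρs, hf, hπ, this, smul_smul]
    have h1 : ∀ h : H, ∑ y : G ⧸ P, Finsupp.single ((g * (h : G)) • y) c =
        (Nat.card H : k)⁻¹ • a := by
      intro h
      rw [← hga (g * h), Finset.smul_sum]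
      refine Finset.sum_congr rfl fun y _ => ?_
      rw [Finsupp.smul_single, smul_eq_mul, mul_comm]
    simp only [h1, Finset.sum_const, Finset.card_univ, ← Nat.card_eq_fintype_card]
    rw [← Nat.cast_smul_eq_nsmul k, smul_smul, mul_inv_cancel₀ hHk, one_smul]
  let φ : MonoidAlgebra k (G ⧸ H) →ₗ[k] MonoidAlgebra k (G ⧸ H) :=
    Finsupp.linearCombination k (fun x : G ⧸ H => ρ x.out v) ∘ₗ C.toLinearMap
  have hφs : ∀ x c, φ (MonoidAlgebra.single x c) = c • ρ x.out v := by
    intro x c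
    simp [φ, C]
  have hφg : ∀ g : G, ρ (g : G ⧸ H).out v = ρ g v := by
    intro g
    obtain ⟨h, hh⟩ := QuotientGroup.mk_out_eq_mul H g
    rw [hh, map_mul, Module.End.mul_apply, hv _ h.2]
  have hext : ∀ (Q : MonoidAlgebra k (G ⧸ H) → Prop), (∀ x c, Q (MonoidAlgebra.single x c)) →
      (∀ x y, Q x → Q y → Q (x + y)) → Q 0 → ∀ x, Q x := by
    intro Q h1 h2 h3 x
    have : x = C.symm (C x) := by simp
    rw [this]
    generalize C x = z
    induction z using Finsupp.induction_linear with
    | zero => simpa using h3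
    | add a b ha hb => rw [map_add]; exact h2 _ _ ha hb
    | single x c => exact h1 x c
  have hcomm : ∀ g x, φ (ρ g x) = ρ g (φ x) := by
    intro g
    apply hext
    · intro x c
      rw [hρs, hφs, hφs, map_smul]
      congr 1
      induction x using QuotientGroup.induction_on with
      | H x =>
        rw [hφg x, ← Module.End.mul_apply, ← map_mul, ← hφg (g * x)]
        rfl
    · intro x y hx hy
      simp only [map_add, hx, hy]
    · simp
  let ε : (G ⧸ P →₀ k) →ₗ[k] k := Finsupp.linearCombination k (fun _ => (1 : k))
  have hεa : ε a = 1 := by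
    simp only [a, map_sum, ε, Finsupp.linearCombination_single, smul_eq_mul, mul_one,
      Finset.sum_const, Finset.card_univ, ← Nat.card_eq_fintype_card, nsmul_eq_mul]
    exact mul_inv_cancel₀ hPk
  have hfφ : ∀ x, f (φ x) = ε (f x) • a := by
    apply hext
    · intro x c
      rw [hφs, map_smul, hfv, hf]
      simp [ε]
    · intro x y hx hy
      simp only [map_add, hx, hy, add_smul]
    · simp
  have : Module.Finite k (MonoidAlgebra k (G ⧸ H)) := Module.Finite.equiv C.symm
  rcases fitting_dichotomy k ρ hind φ hcomm with ⟨N, hN⟩ | hs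
  · have h1 : ∀ N x, ε (f (φ^[N] x)) = ε (f x) := by
      intro N
      induction N with
      | zero => intro x; rfl
      | succ N ih =>
        intro x
        rw [Function.iterate_succ_apply, ih, hfφ, map_smul, hεa, smul_eq_mul, mul_one]
    have h2 := h1 N (MonoidAlgebra.single ((1 : G) : G ⧸ H) 1)
    rw [hN, hf] at h2
    simp [ε] at h2
  · obtain ⟨g, hg⟩ : ∃ g, g ∉ P := by
      by_contra! h
      exact hPT (eq_top_iff.2 fun x _ => h x)
    obtain ⟨x, hx⟩ := hs (MonoidAlgebra.single ((1 : G) : G ⧸ H) 1)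
    have h1 := hfφ x
    rw [hx, hf] at h1
    have ha : ∀ y, a y = (P.index : k)⁻¹ := by
      intro y
      simp [a, Finsupp.finsetSum_apply, Finsupp.single_apply]
    have hne : (π ((1 : G) : G ⧸ H)) ≠ (g : G ⧸ P) := by
      intro h
      apply hg
      have := QuotientGroup.eq.1 (h : ((1 : G) : G ⧸ P) = g)
      simpa using this
    have h2 := DFunLike.congr_fun h1 (g : G ⧸ P)
    have h3 := DFunLike.congr_fun h1 (π ((1 : G) : G ⧸ H))
    rw [Finsupp.smul_apply, ha, Finsupp.single_apply, if_neg hne] at h2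
    rw [Finsupp.smul_apply, ha, ← h2, Finsupp.single_eq_same] at h3
    exact one_ne_zero h3

lemma relIndex_dvd_index_right {G : Type} [Group G] [Finite G] (S K : Subgroup G) [K.Normal] :
    S.relIndex K ∣ S.index := by
  obtain ⟨c, hc⟩ := Subgroup.relIndex_dvd_index_of_normal K S
  have h1 : S.relIndex K * K.index = (S ⊓ K).index := by
    rw [← Subgroup.inf_relIndex_right, Subgroup.relIndex_mul_index inf_le_right]
  have h2 : K.relIndex S * S.index = (S ⊓ K).index := by
    rw [← Subgroup.inf_relIndex_left, Subgroup.relIndex_mul_index inf_le_left]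
  have h3 : K.relIndex S ≠ 0 := Subgroup.index_ne_zero_of_finite
  refine ⟨c, ?_⟩
  rw [hc, ← h2] at h1
  apply Nat.eq_of_mul_eq_mul_left (Nat.pos_of_ne_zero h3)
  rw [← h1]
  ring

lemma card_GL_factor (p : ℕ) [Fact p.Prime] (F : Type) [Field F] [Fintype F]
    (n : ℕ) (hpq : p ∣ Fintype.card F - 1) (hpW : ¬ p ∣ n.factorial) :
    ∃ m, ¬ p ∣ m ∧
      Nat.card (Matrix.GeneralLinearGroup (Fin n) F) = (Fintype.card F - 1) ^ n * m := by
  have hp : p.Prime := Fact.out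
  set q := Fintype.card F with hq
  have hq1 : 1 ≤ q := Fintype.card_pos
  refine ⟨∏ i : Fin n, (q ^ (i : ℕ) * ∑ j ∈ Finset.range (n - i), q ^ j), ?_, ?_⟩
  · intro h
    obtain ⟨i, -, hi⟩ := (Prime.dvd_finsetProd_iff hp.prime _).1 h
    rw [← ZMod.natCast_eq_zero_iff] at hi
    have hqp : (q : ZMod p) = 1 := by
      have := (ZMod.natCast_eq_zero_iff (q - 1) p).2 hpq
      rw [Nat.cast_sub hq1, sub_eq_zero] at this
      simpa using this
    push_cast at hi
    simp only [hqp, one_pow, one_mul, Finset.sum_const, Finset.card_range, nsmul_eq_mul,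
      mul_one] at hi
    have h2 := (ZMod.natCast_eq_zero_iff (n - (i : ℕ)) p).1 hi
    exact hpW (h2.trans (Nat.dvd_factorial (by have := i.2; omega) (Nat.sub_le _ _)))
  · rw [Matrix.card_GL_field]
    have h : (q - 1) ^ n = ∏ _i : Fin n, (q - 1) := by simp
    rw [h, ← Finset.prod_mul_distrib]
    refine Finset.prod_congr rfl fun i _ => ?_
    have h1 : (q - 1) * ∑ j ∈ Finset.range (n - i), q ^ j = q ^ (n - (i : ℕ)) - 1 := by
      rw [mul_comm]; exact geom_sum_mul_of_one_le hq1 _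
    rw [mul_left_comm, h1, Nat.mul_sub, mul_one, ← pow_add, Nat.add_sub_cancel' i.2.le]

/-- Stabilizer of a subspace in `GL_n`. -/
def stabGL {n : ℕ} {F : Type} [Field F] (W : Submodule F (Fin n → F)) :
    Subgroup (Matrix.GeneralLinearGroup (Fin n) F) where
  carrier := {g | (∀ w ∈ W, (g : Matrix (Fin n) (Fin n) F).mulVec w ∈ W) ∧
    (∀ w ∈ W, ((g⁻¹ : Matrix.GeneralLinearGroup (Fin n) F) : Matrix (Fin n) (Fin n) F).mulVec w ∈ W)}
  one_mem' := by simp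
  mul_mem' := by
    rintro a b ⟨ha, ha'⟩ ⟨hb, hb'⟩
    refine ⟨fun w hw => ?_, fun w hw => ?_⟩
    · rw [Units.val_mul, ← Matrix.mulVec_mulVec]
      exact ha _ (hb _ hw)
    · rw [mul_inv_rev, Units.val_mul, ← Matrix.mulVec_mulVec]
      exact hb' _ (ha' _ hw)
  inv_mem' := by
    rintro a ⟨ha, ha'⟩
    exact ⟨ha', by simpa using ha⟩

lemma card_dvd_stabGL {n : ℕ} {F : Type} [Field F] [Fintype F] (W : Submodule F (Fin n → F)) :
    (Fintype.card F - 1) ^ n ∣ Nat.card (stabGL W) := by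
  classical
  obtain ⟨W', hW⟩ := W.exists_isCompl
  let b1 := Module.finBasis F W
  let b2 := Module.finBasis F W'
  let b := (b1.prod b2).map (Submodule.prodEquivOfIsCompl W W' hW)
  have hb : ∀ i, b (Sum.inl i) = (b1 i : Fin n → F) := by
    intro i; simp [b]
  let ι := Fin (Module.finrank F W) ⊕ Fin (Module.finrank F W')
  have hι : Fintype.card ι = n := by
    have := Module.finrank_eq_card_basis b
    rw [Module.finrank_fin_fun] at this
    exact this.symm
  let θ : (ι → F) →ₐ[F] Matrix (Fin n) (Fin n) F :=
    ((LinearMap.toMatrixAlgEquiv' (R := F) (n := Fin n)).toAlgHom.comp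
      (Matrix.toLinAlgEquiv b).toAlgHom).comp (Matrix.diagonalAlgHom F)
  have hθ : ∀ t i, (θ t).mulVec (b i) = t i • b i := by
    intro t i
    have : (θ t).mulVec (b i) = Matrix.toLinAlgEquiv b (Matrix.diagonal t) (b i) := by
      change (LinearMap.toMatrixAlgEquiv' (Matrix.toLinAlgEquiv b (Matrix.diagonal t))).mulVec _ = _
      rw [← Matrix.toLinAlgEquiv'_apply, Matrix.toLinAlgEquiv'_toMatrixAlgEquiv']
    rw [this, Matrix.toLinAlgEquiv_self]
    simp [Matrix.diagonal_apply]
  have hinj : Function.Injective θ := by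
    intro s t h
    funext i
    have h1 := hθ s i
    rw [h, hθ t i] at h1
    exact (smul_left_injective F (b.ne_zero i) h1).symm
  have hpres : ∀ t, ∀ w ∈ W, (θ t).mulVec w ∈ W := by
    intro t w hw
    have h1 : w = ∑ i, b1.repr ⟨w, hw⟩ i • b (Sum.inl i) := by
      have := congrArg Subtype.val (b1.sum_repr ⟨w, hw⟩)
      simp only [hb]
      rw [Submodule.coe_sum] at this
      exact this.symm
    rw [h1, Matrix.mulVec_sum]
    refine W.sum_mem fun i _ => ?_
    rw [Matrix.mulVec_smul, hθ, hb]
    exact W.smul_mem _ (W.smul_mem _ (b1 i).2)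
  let T : (ι → F)ˣ →* Matrix.GeneralLinearGroup (Fin n) F := Units.map (θ : (ι → F) →* _)
  let T' : (ι → F)ˣ →* stabGL W := T.codRestrict (stabGL W) (fun t => by
    refine ⟨fun w hw => hpres _ w hw, fun w hw => ?_⟩
    rw [← map_inv]
    exact hpres _ w hw)
  have hT' : Function.Injective T' := by
    intro s t h
    have h1 : T s = T t := congrArg Subtype.val h
    exact Units.ext (hinj (congrArg Units.val h1))
  have h := Subgroup.card_dvd_of_injective T' hT'
  have hc : Nat.card (ι → F)ˣ = (Fintype.card F - 1) ^ n := by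
    rw [Nat.card_congr MulEquiv.piUnits.toEquiv, Nat.card_pi]
    simp [Nat.card_eq_fintype_card, hι]
    rw [Fintype.card_units]
  rwa [hc] at h

lemma stab_index (p : ℕ) [Fact p.Prime] (F : Type) [Field F] [Fintype F]
    (n : ℕ) (hpq : p ∣ Fintype.card F - 1) (hpW : ¬ p ∣ n.factorial)
    (W : Submodule F (Fin n → F)) :
    ¬ p ∣ ((stabGL W).comap Matrix.SpecialLinearGroup.toGL).index := by
  classical
  obtain ⟨m, hm, hcard⟩ := card_GL_factor p F n hpq hpW
  obtain ⟨c, hc⟩ := card_dvd_stabGL W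
  have hq : 0 < (Fintype.card F - 1) ^ n := by
    have : 1 < Fintype.card F := Fintype.one_lt_card
    exact Nat.pow_pos (by omega)
  have h1 : c * (stabGL W).index = m := by
    apply Nat.eq_of_mul_eq_mul_left hq
    rw [← hcard, ← Subgroup.card_mul_index (stabGL W), hc, mul_assoc]
  have hnorm : (Matrix.SpecialLinearGroup.toGL (n := Fin n) (R := F)).range.Normal := by
    have : (Matrix.SpecialLinearGroup.toGL (n := Fin n) (R := F)).range =
        (Matrix.GeneralLinearGroup.det (n := Fin n) (R := F)).ker := by
      ext g
      constructor
      · rintro ⟨A, rfl⟩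
        rw [MonoidHom.mem_ker]
        ext
        simp
      · intro h
        rw [MonoidHom.mem_ker] at h
        refine ⟨⟨(g : Matrix (Fin n) (Fin n) F), ?_⟩, ?_⟩
        · simpa using congrArg Units.val h
        · ext; rfl
    rw [this]
    infer_instance
  rw [Subgroup.index_comap]
  intro h
  exact hm (h.trans ((relIndex_dvd_index_right _ _).trans ⟨c, by rw [← h1, mul_comm]⟩))

lemma exists_not_stab {F : Type} [Field F] {n : ℕ} (hn : 2 ≤ n) (W : Submodule F (Fin n → F))
    (hb : W ≠ ⊥)
    (h : ∀ A : Matrix.SpecialLinearGroup (Fin n) F, ∀ w ∈ W,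
      (A : Matrix (Fin n) (Fin n) F).mulVec w ∈ W) : W = ⊤ := by
  classical
  have key : ∀ w ∈ W, ∀ i j, j ≠ i → w i ≠ 0 → (Pi.single j 1 : Fin n → F) ∈ W := by
    intro w hw i j hij hi
    have h1 := h ⟨Matrix.transvection j i 1, Matrix.det_transvection_of_ne j i hij 1⟩ w hw
    have h2 : (Matrix.transvection j i (1 : F)).mulVec w = w + w i • Pi.single j 1 := by
      rw [Matrix.transvection, Matrix.add_mulVec, Matrix.one_mulVec]
      congr 1
      ext l
      simp [Matrix.single_mulVec, Function.update_apply, Pi.single_apply]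
    change (Matrix.transvection j i (1 : F)).mulVec w ∈ W at h1
    rw [h2] at h1
    have h3 := W.smul_mem (w i)⁻¹ ((W.add_mem_iff_right hw).1 h1)
    rwa [smul_smul, inv_mul_cancel₀ hi, one_smul] at h3
  obtain ⟨w, hw, hw0⟩ := W.ne_bot_iff.1 hb
  obtain ⟨i, hi⟩ := Function.ne_iff.1 hw0
  have hall : ∀ j, (Pi.single j 1 : Fin n → F) ∈ W := by
    intro j
    by_cases hj : j = i
    · subst hj
      have : Nontrivial (Fin n) := Fin.nontrivial_iff_two_le.2 hn
      obtain ⟨l, hl⟩ := exists_ne j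
      exact key _ (key w hw j l hl hi) l j hl.symm (by simp)
    · exact key w hw i j hj hi
  rw [eq_top_iff]
  intro x _
  rw [pi_eq_sum_univ' x]
  refine W.sum_mem fun j _ => ?_
  exact W.smul_mem _ (by simpa [Pi.single_apply, funext_iff] using hall j)

/-- If `p ∣ q - 1` is coprime to the order `n!` of the Weyl group and `PSL_n(q)` has property
`(I_p)` with respect to `H`, then the full preimage of `H` in `SL_n(F_q)` acts irreducibly on
the natural module `F_q^n`; equivalently `H` lies in no proper parabolic subgroup. -/
theorem stmt12 (k : Type) [Field k] (p : ℕ) [Fact p.Prime] [IsAlgClosed k] [CharP k p]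
    (F : Type) [Field F] [Fintype F] (q : ℕ) (hF : Fintype.card F = q)
    (n : ℕ) (hn : 2 ≤ n) (hpq : p ∣ q - 1) (hpW : ¬ p ∣ n.factorial)
    (H : Subgroup (PSL n F)) (hIp : HasIp k p H) :
    ∀ W : Submodule F (Fin n → F),
      (∀ A : Matrix.SpecialLinearGroup (Fin n) F,
        QuotientGroup.mk' (Subgroup.center (Matrix.SpecialLinearGroup (Fin n) F)) A ∈ H →
        ∀ w ∈ W, (A : Matrix (Fin n) (Fin n) F).mulVec w ∈ W) →
      W = ⊥ ∨ W = ⊤ := by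
  intro W hW
  by_contra! hcon
  obtain ⟨hb, ht⟩ := hcon
  subst hF
  let Q : Subgroup (Matrix.SpecialLinearGroup (Fin n) F) :=
    (stabGL W).comap Matrix.SpecialLinearGroup.toGL
  let mk := QuotientGroup.mk' (Subgroup.center (Matrix.SpecialLinearGroup (Fin n) F))
  have hHQ : H.comap mk ≤ Q := by
    intro A hA
    refine ⟨hW A hA, ?_⟩
    rw [← map_inv]
    exact hW A⁻¹ (inv_mem hA)
  have hsurj : Function.Surjective mk := QuotientGroup.mk'_surjective _
  have hker : mk.ker ≤ Q := le_trans (by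
    intro A hA
    rw [Subgroup.mem_comap, MonoidHom.mem_ker.1 hA]
    exact one_mem H) hHQ
  have hidx : (Q.map mk).index = Q.index := Subgroup.index_map_eq Q hsurj hker
  have hp : ¬ p ∣ (Q.map mk).index := by
    rw [hidx]; exact stab_index p F n hpq hpW W
  have hle : H ≤ Q.map mk := by
    rw [← Subgroup.map_comap_eq_self_of_surjective hsurj H]
    exact Subgroup.map_mono hHQ
  have hne : Q.map mk ≠ ⊤ := by
    intro h
    have hQ : Q = ⊤ := by
      rw [← Subgroup.index_eq_one, ← hidx, h, Subgroup.index_top]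
    refine ht (exists_not_stab hn W hb fun A => ?_)
    have : A ∈ Q := by rw [hQ]; trivial
    exact this.1
  exact not_indecomposable k p H (Q.map mk) hle hIp.1 hp hne hIp.2
end

section
/- The projective general linear group PGL_2(7) = GL_2(F_7)/Z(GL_2(F_7)) does not have property (I_7) with respect to any of its subgroups, although its index-2 subgroup PSL_2(7) has property (I_7) with respect to a subgroup isomorphic to the symmetric group S_4. -/
/-- The projective general linear group `PGL_2(7)`. -/
abbrev PGL27 :=
  Matrix.GeneralLinearGroup (Fin 2) (ZMod 7) ⧸
    Subgroup.center (Matrix.GeneralLinearGroup (Fin 2) (ZMod 7))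

/-- `PSL_2(7)`, realized as the image of `SL_2(F_7)` in `PGL_2(7)`. -/
def PSLinPGL27 : Subgroup PGL27 :=
  ((QuotientGroup.mk' (Subgroup.center (Matrix.GeneralLinearGroup (Fin 2) (ZMod 7)))).comp
    Matrix.SpecialLinearGroup.toGL).range

open scoped MonoidAlgebra in
theorem fitting_aux_s17 {k G V : Type*} [Field k] [Group G] [AddCommGroup V] [Module k V]
    [Module.Finite k V] (ρ : Representation k G V)
    (hI : IsIndecomposableModule (MonoidAlgebra k G) ρ.asModule)
    (f : Module.End k V) (hf : ∀ g, f ∘ₗ ρ g = ρ g ∘ₗ f) :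
    IsNilpotent f ∨ Function.Injective f := by
  obtain ⟨n, hn⟩ := Filter.eventually_atTop.mp f.eventually_isCompl_ker_pow_range_pow
  have hc := hn (n + 1) (by omega)
  have hpow : ∀ m : ℕ, ∀ g v, (f ^ m) (ρ g v) = ρ g ((f ^ m) v) := by
    intro m g
    induction m with
    | zero => simp
    | succ m ih =>
      intro v
      rw [pow_succ, Module.End.mul_apply, Module.End.mul_apply, ← ih]
      exact congrArg _ (LinearMap.congr_fun (hf g) v)
  let A : Subrepresentation ρ := ⟨LinearMap.ker (f ^ (n + 1)), by
    intro g v hv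
    rw [LinearMap.mem_ker] at hv ⊢
    rw [hpow, hv, map_zero]⟩
  let B : Subrepresentation ρ := ⟨LinearMap.range (f ^ (n + 1)), by
    rintro g v ⟨w, rfl⟩
    exact ⟨ρ g w, hpow _ _ _⟩⟩
  have hAB : IsCompl A B := by
    constructor
    · rw [disjoint_iff]
      apply Subrepresentation.toSubmodule_injective
      exact hc.inf_eq_bot
    · rw [codisjoint_iff]
      apply Subrepresentation.toSubmodule_injective
      exact hc.sup_eq_top
  have h2 := (Subrepresentation.subrepresentationSubmoduleOrderIso (ρ := ρ)).isCompl hAB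
  rcases hI.2 _ _ h2 with h | h
  · right
    have hA : A = ⊥ := (map_eq_bot_iff _).mp h
    have hk : LinearMap.ker (f ^ (n + 1)) = ⊥ := congrArg Subrepresentation.toSubmodule hA
    rw [LinearMap.ker_eq_bot] at hk
    intro a b hab
    apply hk
    rw [pow_succ, Module.End.mul_apply, Module.End.mul_apply, hab]
  · left
    have hB : B = ⊥ := (map_eq_bot_iff _).mp h
    have hk : LinearMap.range (f ^ (n + 1)) = ⊥ := congrArg Subrepresentation.toSubmodule hB
    exact ⟨n + 1, LinearMap.range_eq_bot.mp hk⟩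

/-- The equivariant map `k[G/H] → k[G/K]` sending `x` to the sum of `g a K` over `g ∈ x`. -/
noncomputable def heckeMap (k : Type*) [Field k] {G : Type*} [Group G] [Fintype G]
    (H K : Subgroup G) (a : G) :
    MonoidAlgebra k (G ⧸ H) →ₗ[k] MonoidAlgebra k (G ⧸ K) :=
  letI := Classical.decEq (G ⧸ H)
  (Finsupp.lift (MonoidAlgebra k (G ⧸ K)) k (G ⧸ H) (fun x =>
    ∑ g : G with (QuotientGroup.mk g : G ⧸ H) = x, MonoidAlgebra.single ((g * a : G) : G ⧸ K) (1 : k))) ∘ₗ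
  (MonoidAlgebra.coeffLinearEquiv k).toLinearMap

noncomputable def wtMap (k : Type*) [Field k] {X : Type*} (w : X → k) :
    MonoidAlgebra k X →ₗ[k] k :=
  (Finsupp.lift k k X w) ∘ₗ (MonoidAlgebra.coeffLinearEquiv k).toLinearMap

section
variable (k : Type*) [Field k] {G : Type*} [Group G] [Fintype G] (H K : Subgroup G)

theorem wtMap_single {X : Type*} (w : X → k) (x : X) :
    wtMap k w (MonoidAlgebra.single x 1) = w x := by
  simp [wtMap]

open Classical in
theorem heckeMap_single (a : G) (x : G ⧸ H) :
    heckeMap k H K a (MonoidAlgebra.single x 1) =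
      ∑ g : G with (QuotientGroup.mk g : G ⧸ H) = x, MonoidAlgebra.single ((g * a : G) : G ⧸ K) (1 : k) := by
  simp only [heckeMap, LinearMap.comp_apply]
  simp
  congr!

theorem monAlg_ext {X W : Type*} [AddCommMonoid W] [Module k W]
    {f g : MonoidAlgebra k X →ₗ[k] W}
    (h : ∀ x, f (MonoidAlgebra.single x 1) = g (MonoidAlgebra.single x 1)) : f = g := by
  apply MonoidAlgebra.lhom_ext'
  intro x
  ext
  exact h x

theorem heckeMap_equivariant (a g : G) :
    heckeMap k H K a ∘ₗ Representation.ofMulAction k G (G ⧸ H) g =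
      Representation.ofMulAction k G (G ⧸ K) g ∘ₗ heckeMap k H K a := by
  classical
  apply monAlg_ext
  intro x
  simp only [LinearMap.comp_apply, Representation.ofMulAction_single, heckeMap_single, map_sum]
  refine Finset.sum_bij' (fun y _ => g⁻¹ * y) (fun y _ => g * y) ?_ ?_ ?_ ?_ ?_
  · intro y hy
    simp only [Finset.mem_filter, Finset.mem_univ, true_and] at hy ⊢
    rw [← smul_eq_mul, ← MulAction.Quotient.smul_mk, hy, inv_smul_smul]
  · intro y hy
    simp only [Finset.mem_filter, Finset.mem_univ, true_and] at hy ⊢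
    rw [← hy]; rfl
  · simp
  · simp
  · intro y hy
    rw [MulAction.Quotient.smul_mk]
    simp [mul_assoc]

open Classical in
theorem fiber_card (x : G ⧸ H) :
    (Finset.univ.filter (fun g : G => (QuotientGroup.mk g : G ⧸ H) = x)).card = Nat.card H := by
  obtain ⟨y, rfl⟩ := QuotientGroup.mk_surjective x
  rw [Nat.card_eq_fintype_card, ← Finset.card_univ]
  refine (Finset.card_bij (fun (h : H) _ => y * h) ?_ ?_ ?_).symm
  · intro h _
    simp
  · intro a _ b _ hab
    exact Subtype.ext (mul_left_cancel hab)
  · intro b hb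
    simp only [Finset.mem_filter, Finset.mem_univ, true_and] at hb
    exact ⟨⟨y⁻¹ * b, QuotientGroup.eq.mp hb.symm⟩, Finset.mem_univ _, by simp⟩

theorem aug_hecke (a : G) :
    wtMap k (fun _ => 1) ∘ₗ heckeMap k H K a = (Nat.card H : k) • wtMap k (fun _ => 1) := by
  classical
  apply monAlg_ext
  intro x
  simp only [LinearMap.comp_apply, heckeMap_single, map_sum, wtMap_single, LinearMap.smul_apply]
  rw [Finset.sum_const, fiber_card]
  simp

theorem sgn_hecke (s : G →* ℤˣ) (hK : K ≤ s.ker) (a : G) :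
    wtMap k (fun x : G ⧸ K => ((s x.out : ℤ) : k)) ∘ₗ heckeMap k K K a =
      ((Nat.card K : k) * ((s a : ℤ) : k)) • wtMap k (fun x : G ⧸ K => ((s x.out : ℤ) : k)) := by
  classical
  have hout : ∀ g : G, s ((g : G ⧸ K).out) = s g := by
    intro g
    obtain ⟨h, hh⟩ := QuotientGroup.mk_out_eq_mul K g
    rw [hh, map_mul, MonoidHom.mem_ker.mp (hK h.2), mul_one]
  apply monAlg_ext
  intro x
  simp only [LinearMap.comp_apply, heckeMap_single, map_sum, wtMap_single, LinearMap.smul_apply]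
  have : ∀ g ∈ Finset.univ.filter (fun g : G => (QuotientGroup.mk g : G ⧸ K) = x),
      ((s ((g * a : G) : G ⧸ K).out : ℤ) : k) = ((s x.out : ℤ) : k) * ((s a : ℤ) : k) := by
    intro g hg
    simp only [Finset.mem_filter, Finset.mem_univ, true_and] at hg
    rw [hout, ← hg, hout]; simp
  rw [Finset.sum_congr rfl this, Finset.sum_const, fiber_card]
  simp only [nsmul_eq_mul, smul_eq_mul]
  ring

theorem index_lt (s : G →* ℤˣ) (hK : K ≤ s.ker) (t : G) (ht : s t = -1)
    (hHk : (Nat.card H : k) ≠ 0) (hKk : (Nat.card K : k) ≠ 0) (h2 : (2 : k) ≠ 0)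
    (hI : IsIndecomposableModule (MonoidAlgebra k G) (PermMod k H)) :
    H.index < K.index := by
  have : Module.Finite k (MonoidAlgebra k (G ⧸ H)) := 
    Module.Finite.equiv (MonoidAlgebra.coeffLinearEquiv k).symm
  have : Module.Finite k (MonoidAlgebra k (G ⧸ K)) := 
    Module.Finite.equiv (MonoidAlgebra.coeffLinearEquiv k).symm
  let m : MonoidAlgebra k (G ⧸ K) →ₗ[k] MonoidAlgebra k (G ⧸ K) :=
    heckeMap k K K 1 + heckeMap k K K t
  let q := m ∘ₗ heckeMap k H K 1
  let f : Module.End k (MonoidAlgebra k (G ⧸ H)) := heckeMap k K H 1 ∘ₗ q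
  let aH : MonoidAlgebra k (G ⧸ H) →ₗ[k] k := wtMap k (fun _ => 1)
  let aK : MonoidAlgebra k (G ⧸ K) →ₗ[k] k := wtMap k (fun _ => 1)
  let sK : MonoidAlgebra k (G ⧸ K) →ₗ[k] k := wtMap k (fun x => ((s x.out : ℤ) : k))
  have hm : ∀ g, m ∘ₗ Representation.ofMulAction k G (G ⧸ K) g =
      Representation.ofMulAction k G (G ⧸ K) g ∘ₗ m := by
    intro g
    simp only [m, LinearMap.add_comp, LinearMap.comp_add, heckeMap_equivariant]
  have hf : ∀ g, f ∘ₗ Representation.ofMulAction k G (G ⧸ H) g =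
      Representation.ofMulAction k G (G ⧸ H) g ∘ₗ f := by
    intro g
    simp only [f, q]
    rw [LinearMap.comp_assoc, LinearMap.comp_assoc, heckeMap_equivariant,
      ← LinearMap.comp_assoc _ _ m, hm, LinearMap.comp_assoc, ← LinearMap.comp_assoc,
      heckeMap_equivariant, LinearMap.comp_assoc]
  let c : k := (Nat.card K : k) * (2 * (Nat.card K : k)) * (Nat.card H : k)
  have hc : c ≠ 0 := by positivity
  have haug : aH ∘ₗ f = c • aH := by
    have h1 : aH ∘ₗ heckeMap k K H 1 = (Nat.card K : k) • aK := aug_hecke k K H 1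
    have h3 : aK ∘ₗ heckeMap k H K 1 = (Nat.card H : k) • aH := aug_hecke k H K 1
    have h2 : aK ∘ₗ m = (2 * (Nat.card K : k)) • aK := by
      simp only [m, LinearMap.comp_add, aK, aug_hecke]
      rw [← add_smul, two_mul]
    simp only [f, q]
    rw [← LinearMap.comp_assoc, h1, LinearMap.smul_comp, ← LinearMap.comp_assoc, h2,
      LinearMap.smul_comp, h3, smul_smul, smul_smul]
  have hx : aH (MonoidAlgebra.single ((1 : G) : G ⧸ H) 1) = 1 := wtMap_single _ _ _
  have hinj : Function.Injective f := by
    refine (fitting_aux_s17 _ hI f hf).resolve_left ?_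
    rintro ⟨n, hn⟩
    have : ∀ n, aH ∘ₗ (f ^ n) = (c ^ n) • aH := by
      intro n
      induction n with
      | zero => ext; simp
      | succ n ih =>
        rw [pow_succ, Module.End.mul_eq_comp, ← LinearMap.comp_assoc, ih, LinearMap.smul_comp, haug,
          smul_smul, pow_succ]
    have h := LinearMap.congr_fun (this n) (MonoidAlgebra.single ((1 : G) : G ⧸ H) 1)
    rw [hn, LinearMap.smul_apply, hx] at h
    simp only [LinearMap.comp_zero, LinearMap.zero_apply, smul_eq_mul, mul_one] at h
    exact pow_ne_zero n hc h.symm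
  have hq : Function.Injective q := by
    intro a b hab
    apply hinj
    simp only [f, LinearMap.comp_apply, hab]
  have hs : sK ∘ₗ m = 0 := by
    simp only [m, LinearMap.comp_add, sK]
    rw [sgn_hecke k K s hK, sgn_hecke k K s hK, ht, map_one, ← add_smul]
    simp
  have hle : LinearMap.range q ≤ LinearMap.ker sK := by
    rintro _ ⟨v, rfl⟩
    exact LinearMap.congr_fun hs _
  have hlt : LinearMap.ker sK < ⊤ := by
    rw [lt_top_iff_ne_top, Ne, LinearMap.ker_eq_top]
    intro h0
    have h := LinearMap.congr_fun h0 (MonoidAlgebra.single ((1 : G) : G ⧸ K) 1)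
    simp only [sK, wtMap_single, LinearMap.zero_apply] at h
    rcases Int.units_eq_one_or (s ((1 : G) : G ⧸ K).out) with h' | h' <;> rw [h'] at h <;> simp at h
  have e1 := Submodule.finrank_mono hle
  have e2 := Submodule.finrank_lt hlt.ne
  rw [LinearMap.finrank_range_of_inj hq] at e1
  have d : ∀ L : Subgroup G, Module.finrank k (MonoidAlgebra k (G ⧸ L)) = L.index := by
    intro L
    rw [(MonoidAlgebra.coeffLinearEquiv k : MonoidAlgebra k (G ⧸ L) ≃ₗ[k] _).finrank_eq]
    have := Fintype.ofFinite (G ⧸ L)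
    rw [Module.finrank_finsupp_self, Subgroup.index, Nat.card_eq_fintype_card]
  rw [d] at e1 e2
  omega
end
theorem indec_of_cyclic (k : Type*) [Field k] [CharP k 7] {G : Type*} [Group G]
    (K : Subgroup G) [Finite (G ⧸ K)] (u : G) (hu : u ^ 7 = 1)
    (htr : ∀ x y : G ⧸ K, ∃ n : ℕ, u ^ n • x = y) :
    IsIndecomposableModule (MonoidAlgebra k G) (PermMod k K) := by
  let ρ := Representation.ofMulAction k G (G ⧸ K)
  let one : MonoidAlgebra k (G ⧸ K) :=
    (MonoidAlgebra.coeffLinearEquiv k).symm (Finsupp.equivFunOnFinite.symm (fun _ => (1 : k)))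
  have hone : ∀ x, one.coeff x = 1 := fun x => rfl
  have : Nontrivial (MonoidAlgebra k (G ⧸ K)) := ⟨one, 0, by
    intro h
    have := hone ((1 : G) : G ⧸ K)
    rw [h] at this
    simp at this⟩
  refine ⟨this, ?_⟩
  have hchar : CharP (Module.End k (MonoidAlgebra k (G ⧸ K))) 7 :=
    charP_of_injective_algebraMap (algebraMap k _).injective 7
  have : Fact (Nat.Prime 7) := ⟨by norm_num⟩
  have hT : (ρ u - 1) ^ 7 = 0 := by
    rw [sub_pow_char_of_commute (p := 7) (h := Commute.one_right _), ← map_pow, hu, map_one,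
      one_pow, sub_self]
  have key : ∀ S : Subrepresentation ρ, S.toSubmodule ≠ ⊥ →
      ∃ c : k, c ≠ 0 ∧ c • one ∈ S.toSubmodule := by
    intro S hS
    obtain ⟨v, hv, hv0⟩ := Submodule.exists_mem_ne_zero_of_ne_bot hS
    have hmem : ∀ n : ℕ, ((ρ u - 1) ^ n) v ∈ S.toSubmodule := by
      intro n
      induction n with
      | zero => simpa using hv
      | succ n ih =>
        rw [pow_succ', Module.End.mul_apply, LinearMap.sub_apply]
        exact S.toSubmodule.sub_mem (S.apply_mem_toSubmodule u ih) ih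
    have hex : ∃ n : ℕ, ((ρ u - 1) ^ n) v = 0 := ⟨7, by rw [hT]; rfl⟩
    classical
    have hspec := Nat.find_spec hex
    have hmin := fun m => Nat.find_min (m := m) hex
    rcases hn : Nat.find hex with _ | n
    · rw [hn] at hspec
      exact absurd hspec (by simpa using hv0)
    rw [hn] at hspec hmin
    have hw0 := hmin n (by omega)
    have hwS := hmem n
    rw [pow_succ', Module.End.mul_apply, LinearMap.sub_apply, Module.End.one_apply,
      sub_eq_zero] at hspec
    generalize ((ρ u - 1) ^ n) v = w at *
    have hpow : ∀ m : ℕ, ρ (u ^ m) w = w := by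
      intro m
      induction m with
      | zero => simp
      | succ m ih => rw [pow_succ, map_mul, Module.End.mul_apply, hspec, ih]
    have hw : w = w.coeff ((1 : G) : G ⧸ K) • one := by
      ext x
      obtain ⟨m, hm⟩ := htr ((1 : G) : G ⧸ K) x
      have h1 : (ρ (u ^ m) w).coeff x = w.coeff ((1 : G) : G ⧸ K) := by
        rw [Representation.coeff_ofMulAction, ← hm, inv_smul_smul]
      rw [hpow] at h1
      rw [h1, MonoidAlgebra.coeff_smul, Finsupp.smul_apply, hone, smul_eq_mul, mul_one]
    refine ⟨w.coeff ((1 : G) : G ⧸ K), ?_, hw ▸ hwS⟩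
    intro h
    rw [h, zero_smul] at hw
    exact hw0 hw
  intro A B hAB
  by_contra! hne
  let A' := Subrepresentation.ofSubmodule' A
  let B' := Subrepresentation.ofSubmodule' B
  obtain ⟨a, ha, haA⟩ := key A' (by
    intro h
    apply hne.1
    rw [eq_bot_iff]
    intro x hx
    have : x ∈ A'.toSubmodule := hx
    rw [h] at this
    exact this)
  obtain ⟨b, hb, hbB⟩ := key B' (by
    intro h
    apply hne.2
    rw [eq_bot_iff]
    intro x hx
    have : x ∈ B'.toSubmodule := hx
    rw [h] at this
    exact this)
  have h1 : one ∈ A'.toSubmodule := by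
    simpa [smul_smul, ha] using A'.toSubmodule.smul_mem a⁻¹ haA
  have h2 : one ∈ B'.toSubmodule := by
    simpa [smul_smul, hb] using B'.toSubmodule.smul_mem b⁻¹ hbB
  have h3 : (one : PermMod k K) ∈ A ⊓ B := ⟨h1, h2⟩
  rw [hAB.inf_eq_bot] at h3
  have := hone ((1 : G) : G ⧸ K)
  have h4 : one = 0 := (Submodule.mem_bot (M := PermMod k K) (MonoidAlgebra k G)).mp h3
  rw [h4] at this
  simp at this
def tab : Fin 4 → Fin 4 → Fin 4 → ZMod 7 × ZMod 7 × ZMod 7 × ZMod 7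
  | 0, 1, 2 => (1, 0, 0, 1)
  | 0, 1, 3 => (3, 2, 2, 4)
  | 0, 2, 1 => (1, 4, 3, 6)
  | 0, 2, 3 => (3, 3, 0, 5)
  | 0, 3, 1 => (2, 3, 0, 4)
  | 0, 3, 2 => (2, 5, 6, 5)
  | 1, 0, 2 => (0, 1, 6, 0)
  | 1, 0, 3 => (2, 4, 4, 5)
  | 1, 2, 0 => (3, 6, 6, 3)
  | 1, 2, 3 => (0, 2, 3, 3)
  | 1, 3, 0 => (0, 3, 2, 3)
  | 1, 3, 2 => (1, 2, 2, 5)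
  | 2, 0, 1 => (3, 1, 1, 3)
  | 2, 0, 3 => (3, 4, 5, 0)
  | 2, 1, 0 => (1, 3, 4, 6)
  | 2, 1, 3 => (2, 0, 3, 4)
  | 2, 3, 0 => (1, 1, 5, 6)
  | 2, 3, 1 => (2, 1, 1, 1)
  | 3, 0, 1 => (3, 5, 4, 0)
  | 3, 0, 2 => (2, 2, 2, 6)
  | 3, 1, 0 => (3, 0, 3, 5)
  | 3, 1, 2 => (2, 6, 5, 5)
  | 3, 2, 0 => (1, 6, 6, 2)
  | 3, 2, 1 => (1, 5, 1, 6)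
  | _, _, _ => (1, 0, 0, 1)

def tabP (σ : Equiv.Perm (Fin 4)) : ZMod 7 × ZMod 7 × ZMod 7 × ZMod 7 := tab (σ 0) (σ 1) (σ 2)

def tmul (a b : ZMod 7 × ZMod 7 × ZMod 7 × ZMod 7) : ZMod 7 × ZMod 7 × ZMod 7 × ZMod 7 :=
  (a.1 * b.1 + a.2.1 * b.2.2.1, a.1 * b.2.1 + a.2.1 * b.2.2.2,
   a.2.2.1 * b.1 + a.2.2.2 * b.2.2.1, a.2.2.1 * b.2.1 + a.2.2.2 * b.2.2.2)

theorem tabP_mul : ∀ σ τ : Equiv.Perm (Fin 4),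
    tmul (tabP σ) (tabP τ) = tabP (σ * τ) ∨ tmul (tabP σ) (tabP τ) = - tabP (σ * τ) := by
  decide +kernel

theorem tabP_det : ∀ σ : Equiv.Perm (Fin 4),
    (tabP σ).1 * (tabP σ).2.2.2 - (tabP σ).2.1 * (tabP σ).2.2.1 = 1 := by
  decide +kernel

theorem tabP_inj : ∀ σ : Equiv.Perm (Fin 4),
    (tabP σ).1 = (tabP σ).2.2.2 → (tabP σ).2.1 = 0 → (tabP σ).2.2.1 = 0 → σ = 1 := by
  decide +kernel
theorem period_inj {G X : Type*} [Group G] [MulAction G X] (g : G) (x : X) :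
    Function.Injective (fun i : Fin (MulAction.period g x) => g ^ (i : ℕ) • x) := by
  have key : ∀ i j : Fin (MulAction.period g x), (i : ℕ) ≤ j →
      g ^ (i : ℕ) • x = g ^ (j : ℕ) • x → i = j := by
    intro i j hij h
    have h1 : g ^ ((j : ℕ) - i) • x = x := by
      have : (j : ℕ) = i + (j - i) := by omega
      rw [this, pow_add, mul_smul] at h
      exact ((MulAction.injective (g ^ (i : ℕ))) h).symm
    rw [MulAction.pow_smul_eq_iff_period_dvd] at h1
    have := Nat.eq_zero_of_dvd_of_lt h1 (by omega)
    exact Fin.ext (by omega)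
  intro i j h
  rcases le_total (i : ℕ) j with hij | hij
  · exact key i j hij h
  · exact (key j i hij h.symm).symm

theorem period_le {G X : Type*} [Group G] [MulAction G X] [Finite X] (g : G) (x : X) :
    MulAction.period g x ≤ Nat.card X := by
  simpa using Nat.card_le_card_of_injective _ (period_inj g x)

theorem pow_four_fix {G X : Type*} [Group G] [MulAction G X] [Finite X] (hX : Nat.card X = 7)
    (g : G) (hg : g ^ 8 = 1) (x : X) : g ^ 4 • x = x := by
  have h1 : MulAction.period g x ∣ 8 := by
    rw [← MulAction.pow_smul_eq_iff_period_dvd, hg, one_smul]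
  have h2 := period_le g x
  rw [MulAction.pow_smul_eq_iff_period_dvd]
  obtain ⟨i, hi, h⟩ := (Nat.dvd_prime_pow Nat.prime_two (m := 3)).mp h1
  rw [h] at h2 ⊢
  interval_cases i <;> simp_all

theorem seven_dvd {G : Type*} [Group G] (H : Subgroup G) (u : G) (hu : u ^ 7 = 1)
    (hu1 : u ≠ 1) (h : u ∈ H) : 7 ∣ Nat.card H := by
  have : Fact (Nat.Prime 7) := ⟨by norm_num⟩
  rw [← orderOf_eq_prime hu hu1]
  exact Subgroup.orderOf_dvd_natCard H h

theorem trans_seven {G : Type*} [Group G] (K : Subgroup G) (hK : K.index = 7)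
    (h7 : ¬ 7 ∣ Nat.card K) (u : G) (hu : u ^ 7 = 1) (hu1 : u ≠ 1) (x y : G ⧸ K) :
    ∃ n : ℕ, u ^ n • x = y := by
  have hfin : Finite (G ⧸ K) := Nat.finite_of_card_ne_zero (by
    change K.index ≠ 0
    omega)
  have hp : MulAction.period u x = 7 := by
    have h1 : MulAction.period u x ∣ 7 := by
      rw [← MulAction.pow_smul_eq_iff_period_dvd, hu, one_smul]
    rcases (Nat.dvd_prime (by norm_num)).mp h1 with h | h
    · exfalso
      have h2 : u • x = x := by
        have : u ^ 1 • x = x := by rw [MulAction.pow_smul_eq_iff_period_dvd, h]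
        simpa using this
      obtain ⟨g, rfl⟩ := QuotientGroup.mk_surjective x
      rw [MulAction.Quotient.smul_mk, eq_comm, QuotientGroup.eq] at h2
      refine h7 (seven_dvd K (g⁻¹ * u * g) ?_ ?_ (by simpa [mul_assoc] using h2))
      · have := conj_pow (a := g⁻¹) (b := u) (i := 7)
        simp only [inv_inv] at this
        rw [this, hu]; simp
      · intro h3
        apply hu1
        have : u = g * (g⁻¹ * u * g) * g⁻¹ := by group
        rw [this, h3]; simp
    · exact h
  have hinj := period_inj u x
  have hbij := (Nat.bijective_iff_injective_and_card _).mpr ⟨hinj, by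
    rw [Nat.card_eq_fintype_card, Fintype.card_fin, hp]; exact hK.symm⟩
  obtain ⟨i, hi⟩ := hbij.2 y
  exact ⟨i, hi⟩
abbrev GL27 := Matrix.GeneralLinearGroup (Fin 2) (ZMod 7)

instance fact7 : Fact (Nat.Prime 7) := ⟨by norm_num⟩

def pr : GL27 →* PGL27 := QuotientGroup.mk' (Subgroup.center GL27)

theorem pr_eq_one (g : GL27) :
    pr g = 1 ↔ ∃ c : ZMod 7, g.val = Matrix.scalar (Fin 2) c := by
  rw [pr, QuotientGroup.mk'_apply, QuotientGroup.eq_one_iff,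
    Matrix.GeneralLinearGroup.mem_center_iff_val_mem_range_scalar]
  constructor
  · rintro ⟨c, hc⟩
    exact ⟨c, hc.symm⟩
  · rintro ⟨c, hc⟩
    exact ⟨c, hc.symm⟩

theorem pr_eq_one' (g : GL27) :
    pr g = 1 ↔ g.val 0 1 = 0 ∧ g.val 1 0 = 0 ∧ g.val 0 0 = g.val 1 1 := by
  rw [pr_eq_one]
  constructor
  · rintro ⟨c, hc⟩
    simp [hc]
  · rintro ⟨h1, h2, h3⟩
    refine ⟨g.val 0 0, ?_⟩
    ext i j
    fin_cases i <;> fin_cases j <;> simp [h1, h2, h3]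

theorem card_PGL27 : Nat.card PGL27 = 336 := by
  have h1 : Nat.card GL27 = 2016 := by
    rw [Matrix.card_GL_field]
    simp [ZMod.card, Fin.prod_univ_two]
  have h2 : Nat.card (Subgroup.center GL27) = 6 := by
    rw [Matrix.GeneralLinearGroup.center_eq_range_scalar]
    have hinj : Function.Injective
        (Matrix.GeneralLinearGroup.scalar (Fin 2) : (ZMod 7)ˣ →* GL27) := by
      intro a b hab
      have := congrArg (fun g : GL27 => g.val 0 0) hab
      simpa [Matrix.GeneralLinearGroup.scalar, Units.ext_iff] using this
    rw [← Nat.card_congr (MonoidHom.ofInjective hinj).toEquiv, Nat.card_eq_fintype_card,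
      ZMod.card_units]
  have h3 := Subgroup.card_eq_card_quotient_mul_card_subgroup (Subgroup.center GL27)
  rw [h1, h2] at h3
  change Nat.card (GL27 ⧸ Subgroup.center GL27) = 336
  omega

def sgn : PGL27 →* ℤˣ :=
  QuotientGroup.lift (Subgroup.center GL27)
    ((quadraticChar (ZMod 7)).toUnitHom.comp Matrix.GeneralLinearGroup.det) (by
      intro g hg
      rw [Matrix.GeneralLinearGroup.mem_center_iff_val_mem_range_scalar] at hg
      obtain ⟨c, hc⟩ := hg
      apply Units.ext
      have hd : g.val.det = c ^ 2 := by rw [← hc]; simp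
      have h0 : c ≠ 0 := by
        rintro rfl
        have := g.det.ne_zero
        simp [hd] at this
      simp [hd, quadraticChar_sq_one' h0])

theorem sgn_pr (g : GL27) : (sgn (pr g) : ℤ) = quadraticChar (ZMod 7) g.val.det := by
  rfl

theorem ker_sgn : sgn.ker = PSLinPGL27 := by
  ext x
  obtain ⟨g, rfl⟩ := QuotientGroup.mk'_surjective (Subgroup.center GL27) x
  change pr g ∈ _ ↔ pr g ∈ _
  rw [MonoidHom.mem_ker, Units.ext_iff, sgn_pr]
  have hd0 : g.val.det ≠ 0 := g.det.ne_zero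
  rw [Units.val_one, quadraticChar_one_iff_isSquare hd0]
  constructor
  · rintro ⟨r, hr⟩
    have hr0 : r ≠ 0 := by
      rintro rfl
      simp [hr] at hd0
    have hdet : (r⁻¹ • g.val).det = 1 := by
      rw [Matrix.det_smul, hr, Fintype.card_fin]
      field_simp
    let s : Matrix.SpecialLinearGroup (Fin 2) (ZMod 7) := ⟨r⁻¹ • g.val, hdet⟩
    have hsc : pr (Matrix.GeneralLinearGroup.scalar (Fin 2) (Units.mk0 r hr0)) = 1 := by
      rw [pr_eq_one]
      exact ⟨r, rfl⟩
    have hg : s.toGL * Matrix.GeneralLinearGroup.scalar (Fin 2) (Units.mk0 r hr0) = g := by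
      apply Units.ext
      change (r⁻¹ • g.val) * Matrix.scalar (Fin 2) r = g.val
      ext i j
      simp only [Matrix.scalar_apply, Matrix.mul_diagonal, Matrix.smul_apply, smul_eq_mul]
      field_simp
    refine ⟨s, ?_⟩
    change pr s.toGL = pr g
    rw [← hg, map_mul, hsc, mul_one]
  · rintro ⟨s, hs⟩
    have hs' : pr s.toGL = pr g := hs
    rw [← quadraticChar_one_iff_isSquare hd0, ← sgn_pr, ← hs', sgn_pr]
    simp

def X0 : GL27 := ⟨!![0, 1; 1, 1], !![-1, 1; 1, 0], by decide, by decide⟩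
def Y0 : GL27 := ⟨!![0, 1; 6, 1], !![1, 6; 1, 0], by decide, by decide⟩
def W0 : GL27 := ⟨!![0, 2; 3, 5], !![5, 5; 4, 0], by decide, by decide⟩
def U0 : Matrix.SpecialLinearGroup (Fin 2) (ZMod 7) := ⟨!![1, 1; 0, 1], by decide⟩

theorem U_eq : X0 ^ 4 * (Y0 * X0 ^ 4 * Y0⁻¹) * (W0 * X0 ^ 4 * W0⁻¹) = U0.toGL :=
  Units.ext (by decide +kernel)

theorem X_pow : pr X0 ^ 8 = 1 := by
  rw [← map_pow, pr_eq_one']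
  decide +kernel

theorem U_pow : pr U0.toGL ^ 7 = 1 := by
  rw [← map_pow, pr_eq_one']
  decide +kernel

theorem U_ne : pr U0.toGL ≠ 1 := by
  rw [Ne, pr_eq_one']
  decide +kernel

theorem sgn_X : sgn (pr X0) = -1 := by
  apply Units.ext
  rw [sgn_pr]
  decide +kernel

theorem index_PSL : PSLinPGL27.index = 2 := by
  rw [← ker_sgn, Subgroup.index_ker]
  have : sgn.range = ⊤ := by
    rw [eq_top_iff]
    intro z _
    rcases Int.units_eq_one_or z with rfl | rfl
    · exact one_mem _
    · exact ⟨_, sgn_X⟩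
  rw [this, Subgroup.card_top]
  simp
def tabSL (σ : Equiv.Perm (Fin 4)) : Matrix.SpecialLinearGroup (Fin 2) (ZMod 7) :=
  ⟨!![(tabP σ).1, (tabP σ).2.1; (tabP σ).2.2.1, (tabP σ).2.2.2], by
    rw [Matrix.det_fin_two_of]; exact tabP_det σ⟩

theorem pr_neg (s t : Matrix.SpecialLinearGroup (Fin 2) (ZMod 7)) (h : s.val = - t.val) :
    pr s.toGL = pr t.toGL := by
  have hsc : pr (-1 : GL27) = 1 := by
    rw [pr_eq_one']
    simp
  rw [← mul_one (pr t.toGL), ← hsc, ← map_mul]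
  congr 1
  apply Units.ext
  simpa using h

theorem tabSL_mul_val (σ τ : Equiv.Perm (Fin 4)) : (tabSL σ * tabSL τ).val =
    !![(tmul (tabP σ) (tabP τ)).1, (tmul (tabP σ) (tabP τ)).2.1;
      (tmul (tabP σ) (tabP τ)).2.2.1, (tmul (tabP σ) (tabP τ)).2.2.2] := by
  rw [Matrix.SpecialLinearGroup.coe_mul]
  simp [tabSL, Matrix.mul_fin_two, tmul]

theorem pr_tab_mul (σ τ : Equiv.Perm (Fin 4)) :
    pr (tabSL (σ * τ)).toGL = pr (tabSL σ).toGL * pr (tabSL τ).toGL := by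
  rw [← map_mul, ← map_mul]
  rcases tabP_mul σ τ with h | h
  · have : tabSL (σ * τ) = tabSL σ * tabSL τ := by
      apply Subtype.ext
      rw [tabSL_mul_val, h]
      rfl
    rw [this]
  · symm
    apply pr_neg
    rw [tabSL_mul_val, h]
    simp [tabSL]

def S4hom : Equiv.Perm (Fin 4) →* PSLinPGL27 :=
  MonoidHom.mk' (fun σ => ⟨pr (tabSL σ).toGL, ⟨tabSL σ, rfl⟩⟩) (by
    intro σ τ
    exact Subtype.ext (pr_tab_mul σ τ))

theorem S4hom_inj : Function.Injective S4hom := by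
  rw [injective_iff_map_eq_one]
  intro σ h
  have h1 : pr (tabSL σ).toGL = 1 := congrArg Subtype.val h
  rw [pr_eq_one'] at h1
  exact tabP_inj σ h1.2.2 h1.1 h1.2.1

theorem card_S4 : Nat.card S4hom.range = 24 := by
  rw [← Nat.card_congr (MonoidHom.ofInjective S4hom_inj).toEquiv, Nat.card_eq_fintype_card,
    Fintype.card_perm]
  rfl

theorem card_S4' : Nat.card (S4hom.range.map PSLinPGL27.subtype) = 24 := by
  rw [Subgroup.card_map_of_injective (Subgroup.subtype_injective _), card_S4]

instance : Finite PGL27 := Nat.finite_of_card_ne_zero (by rw [card_PGL27]; norm_num)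

theorem part_one (k : Type) [Field k] [CharP k 7] (H : Subgroup PGL27) : ¬ HasIp k 7 H := by
  rintro ⟨h7, hI⟩
  letI := Fintype.ofFinite PGL27
  have hcast : ∀ n : ℕ, ¬ 7 ∣ n → (n : k) ≠ 0 := by
    intro n hn h
    exact hn ((CharP.cast_eq_zero_iff k 7 n).mp h)
  have hlt := index_lt k H (S4hom.range.map PSLinPGL27.subtype) sgn (by
      rw [ker_sgn]
      exact Subgroup.map_subtype_le _) (pr X0) sgn_X (hcast _ h7)
      (hcast _ (by rw [card_S4']; norm_num)) (by exact_mod_cast hcast 2 (by norm_num)) hI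
  have h1 := Subgroup.card_mul_index (S4hom.range.map PSLinPGL27.subtype)
  have h2 := Subgroup.card_mul_index H
  rw [card_S4', card_PGL27] at h1
  rw [card_PGL27] at h2
  have h3 : 7 ∣ Nat.card H * H.index := by rw [h2]; norm_num
  have h4 : 7 ∣ H.index := ((Nat.Prime.dvd_mul (by norm_num)).mp h3).resolve_left h7
  have h5 : H.index = 7 := by
    have : H.index ≠ 0 := by
      intro h; rw [h] at h2; omega
    omega
  have hmem : ∀ g : PGL27, g * pr X0 ^ 4 * g⁻¹ ∈ H := by
    intro g
    have := pow_four_fix (X := PGL27 ⧸ H) h5 (pr X0) X_pow (QuotientGroup.mk g⁻¹)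
    rw [MulAction.Quotient.smul_mk, eq_comm, QuotientGroup.eq] at this
    simpa [mul_assoc] using this
  refine h7 (seven_dvd H (pr U0.toGL) U_pow U_ne ?_)
  rw [← U_eq]
  simp only [map_mul, map_pow, map_inv]
  exact H.mul_mem (H.mul_mem (by simpa using hmem 1) (hmem _)) (hmem _)

theorem part_two (k : Type) [Field k] [CharP k 7] : HasIp k 7 S4hom.range := by
  have h7 : ¬ 7 ∣ Nat.card S4hom.range := by rw [card_S4]; norm_num
  refine ⟨h7, ?_⟩
  have hN : Nat.card PSLinPGL27 = 168 := by
    have := Subgroup.card_mul_index PSLinPGL27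
    rw [index_PSL, card_PGL27] at this
    omega
  have hidx : S4hom.range.index = 7 := by
    have := Subgroup.card_mul_index S4hom.range
    rw [card_S4, hN] at this
    omega
  let u : PSLinPGL27 := ⟨pr U0.toGL, ⟨U0, rfl⟩⟩
  have hu : u ^ 7 = 1 := Subtype.ext U_pow
  have hu1 : u ≠ 1 := fun h => U_ne (congrArg Subtype.val h)
  exact indec_of_cyclic k S4hom.range u hu (trans_seven _ hidx h7 u hu hu1)

/-- `PGL_2(7)` does not have property `(I_7)` with respect to any subgroup, although its
index-two subgroup `PSL_2(7)` has property `(I_7)` with respect to a subgroup isomorphic to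
the symmetric group `S_4`. -/
theorem stmt17 (k : Type) [Field k] [IsAlgClosed k] [CharP k 7] :
    (∀ H : Subgroup PGL27, ¬ HasIp k 7 H) ∧
    (PSLinPGL27.index = 2 ∧
      ∃ H : Subgroup ↥PSLinPGL27, Nonempty (↥H ≃* Equiv.Perm (Fin 4)) ∧ HasIp k 7 H) := by
  exact ⟨part_one k, index_PSL, S4hom.range,
    ⟨(MonoidHom.ofInjective S4hom_inj).symm⟩, part_two k⟩
end

section
/- The symmetric group S_7 does not have property (I_5) with respect to any of its subgroups, although its index-2 subgroup A_7 has property (I_5) with respect to a subgroup isomorphic to PSL_2(7) (of order 168). -/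
/-- The projective special linear group `PSL_2(7)`. -/
abbrev PSL27 :=
  Matrix.SpecialLinearGroup (Fin 2) (ZMod 7) ⧸
    Subgroup.center (Matrix.SpecialLinearGroup (Fin 2) (ZMod 7))

open Finset

section Modules

variable {k : Type} [Field k] {G : Type} [Group G] [Fintype G]

/-- The action of `g` on finitely supported functions. -/
noncomputable def act (k : Type) [Field k] {G : Type} [Group G] (X : Type) [MulAction G X] (g : G) :
    (X →₀ k) →ₗ[k] (X →₀ k) := Finsupp.lmapDomain k k (g • ·)

lemma act_single {X : Type} [MulAction G X] (g : G) (x : X) (c : k) :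
    act k X g (Finsupp.single x c) = Finsupp.single (g • x) c := by
  simp [act]

lemma act_apply {X : Type} [MulAction G X] (g : G) (v : X →₀ k) (x : X) :
    act k X g v (g • x) = v x := by
  simp only [act, Finsupp.lmapDomain_apply]
  exact Finsupp.mapDomain_apply (MulAction.injective g) v x

/-- The permutation module as finitely supported functions. -/
noncomputable def pmEquiv (k : Type) [Field k] {G : Type} [Group G] (H : Subgroup G) :
    PermMod k H ≃ₗ[k] (G ⧸ H →₀ k) :=
  (Representation.ofMulAction k G (G ⧸ H)).asModuleEquiv.trans (MonoidAlgebra.coeffLinearEquiv k)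

lemma pmEquiv_smul (H : Subgroup G) (g : G) (v : PermMod k H) :
    pmEquiv k H (MonoidAlgebra.single g (1 : k) • v) = act k _ g (pmEquiv k H v) := by
  simp only [pmEquiv, LinearEquiv.trans_apply, Representation.asModuleEquiv_map_smul,
        Representation.asAlgebraHom_single, one_smul, Representation.ofMulAction_def]
  rfl

/-- An equivariant `k`-linear endomorphism, viewed as a `k[G]`-linear one. -/
noncomputable def toEnd (H : Subgroup G) (f : (G ⧸ H →₀ k) →ₗ[k] (G ⧸ H →₀ k))
    (hf : ∀ (g : G) v, f (act k _ g v) = act k _ g (f v)) :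
    Module.End (MonoidAlgebra k G) (PermMod k H) :=
  MonoidAlgebra.equivariantOfLinearOfComm (V := PermMod k H) (W := PermMod k H)
    (R := k) (M := G)
    ((pmEquiv k H).symm.toLinearMap ∘ₗ f ∘ₗ (pmEquiv k H).toLinearMap) (by
      intro g v
      simp only [LinearMap.comp_apply, LinearEquiv.coe_coe, pmEquiv_smul, hf]
      rw [LinearEquiv.symm_apply_eq, pmEquiv_smul, LinearEquiv.apply_symm_apply])

lemma toEnd_apply (H : Subgroup G) (f : (G ⧸ H →₀ k) →ₗ[k] (G ⧸ H →₀ k))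
    (hf : ∀ (g : G) v, f (act k _ g v) = act k _ g (f v)) (v : PermMod k H) :
    pmEquiv k H (toEnd H f hf v) = f (pmEquiv k H v) := by
  simp [toEnd]

/-- The augmentation map. -/
noncomputable def aug (k : Type) [Field k] (X : Type) : (X →₀ k) →ₗ[k] k :=
  Finsupp.linearCombination k (fun _ => (1 : k))

lemma surj_of_indec (H : Subgroup G)
    (hI : IsIndecomposableModule (MonoidAlgebra k G) (PermMod k H))
    (f : (G ⧸ H →₀ k) →ₗ[k] (G ⧸ H →₀ k))
    (hf : ∀ (g : G) v, f (act k _ g v) = act k _ g (f v))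
    (haug : ∀ v, aug k _ (f v) = aug k _ v) : Function.Surjective f := by
  classical
  set F := toEnd H f hf with hF
  have hFa : ∀ v, pmEquiv k H (F v) = f (pmEquiv k H v) := toEnd_apply H f hf
  haveI : IsNoetherian (MonoidAlgebra k G) (PermMod k H) := isNoetherian_of_tower k inferInstance
  haveI : IsArtinian (MonoidAlgebra k G) (PermMod k H) := isArtinian_of_tower k inferInstance
  obtain ⟨n, hn, hn1⟩ := ((LinearMap.eventually_isCompl_ker_pow_range_pow F).and
    (Filter.eventually_ge_atTop 1)).exists
  have haugn : ∀ (n : ℕ) (v : PermMod k H), aug k (G ⧸ H) (pmEquiv k H ((F ^ n) v)) =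
      aug k _ (pmEquiv k H v) := by
    intro n
    induction n with
    | zero => intro v; rfl
    | succ n ih =>
      intro v
      rw [pow_succ', Module.End.mul_apply, hFa, haug, ih]
  rcases hI.2 _ _ hn with h | h
  · rw [h] at hn
    have htop : LinearMap.range (F ^ n) = ⊤ := by simpa using hn.sup_eq_top
    intro v
    obtain ⟨w, hw⟩ := LinearMap.range_eq_top.mp htop ((pmEquiv k H).symm v)
    obtain ⟨m, rfl⟩ : ∃ m, n = m + 1 := ⟨n - 1, by omega⟩
    rw [pow_succ', Module.End.mul_apply] at hw
    refine ⟨pmEquiv k H ((F ^ m) w), ?_⟩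
    rw [← hFa, hw, LinearEquiv.apply_symm_apply]
  · exfalso
    have h0 : F ^ n = 0 := LinearMap.range_eq_bot.mp h
    have h1 := haugn n ((pmEquiv k H).symm (Finsupp.single ((1 : G) : G ⧸ H) 1))
    rw [h0, LinearEquiv.apply_symm_apply] at h1
    have h2 : aug k (G ⧸ H) (Finsupp.single ((1 : G) : G ⧸ H) 1) = 1 := by
      simp [aug]
    rw [h2] at h1
    simp at h1

/-- Averaging map `k[G/K] → k[G/H]`. -/
noncomputable def avg (k : Type) [Field k] (K H : Subgroup G) [Fintype K] :
    (G ⧸ K →₀ k) →ₗ[k] (G ⧸ H →₀ k) :=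
  Finsupp.linearCombination k (fun q : G ⧸ K =>
    ((Fintype.card K : k)⁻¹) • ∑ x : K, Finsupp.single ((q.out * (x : G) : G) : G ⧸ H) (1 : k))

lemma avg_single (K H : Subgroup G) [Fintype K] (g : G) :
    avg k K H (Finsupp.single (g : G ⧸ K) 1) =
      ((Fintype.card K : k)⁻¹) • ∑ x : K, Finsupp.single ((g * (x : G) : G) : G ⧸ H) (1 : k) := by
  simp only [avg, Finsupp.linearCombination_single, one_smul]
  congr 1
  obtain ⟨x0, hx0⟩ := QuotientGroup.mk_out_eq_mul K g
  rw [hx0]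
  refine Fintype.sum_equiv (Equiv.mulLeft x0) _ _ fun x => ?_
  simp [mul_assoc]

lemma avg_equivariant (K H : Subgroup G) [Fintype K] (g : G) (v : G ⧸ K →₀ k) :
    avg k K H (act k (G ⧸ K) g v) =
      act k (G ⧸ H) g (avg k K H v) := by
  have : avg k K H ∘ₗ act k (G ⧸ K) g =
      act k (G ⧸ H) g ∘ₗ avg k K H := by
    refine Finsupp.lhom_ext' fun q => LinearMap.ext_ring ?_
    induction q using QuotientGroup.induction_on with
    | H a =>
      simp only [LinearMap.comp_apply, Finsupp.lsingle_apply,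
        act_single, avg_single, map_smul, map_sum]
      rw [show g • (a : G ⧸ K) = ((g * a : G) : G ⧸ K) from rfl, avg_single]
      congr 1
      refine Finset.sum_congr rfl fun x _ => ?_
      rw [mul_assoc]; rfl
  exact LinearMap.congr_fun this v

lemma avg_aug (K H : Subgroup G) [Fintype K] (hK : (Fintype.card K : k) ≠ 0) (v : G ⧸ K →₀ k) :
    aug k _ (avg k K H v) = aug k _ v := by
  have : aug k _ ∘ₗ avg k K H = aug k (G ⧸ K) := by
    refine Finsupp.lhom_ext' fun q => LinearMap.ext_ring ?_
    induction q using QuotientGroup.induction_on with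
    | H a =>
      simp only [LinearMap.comp_apply, Finsupp.lsingle_apply, avg_single, map_smul, map_sum]
      simp [aug, hK]
  exact LinearMap.congr_fun this v

lemma avg_surj (K H : Subgroup G) [Fintype K] [Fintype H] (hK : (Fintype.card K : k) ≠ 0)
    (hH : (Fintype.card H : k) ≠ 0)
    (hI : IsIndecomposableModule (MonoidAlgebra k G) (PermMod k H)) :
    Function.Surjective (avg k K H) := by
  have := surj_of_indec H hI (avg k K H ∘ₗ avg k H K)
    (fun g v => by simp [avg_equivariant]) (fun v => by simp [avg_aug, hK, hH])
  rw [LinearMap.coe_comp] at this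
  exact this.of_comp

lemma card_le_of_indec (K H : Subgroup G) [Fintype K] [Fintype H] (hK : (Fintype.card K : k) ≠ 0)
    (hH : (Fintype.card H : k) ≠ 0)
    (hI : IsIndecomposableModule (MonoidAlgebra k G) (PermMod k H)) :
    Nat.card K ≤ Nat.card H := by
  classical
  have h := LinearMap.finrank_le_finrank_of_surjective (avg_surj K H hK hH hI)
  rw [Module.finrank_finsupp_self, Module.finrank_finsupp_self, ← Nat.card_eq_fintype_card,
    ← Nat.card_eq_fintype_card] at h
  have h1 := Subgroup.card_eq_card_quotient_mul_card_subgroup H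
  have h2 := Subgroup.card_eq_card_quotient_mul_card_subgroup K
  have h3 : 0 < Nat.card (G ⧸ H) := Nat.card_pos
  by_contra hlt
  push Not at hlt
  have : Nat.card (G ⧸ H) * Nat.card H < Nat.card (G ⧸ K) * Nat.card K :=
    (Nat.mul_lt_mul_of_pos_left hlt h3).trans_le (Nat.mul_le_mul_right _ h)
  omega

lemma fun_zero_of_indec (K H : Subgroup G) [Fintype K] [Fintype H]
    (hK : (Fintype.card K : k) ≠ 0) (hH : (Fintype.card H : k) ≠ 0)
    (hI : IsIndecomposableModule (MonoidAlgebra k G) (PermMod k H))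
    (u : G ⧸ H → k) (hu : ∀ g : G, ∑ x : K, u ((g * (x : G) : G) : G ⧸ H) = 0) : u = 0 := by
  have h0 : Finsupp.linearCombination k u ∘ₗ avg k K H = 0 := by
    refine Finsupp.lhom_ext' fun q => LinearMap.ext_ring ?_
    induction q using QuotientGroup.induction_on with
    | H a =>
      simp only [LinearMap.comp_apply, Finsupp.lsingle_apply, avg_single, map_smul, map_sum]
      simp [hu]
  funext q
  obtain ⟨w, hw⟩ := avg_surj K H hK hH hI (Finsupp.single q 1)
  have := LinearMap.congr_fun h0 w
  rw [LinearMap.comp_apply, hw] at this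
  simpa using this

/-- A permutation module on a two-transitive coset space of degree divisible by the characteristic
is indecomposable. -/
lemma indec_of_two_transitive (H : Subgroup G)
    (hcard : (Nat.card (G ⧸ H) : k) = 0) (x : G) (hx : x ∉ H)
    (htrans : ∀ q : G ⧸ H, q = ((1 : G) : G ⧸ H) ∨ ∃ h ∈ H, q = ((h * x : G) : G ⧸ H)) :
    IsIndecomposableModule (MonoidAlgebra k G) (PermMod k H) := by
  classical
  let ρ : G → (G ⧸ H →₀ k) →ₗ[k] (G ⧸ H →₀ k) := act k (G ⧸ H)
  have hnt : Nontrivial (PermMod k H) := (pmEquiv k H).toEquiv.nontrivial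
  refine ⟨hnt, fun N N' hc => ?_⟩
  let P : Module.End (MonoidAlgebra k G) (PermMod k H) := N.projection N' hc
  let p : (G ⧸ H →₀ k) →ₗ[k] (G ⧸ H →₀ k) :=
    (pmEquiv k H).toLinearMap ∘ₗ P.restrictScalars k ∘ₗ (pmEquiv k H).symm.toLinearMap
  have hpdef : ∀ v, p v = pmEquiv k H (P ((pmEquiv k H).symm v)) := fun v => rfl
  have hpρ : ∀ (g : G) (v : G ⧸ H →₀ k), p (ρ g v) = ρ g (p v) := by
    intro g v
    have h1 : (pmEquiv k H).symm (ρ g v) =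
        MonoidAlgebra.single g (1 : k) • (pmEquiv k H).symm v := by
      rw [LinearEquiv.symm_apply_eq, pmEquiv_smul, LinearEquiv.apply_symm_apply]
    rw [hpdef, h1, map_smul, pmEquiv_smul, hpdef]
  have hpp : ∀ v, p (p v) = p v := by
    intro v
    have := (Submodule.isIdempotentElem_projection hc).eq
    rw [hpdef, hpdef v, LinearEquiv.symm_apply_apply]
    exact congrArg _ (LinearMap.congr_fun this _)
  set e : G ⧸ H := ((1 : G) : G ⧸ H) with he
  set T : G ⧸ H →₀ k := ∑ q, Finsupp.single q 1 with hT
  set β : k := p (Finsupp.single e 1) ((x : G) : G ⧸ H) with hβ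
  set α : k := p (Finsupp.single e 1) e - β with hα
  have hρapp : ∀ (g : G) (v : G ⧸ H →₀ k) (q : G ⧸ H), ρ g v (g • q) = v q := by
    exact fun g v q => act_apply g v q
  have hTapp : ∀ q, T q = 1 := by
    intro q
    simp [hT, Finsupp.finset_sum_apply, Finsupp.single_apply]
  have hHe : ∀ h ∈ H, h • e = e := by
    intro h hh
    rw [he, MulAction.Quotient.smul_coe, QuotientGroup.eq]
    simpa using hh
  have hxe : ((x : G) : G ⧸ H) ≠ e := by
    rw [he, Ne, QuotientGroup.eq]
    simpa using hx
  have hpe : p (Finsupp.single e 1) = α • Finsupp.single e 1 + β • T := by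
    ext q
    rcases htrans q with h | ⟨h, hh, h2⟩
    · rw [h]
      simp [hTapp, hα]
    · have hqe : q ≠ e := by
        intro hq
        rw [h2] at hq
        have h3 : h • ((x : G) : G ⧸ H) = h • e := (hHe h hh).symm ▸ hq
        exact hxe (MulAction.injective h h3)
      have h3 : ρ h (Finsupp.single e 1) = Finsupp.single e 1 := by
        rw [act_single, hHe h hh]
      have h4 : p (Finsupp.single e 1) q = β := by
        rw [← h3, hpρ, h2]
        exact hρapp h _ ((x : G) : G ⧸ H)
      simp [hTapp, h4, Finsupp.single_apply, hqe.symm]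
  have hρT : ∀ g, ρ g T = T := by
    intro g
    ext q
    have := hρapp g T (g⁻¹ • q)
    rw [smul_inv_smul] at this
    rw [this, hTapp, hTapp]
  have hp : ∀ v, p v = α • v + (β * aug k _ v) • T := by
    intro v
    have : p = α • LinearMap.id + (β • (aug k (G ⧸ H)).smulRight T) := by
      refine Finsupp.lhom_ext' fun q => LinearMap.ext_ring ?_
      induction q using QuotientGroup.induction_on with
      | H a =>
        have h5 : Finsupp.single (a : G ⧸ H) (1 : k) = ρ a (Finsupp.single e 1) := by
          rw [act_single]
          congr 1
          rw [he]
          change _ = ((a * 1 : G) : G ⧸ H)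
          rw [mul_one]
        simp only [LinearMap.comp_apply, Finsupp.lsingle_apply]
        conv_lhs => rw [h5, hpρ, hpe, map_add, map_smul, map_smul, hρT, ← h5]
        simp [aug]
    rw [this]
    simp [mul_smul]
  have haT : aug k _ T = 0 := by
    simp [hT, aug, ← hcard, Nat.card_eq_fintype_card]
  have hpT : p T = α • T := by rw [hp, haT]; simp
  have key := hpp (Finsupp.single e 1)
  rw [hpe, map_add, map_smul, map_smul, hpT, hpe] at key
  have k1 := DFunLike.congr_fun key ((x : G) : G ⧸ H)
  have k2 := DFunLike.congr_fun key e
  simp [hTapp, Finsupp.single_apply, Ne.symm hxe] at k1 k2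
  have hα01 : α * (α - 1) = 0 := by linear_combination k2 - k1
  have hβ0 : β = 0 := by
    have : β * (2 * α - 1) = 0 := by linear_combination k1
    rcases mul_eq_zero.mp this with h | h
    · exact h
    · rcases mul_eq_zero.mp hα01 with h' | h'
      · exfalso; rw [h'] at h; simp at h
      · exfalso
        rw [sub_eq_zero.mp h'] at h
        norm_num at h
  rcases mul_eq_zero.mp hα01 with h' | h'
  · left
    rw [eq_bot_iff]
    intro v hv
    have h6 : P v = v := (Submodule.projection_eq_self_iff hc v).mpr hv
    have h7 : p (pmEquiv k H v) = 0 := by rw [hp, h', hβ0]; simp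
    rw [hpdef, LinearEquiv.symm_apply_apply, h6] at h7
    simpa using h7
  · right
    rw [eq_bot_iff]
    intro v hv
    have h6 : P v = 0 := (Submodule.projection_apply_eq_zero_iff hc).mpr hv
    have h7 : p (pmEquiv k H v) = pmEquiv k H v := by
      rw [hp, sub_eq_zero.mp h', hβ0]; simp
    rw [hpdef, LinearEquiv.symm_apply_apply, h6] at h7
    simpa using h7.symm

end Modules

section Check

/-- The two-sided product word `c^i h c^j h`, with `c` the translation by one. -/
def wordF (h : Fin 7 → Fin 7) (i j x : Fin 7) : Fin 7 := h (h x + j) + i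

/-- The sign of a permutation, from its inversions. -/
def sgnF (h : Fin 7 → Fin 7) : ℤˣ :=
  ∏ j, ∏ i ∈ Finset.Iio j, (if h i < h j then 1 else -1)

/-- The dichotomy to be checked: affine or with a word of order five. -/
def DichF (h : Fin 7 → Fin 7) : Prop :=
  sgnF h = -1 → (∀ x, h x = h 1 * x) ∨
    ∃ i j : Fin 7, (∀ x, wordF h i j (wordF h i j (wordF h i j (wordF h i j (wordF h i j x)))) = x) ∧
      ∃ x, wordF h i j x ≠ x

instance (h : Fin 7 → Fin 7) : Decidable (DichF h) := by unfold DichF; infer_instance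

set_option maxRecDepth 100000 in
set_option synthInstance.maxHeartbeats 1000000 in
set_option synthInstance.maxSize 10000 in
lemma dich_check : ∀ a : Fin 7, a ≠ 0 → ∀ b : Fin 7, b ≠ 0 ∧ b ≠ a →
    ∀ c : Fin 7, c ≠ 0 ∧ c ≠ a ∧ c ≠ b → ∀ d : Fin 7, d ≠ 0 ∧ d ≠ a ∧ d ≠ b ∧ d ≠ c →
    ∀ e : Fin 7, e ≠ 0 ∧ e ≠ a ∧ e ≠ b ∧ e ≠ c ∧ e ≠ d →
    ∀ f : Fin 7, f ≠ 0 ∧ f ≠ a ∧ f ≠ b ∧ f ≠ c ∧ f ≠ d ∧ f ≠ e →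
    DichF ![0, a, b, c, d, e, f] := by
  decide +kernel

end Check

section PSL

/-- An involution of the seven points: `(1 2)(3 6)`. -/
def sF (x : ZMod 7) : ZMod 7 := (![0, 2, 1, 6, 4, 5, 3] : Fin 7 → Fin 7) x

/-- The action of the matrix `(a b; c d)` on seven points. -/
def actF (a b c d x : ZMod 7) : ZMod 7 :=
  if c = 0 then a * a * x + a * b
  else a * (c * c * c * c * c) + c * c * c * c * sF (x + d * (c * c * c * c * c))

set_option maxRecDepth 100000 in
lemma actF_w : ∀ a b c d : ZMod 7, a * d - b * c = 1 → ∀ x : ZMod 7,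
    actF (-c) (-d) a b x = sF (actF a b c d x) := by
  decide +kernel

set_option maxRecDepth 100000 in
lemma actF_ker : ∀ a b c d : ZMod 7, a * d - b * c = 1 → (∀ x : ZMod 7, actF a b c d x = x) →
   b = 0 ∧ c = 0 ∧ a = d ∧ a * a = 1 := by
  decide +kernel

/-- The permutation `(3 4)(5 6)`. -/
def xF (x : ZMod 7) : ZMod 7 := (![0, 1, 2, 4, 3, 6, 5] : Fin 7 → Fin 7) x

set_option maxRecDepth 100000 in
lemma not_mem_check : ∀ a b c d : ZMod 7, a * d - b * c = 1 →
   (∃ x, actF a b c d x ≠ xF x) ∧ (∀ i : ZMod 7, i ≠ 0 → ∃ x, actF a b c d x ≠ xF (i + xF x)) ∧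
   (∀ i : ZMod 7, ∃ x, actF a b c d x ≠ xF (i + sF (xF x))) ∧
   (∀ i : ZMod 7, i ≠ 0 → ∃ x, actF a b c d x ≠ xF (sF (i + sF (xF x)))) := by
  decide +kernel

/-- Shorthand for `SL_2(7)`. -/
abbrev SL7 := Matrix.SpecialLinearGroup (Fin 2) (ZMod 7)

/-- The action of a matrix of determinant one on seven points. -/
def actM (g : SL7) (x : ZMod 7) : ZMod 7 := actF (g.1 0 0) (g.1 0 1) (g.1 1 0) (g.1 1 1) x

lemma det7 (g : SL7) : g.1 0 0 * g.1 1 1 - g.1 0 1 * g.1 1 0 = 1 := by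
  have := g.2
  rwa [Matrix.det_fin_two] at this

instance factPrime7 : Fact (Nat.Prime 7) := ⟨by norm_num⟩

lemma mul00 (g h : SL7) : (g * h).1 0 0 = g.1 0 0 * h.1 0 0 + g.1 0 1 * h.1 1 0 := by
  rw [Matrix.SpecialLinearGroup.coe_mul, Matrix.mul_apply, Fin.sum_univ_two]
lemma mul01 (g h : SL7) : (g * h).1 0 1 = g.1 0 0 * h.1 0 1 + g.1 0 1 * h.1 1 1 := by
  rw [Matrix.SpecialLinearGroup.coe_mul, Matrix.mul_apply, Fin.sum_univ_two]
lemma mul10 (g h : SL7) : (g * h).1 1 0 = g.1 1 0 * h.1 0 0 + g.1 1 1 * h.1 1 0 := by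
  rw [Matrix.SpecialLinearGroup.coe_mul, Matrix.mul_apply, Fin.sum_univ_two]
lemma mul11 (g h : SL7) : (g * h).1 1 1 = g.1 1 0 * h.1 0 1 + g.1 1 1 * h.1 1 1 := by
  rw [Matrix.SpecialLinearGroup.coe_mul, Matrix.mul_apply, Fin.sum_univ_two]

lemma SL7_ext (g h : SL7) (h00 : g.1 0 0 = h.1 0 0) (h01 : g.1 0 1 = h.1 0 1)
    (h10 : g.1 1 0 = h.1 1 0) (h11 : g.1 1 1 = h.1 1 1) : g = h := by
  ext i j
  fin_cases i <;> fin_cases j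
  · exact h00
  · exact h01
  · exact h10
  · exact h11

/-- The Weyl element. -/
def wM : SL7 := ⟨!![0, -1; 1, 0], by simp [Matrix.det_fin_two]⟩

/-- The transvections. -/
def tM (b : ZMod 7) : SL7 := ⟨!![1, b; 0, 1], by simp [Matrix.det_fin_two]⟩

/-- The diagonal matrices. -/
def mM (a : ZMod 7) (ha : a * (a * a * a * a * a) = 1) : SL7 :=
  ⟨!![a, 0; 0, a * a * a * a * a], by simp [Matrix.det_fin_two, ha]⟩

lemma w00 : wM.1 0 0 = 0 := rfl
lemma w01 : wM.1 0 1 = -1 := rfl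
lemma w10 : wM.1 1 0 = 1 := rfl
lemma w11 : wM.1 1 1 = 0 := rfl
lemma t00 (b) : (tM b).1 0 0 = 1 := rfl
lemma t01 (b) : (tM b).1 0 1 = b := rfl
lemma t10 (b) : (tM b).1 1 0 = 0 := rfl
lemma t11 (b) : (tM b).1 1 1 = 1 := rfl
lemma m00 (a ha) : (mM a ha).1 0 0 = a := rfl
lemma m01 (a ha) : (mM a ha).1 0 1 = 0 := rfl
lemma m10 (a ha) : (mM a ha).1 1 0 = 0 := rfl
lemma m11 (a ha) : (mM a ha).1 1 1 = a * a * a * a * a := rfl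

lemma pow5 : ∀ a : ZMod 7, a ≠ 0 → a * (a * a * a * a * a) = 1 := by decide +kernel

lemma actM_one (x : ZMod 7) : actM 1 x = x := by
  simp [actM, actF]

lemma actM_wM_mul (h : SL7) (x : ZMod 7) : actM (wM * h) x = sF (actM h x) := by
  have := actF_w _ _ _ _ (det7 h) x
  rw [actM, actM, ← this]
  simp only [mul00, mul01, mul10, mul11, w00, w01, w10, w11]
  congr 1 <;> ring

lemma actM_tM_mul (b : ZMod 7) (h : SL7) (x : ZMod 7) : actM (tM b * h) x = b + actM h x := by
  have hd := det7 h
  simp only [actM, actF]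
  simp only [mul00, mul01, mul10, mul11, t00, t01, t10, t11, one_mul, zero_mul, zero_add]
  split_ifs with hc
  · rw [hc] at hd ⊢
    linear_combination b * hd
  · linear_combination b * pow5 _ hc

lemma actM_mM_mul (a : ZMod 7) (ha) (h : SL7) (x : ZMod 7) :
    actM (mM a ha * h) x = a * a * actM h x := by
  have ha0 : a ≠ 0 := by rintro rfl; exact absurd ha (by decide)
  have ha' : a ^ 6 = 1 := by rw [← ha]; ring
  simp only [actM, actF]
  simp only [mul00, mul01, mul10, mul11, m00, m01, m10, m11, zero_mul, zero_add, add_zero]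
  have h6 : ∀ n : ℕ, a ^ (6 * n) = 1 := fun n => by rw [pow_mul, ha', one_pow]
  have h0 : a * a * a * a * a * h.1 1 0 = 0 ↔ h.1 1 0 = 0 := by simp [ha0]
  simp only [h0]
  split_ifs with hc
  · ring
  · generalize h.1 1 0 = c at *
    generalize h.1 1 1 = d at *
    generalize h.1 0 0 = e at *
    have e1 : a * a * a * a * a * d * (a * a * a * a * a * c * (a * a * a * a * a * c) *
      (a * a * a * a * a * c) * (a * a * a * a * a * c) * (a * a * a * a * a * c)) =
      d * (c * c * c * c * c) := by linear_combination (d * c ^ 5) * h6 5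
    rw [e1]
    generalize sF _ = y
    linear_combination (e * c ^ 5 * a ^ 2) * h6 4 + (c ^ 4 * y * a ^ 2) * h6 3

lemma actM_wM (x : ZMod 7) : actM wM x = sF x := by
  rw [← mul_one wM, actM_wM_mul, actM_one]
lemma actM_tM (b x : ZMod 7) : actM (tM b) x = b + x := by
  rw [← mul_one (tM b), actM_tM_mul, actM_one]
lemma actM_mM (a : ZMod 7) (ha) (x : ZMod 7) : actM (mM a ha) x = a * a * x := by
  rw [← mul_one (mM a ha), actM_mM_mul, actM_one]

lemma SL7_induction (P : SL7 → Prop) (hw : P wM) (ht : ∀ b, P (tM b)) (hm : ∀ a ha, P (mM a ha))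
    (hmul : ∀ g h, P g → P h → P (g * h)) (g : SL7) : P g := by
  have hd := det7 g
  by_cases hc : g.1 1 0 = 0
  · rw [hc, mul_zero, sub_zero] at hd
    have ha0 : g.1 0 0 ≠ 0 := by intro h; rw [h, zero_mul] at hd; exact absurd hd (by decide)
    have ha := pow5 _ ha0
    have : g = tM (g.1 0 0 * g.1 0 1) * mM (g.1 0 0) ha := by
      apply SL7_ext <;> simp only [mul00, mul01, mul10, mul11, t00, t01, t10, t11, m00, m01, m10, m11]
      · ring
      · linear_combination (- g.1 0 1) * ha
      · rw [hc]; ring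
      · apply mul_left_cancel₀ ha0
        linear_combination hd - ha
    rw [this]
    exact hmul _ _ (ht _) (hm _ _)
  · have ha := pow5 _ hc
    have : g = tM (g.1 0 0 * (g.1 1 0 * g.1 1 0 * g.1 1 0 * g.1 1 0 * g.1 1 0)) * (wM *
      (mM (g.1 1 0) ha * tM (g.1 1 1 * (g.1 1 0 * g.1 1 0 * g.1 1 0 * g.1 1 0 * g.1 1 0)))) := by
      apply SL7_ext <;> simp only [mul00, mul01, mul10, mul11, t00, t01, t10, t11, m00, m01, m10,
        m11, w00, w01, w10, w11]
      · linear_combination (- g.1 0 0) * ha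
      · apply mul_left_cancel₀ hc
        have h6 : g.1 1 0 ^ 6 = 1 := by linear_combination ha
        linear_combination (-1) * hd + (1 - g.1 0 0 * g.1 1 1 * (g.1 1 0 ^ 6 + 1)) * h6
      · ring
      · linear_combination (- g.1 1 1) * ha
    rw [this]
    exact hmul _ _ (ht _) (hmul _ _ hw (hmul _ _ (hm _ _) (ht _)))

lemma actM_mul (g h : SL7) (x : ZMod 7) : actM (g * h) x = actM g (actM h x) := by
  revert h x
  refine SL7_induction (fun g => ∀ h x, actM (g * h) x = actM g (actM h x)) ?_ ?_ ?_ ?_ g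
  · intro h x; rw [actM_wM_mul, actM_wM]
  · intro b h x; rw [actM_tM_mul, actM_tM]
  · intro a ha h x; rw [actM_mM_mul, actM_mM]
  · intro g1 g2 h1 h2 h x
    rw [mul_assoc, h1, h2, h1]

/-- The action on `Fin 7`. -/
def actP (g : SL7) (x : Fin 7) : Fin 7 := actM g x

lemma actP_mul (g h : SL7) (x : Fin 7) : actP (g * h) x = actP g (actP h x) := actM_mul g h x
lemma actP_one (x : Fin 7) : actP 1 x = x := actM_one x
lemma actP_wM (x : Fin 7) : actP wM x = (![0, 2, 1, 6, 4, 5, 3] : Fin 7 → Fin 7) x := actM_wM x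
lemma actP_tM (b x : Fin 7) : actP (tM b) x = b + x := actM_tM b x
lemma actP_mM (a : Fin 7) (ha) (x : Fin 7) : actP (mM a ha) x = a * a * x := actM_mM a ha x

/-- The homomorphism from `SL_2(7)` to the symmetric group on seven points. -/
def homS : SL7 →* Equiv.Perm (Fin 7) where
  toFun g :=
    { toFun := actP g
      invFun := actP g⁻¹
      left_inv := fun x => by rw [← actP_mul, inv_mul_cancel, actP_one]
      right_inv := fun x => by rw [← actP_mul, mul_inv_cancel, actP_one] }
  map_one' := Equiv.ext fun x => actP_one x
  map_mul' g h := Equiv.ext fun x => actP_mul g h x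

lemma homS_apply (g : SL7) (x : Fin 7) : homS g x = actP g x := rfl

lemma sign_of_pow {σ : Equiv.Perm (Fin 7)} {n : ℕ} (hn : Odd n) (h : σ ^ n = 1) :
    Equiv.Perm.sign σ = 1 := by
  have h1 := congrArg Equiv.Perm.sign h
  rw [map_pow, map_one] at h1
  rcases Int.units_eq_one_or (Equiv.Perm.sign σ) with h2 | h2
  · exact h2
  · rw [h2, hn.neg_one_pow] at h1
    exact absurd h1 (by decide)

lemma sign_homS (g : SL7) : Equiv.Perm.sign (homS g) = 1 := by
  refine SL7_induction (fun g => Equiv.Perm.sign (homS g) = 1) ?_ ?_ ?_ ?_ g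
  · have : homS wM = Equiv.swap 1 2 * Equiv.swap 3 6 := by
      apply Equiv.ext
      intro x
      rw [homS_apply, actP_wM]
      revert x
      decide
    rw [this, Equiv.Perm.sign_mul, Equiv.Perm.sign_swap (by decide),
      Equiv.Perm.sign_swap (by decide)]
    rfl
  · intro b
    refine sign_of_pow (n := 7) (by decide) ?_
    apply Equiv.ext
    intro x
    simp only [pow_succ, pow_zero, one_mul, Equiv.Perm.mul_apply, homS_apply]
    have : ∀ b x : Fin 7, b + (b + (b + (b + (b + (b + (b + x)))))) = x := by decide +kernel
    have h2 := actP_tM b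
    rw [h2, h2, h2, h2, h2, h2, h2]
    exact this b x
  · intro a ha
    refine sign_of_pow (n := 3) (by decide) ?_
    apply Equiv.ext
    intro x
    have h1 : ∀ y : Fin 7, homS (mM a ha) y = actP (mM a ha) y := fun y => rfl
    have h2 := actP_mM a ha
    have : ∀ a : Fin 7, a * (a * a * a * a * a) = 1 → ∀ x : Fin 7,
        a * a * (a * a * (a * a * x)) = x := by decide +kernel
    have h3 := this a ha x
    simp only [pow_succ, pow_zero, one_mul, Equiv.Perm.mul_apply, h1, Equiv.Perm.one_apply]
    rw [h2, h2, h2]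
    exact h3
  · intro g h hg hh
    rw [map_mul, map_mul, hg, hh, one_mul]

/-- The homomorphism from `SL_2(7)` to the alternating group on seven points. -/
def homA : SL7 →* alternatingGroup (Fin 7) :=
  homS.codRestrict _ (fun g => Equiv.Perm.mem_alternatingGroup.mpr (sign_homS g))

lemma homA_apply (g : SL7) (x : Fin 7) : (homA g : Equiv.Perm (Fin 7)) x = actP g x := rfl

lemma homA_ker : homA.ker = Subgroup.center SL7 := by
  ext g
  rw [MonoidHom.mem_ker, Matrix.SpecialLinearGroup.mem_center_iff]
  constructor
  · intro h
    have h1 : ∀ x : ZMod 7, actM g x = x := by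
      intro x
      refine (homA_apply g x).symm.trans ?_
      rw [h]; rfl
    obtain ⟨hb, hc, had, haa⟩ := actF_ker _ _ _ _ (det7 g) h1
    refine ⟨g.1 0 0, by simpa [pow_two] using haa, ?_⟩
    ext i j
    fin_cases i <;> fin_cases j <;> simp [hb, hc, had]
  · rintro ⟨r, hr, h⟩
    have hr' : r * r = 1 := by simpa [pow_two] using hr
    apply Subtype.ext
    apply Equiv.ext
    intro x
    refine (homA_apply g x).trans ?_
    have h2 : ∀ y : ZMod 7, actM g y = y := by
      intro y
      have h10 : g.1 1 0 = 0 := by rw [← h]; simp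
      have h01 : g.1 0 1 = 0 := by rw [← h]; simp
      have h00 : g.1 0 0 = r := by rw [← h]; simp
      rw [actM, h10, h01, h00]
      simp [actF, hr']
    exact h2 x

lemma card_SL7 : Nat.card SL7 = 336 := by
  let e : SL7 ≃ {q : Fin 7 × Fin 7 × Fin 7 × Fin 7 // q.1 * q.2.2.2 - q.2.1 * q.2.2.1 = 1} :=
    { toFun := fun g => ⟨(g.1 0 0, g.1 0 1, g.1 1 0, g.1 1 1), det7 g⟩
      invFun := fun q => ⟨(!![q.1.1, q.1.2.1; q.1.2.2.1, q.1.2.2.2] : Matrix (Fin 2) (Fin 2) (ZMod 7)),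
        by rw [Matrix.det_fin_two]; exact q.2⟩
      left_inv := fun g => SL7_ext _ _ rfl rfl rfl rfl
      right_inv := fun q => rfl }
  rw [Nat.card_congr e, Nat.card_eq_fintype_card, Fintype.card_subtype]
  decide +kernel

/-- The subgroup of the alternating group isomorphic to `PSL_2(7)`. -/
def H168 : Subgroup (alternatingGroup (Fin 7)) := homA.range

lemma H168_equiv : Nonempty (H168 ≃* PSL27) :=
  ⟨((QuotientGroup.quotientMulEquivOfEq homA_ker.symm).trans
    (QuotientGroup.quotientKerEquivRange homA)).symm⟩

lemma card_center7 : Nat.card (Subgroup.center SL7) = 2 := by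
  have hne : (1 : SL7) ≠ mM (-1) (by decide) := by
    intro h
    have := congrArg (fun g : SL7 => g.1 0 0) h
    exact absurd this (by decide)
  have : ((Subgroup.center SL7 : Subgroup SL7) : Set SL7) = {1, mM (-1) (by decide)} := by
    ext g
    rw [SetLike.mem_coe, Matrix.SpecialLinearGroup.mem_center_iff]
    simp only [Set.mem_insert_iff, Set.mem_singleton_iff, Fintype.card_fin]
    constructor
    · rintro ⟨r, hr, h⟩
      have h10 : g.1 1 0 = 0 := by rw [← h]; simp
      have h01 : g.1 0 1 = 0 := by rw [← h]; simp
      have h00 : g.1 0 0 = r := by rw [← h]; simp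
      have h11 : g.1 1 1 = r := by rw [← h]; simp
      have hsq : ∀ r : ZMod 7, r ^ 2 = 1 → r = 1 ∨ r = -1 := by decide +kernel
      rcases hsq r hr with h1 | h1
      · left; apply SL7_ext <;> simp [*]
      · right; apply SL7_ext <;> simp [*, m00, m01, m10, m11]
    · rintro (rfl | rfl)
      · exact ⟨1, by simp, by simp⟩
      · refine ⟨-1, by simp, ?_⟩
        ext i j
        fin_cases i <;> fin_cases j <;> rfl
  rw [← SetLike.coe_sort_coe, this, Nat.card_coe_set_eq, Set.ncard_pair hne]

lemma card_H168 : Nat.card H168 = 168 := by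
  have h1 := Subgroup.card_eq_card_quotient_mul_card_subgroup (Subgroup.center SL7)
  rw [card_SL7, card_center7, ← Nat.card_congr H168_equiv.some.toEquiv] at h1
  omega

lemma card_A7 : Nat.card (alternatingGroup (Fin 7)) = 2520 := by
  rw [Nat.card_eq_fintype_card, card_alternatingGroup]
  decide

lemma card_quot : Nat.card (alternatingGroup (Fin 7) ⧸ H168) = 15 := by
  have h1 := Subgroup.card_eq_card_quotient_mul_card_subgroup H168
  rw [card_A7, card_H168] at h1
  omega

/-- The element `(3 4)(5 6)` of the alternating group. -/
def xA : alternatingGroup (Fin 7) :=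
  ⟨Equiv.swap 3 4 * Equiv.swap 5 6, by
    rw [Equiv.Perm.mem_alternatingGroup, Equiv.Perm.sign_mul, Equiv.Perm.sign_swap (by decide),
      Equiv.Perm.sign_swap (by decide)]
    rfl⟩

lemma xA_apply (x : Fin 7) : (xA : Equiv.Perm (Fin 7)) x = xF x := by
  have h : ∀ x : Fin 7, (Equiv.swap 3 4 * Equiv.swap 5 6 : Equiv.Perm (Fin 7)) x =
      (![0, 1, 2, 4, 3, 6, 5] : Fin 7 → Fin 7) x := by decide
  exact h x

lemma xA_inv : xA⁻¹ = xA := by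
  rw [inv_eq_iff_mul_eq_one]
  apply Subtype.ext
  apply Equiv.ext
  decide

lemma not_mem_of (y : alternatingGroup (Fin 7)) (f : ZMod 7 → ZMod 7)
    (hf : ∀ x : Fin 7, (y : Equiv.Perm (Fin 7)) x = f x)
    (h : ∀ g : SL7, ∃ x, actM g x ≠ f x) : y ∉ H168 := by
  rintro ⟨g, rfl⟩
  obtain ⟨x, hx⟩ := h g
  exact hx ((homA_apply g x).symm.trans (hf x))

lemma xA_not_mem : xA ∉ H168 :=
  not_mem_of xA xF xA_apply fun g => (not_mem_check _ _ _ _ (det7 g)).1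

lemma conj_t_not_mem (i : ZMod 7) (hi : i ≠ 0) : xA⁻¹ * (homA (tM i) * xA) ∉ H168 := by
  refine not_mem_of _ (fun x => xF (i + xF x)) ?_
    fun g => (not_mem_check _ _ _ _ (det7 g)).2.1 i hi
  intro x
  rw [xA_inv]
  refine (xA_apply _).trans ?_
  refine congrArg xF ?_
  refine (actP_tM i _).trans ?_
  exact congrArg (fun z => i + z) (xA_apply x)

lemma conj_tw_not_mem (i : ZMod 7) : xA⁻¹ * (homA (tM i) * (homA wM * xA)) ∉ H168 := by
  refine not_mem_of _ (fun x => xF (i + sF (xF x))) ?_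
    fun g => (not_mem_check _ _ _ _ (det7 g)).2.2.1 i
  intro x
  rw [xA_inv]
  refine (xA_apply _).trans ?_
  refine congrArg xF ?_
  refine (actP_tM i _).trans ?_
  refine congrArg (fun z => i + z) ?_
  exact (actP_wM _).trans (congrArg sF (xA_apply x))

lemma wA_inv : (homA wM)⁻¹ = homA wM := by
  rw [inv_eq_iff_mul_eq_one]
  apply Subtype.ext
  apply Equiv.ext
  intro x
  have h : ∀ x : ZMod 7, sF (sF x) = x := by decide +kernel
  exact (actP_wM _).trans ((congrArg sF (actP_wM x)).trans (h x))

lemma conj_wtw_not_mem (i : ZMod 7) (hi : i ≠ 0) :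
    xA⁻¹ * ((homA wM)⁻¹ * (homA (tM i) * (homA wM * xA))) ∉ H168 := by
  refine not_mem_of _ (fun x => xF (sF (i + sF (xF x)))) ?_
    fun g => (not_mem_check _ _ _ _ (det7 g)).2.2.2 i hi
  intro x
  rw [xA_inv, wA_inv]
  refine (xA_apply _).trans ?_
  refine congrArg xF ?_
  refine (actP_wM _).trans ?_
  refine congrArg sF ?_
  refine (actP_tM i _).trans ?_
  refine congrArg (fun z => i + z) ?_
  exact (actP_wM _).trans (congrArg sF (xA_apply x))

lemma tM_sub (i j : ZMod 7) : (homA (tM i))⁻¹ * homA (tM j) = homA (tM (j - i)) := by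
  rw [inv_mul_eq_iff_eq_mul, ← map_mul]
  congr 1
  apply SL7_ext <;> simp only [mul00, mul01, mul10, mul11, t00, t01, t10, t11] <;> ring

lemma tM_zero : tM 0 = 1 := by
  apply SL7_ext <;> simp [t00, t01, t10, t11]

/-- Fifteen coset representatives. -/
def cosetMap : Option (Bool × ZMod 7) → alternatingGroup (Fin 7) ⧸ H168
  | none => ((1 : alternatingGroup (Fin 7)) : alternatingGroup (Fin 7) ⧸ H168)
  | some (false, i) => ((homA (tM i) * xA : alternatingGroup (Fin 7)) : _ ⧸ H168)
  | some (true, i) => ((homA (tM i) * (homA wM * xA) : alternatingGroup (Fin 7)) : _ ⧸ H168)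

lemma homA_mem (g : SL7) : homA g ∈ H168 := ⟨g, rfl⟩

lemma cosetMap_inj : Function.Injective cosetMap := by
  have key1 : ∀ g : SL7, ((homA g * xA : alternatingGroup (Fin 7)) : _ ⧸ H168) ≠
      ((1 : alternatingGroup (Fin 7)) : _ ⧸ H168) := by
    intro g h
    have h1 := (QuotientGroup.eq.mp h.symm)
    rw [inv_one, one_mul] at h1
    exact xA_not_mem ((Subgroup.mul_mem_cancel_left _ (homA_mem g)).mp h1)
  have key2 : ∀ i j, ((homA (tM i) * xA : alternatingGroup (Fin 7)) : _ ⧸ H168) ≠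
      ((homA (tM j) * (homA wM * xA) : alternatingGroup (Fin 7)) : _ ⧸ H168) := by
    intro i j h
    have h1 := QuotientGroup.eq.mp h
    rw [show (homA (tM i) * xA)⁻¹ * (homA (tM j) * (homA wM * xA)) =
      xA⁻¹ * (((homA (tM i))⁻¹ * homA (tM j)) * (homA wM * xA)) by group, tM_sub] at h1
    exact conj_tw_not_mem _ h1
  have key3 : ∀ i j, i ≠ j → ((homA (tM i) * xA : alternatingGroup (Fin 7)) : _ ⧸ H168) ≠
      ((homA (tM j) * xA : alternatingGroup (Fin 7)) : _ ⧸ H168) := by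
    intro i j hij h
    have h1 := QuotientGroup.eq.mp h
    rw [show (homA (tM i) * xA)⁻¹ * (homA (tM j) * xA) =
      xA⁻¹ * (((homA (tM i))⁻¹ * homA (tM j)) * xA) by group, tM_sub] at h1
    exact conj_t_not_mem _ (sub_ne_zero.mpr hij.symm) h1
  have key4 : ∀ i j, i ≠ j →
      ((homA (tM i) * (homA wM * xA) : alternatingGroup (Fin 7)) : _ ⧸ H168) ≠
      ((homA (tM j) * (homA wM * xA) : alternatingGroup (Fin 7)) : _ ⧸ H168) := by
    intro i j hij h
    have h1 := QuotientGroup.eq.mp h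
    rw [show (homA (tM i) * (homA wM * xA))⁻¹ * (homA (tM j) * (homA wM * xA)) =
      xA⁻¹ * ((homA wM)⁻¹ * (((homA (tM i))⁻¹ * homA (tM j)) * (homA wM * xA))) by group,
      tM_sub] at h1
    exact conj_wtw_not_mem _ (sub_ne_zero.mpr hij.symm) h1
  rintro (_ | ⟨_ | _, i⟩) (_ | ⟨_ | _, j⟩) h
  · rfl
  · exact absurd h.symm (key1 _)
  · refine absurd h.symm ?_
    simp only [cosetMap]
    rw [← mul_assoc, ← map_mul]; exact key1 _
  · exact absurd h (key1 _)
  · by_cases hij : i = j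
    · rw [hij]
    · exact absurd h (key3 _ _ hij)
  · exact absurd h (key2 _ _)
  · refine absurd h ?_
    simp only [cosetMap]
    rw [← mul_assoc, ← map_mul]; exact key1 _
  · exact absurd h.symm (key2 _ _)
  · by_cases hij : i = j
    · rw [hij]
    · exact absurd h (key4 _ _ hij)

lemma H168_trans (q : alternatingGroup (Fin 7) ⧸ H168) :
    q = ((1 : alternatingGroup (Fin 7)) : _ ⧸ H168) ∨
      ∃ h ∈ H168, q = ((h * xA : alternatingGroup (Fin 7)) : _ ⧸ H168) := by
  have hs : Function.Surjective cosetMap := by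
    refine ((Nat.bijective_iff_injective_and_card cosetMap).mpr ⟨cosetMap_inj, ?_⟩).2
    rw [card_quot, Nat.card_eq_fintype_card]
    simp [ZMod.card]
  obtain ⟨c, rfl⟩ := hs q
  rcases c with _ | ⟨_ | _, i⟩
  · exact Or.inl rfl
  · exact Or.inr ⟨_, homA_mem _, rfl⟩
  · exact Or.inr ⟨homA (tM i * wM), homA_mem _, by rw [map_mul, mul_assoc]; rfl⟩

end PSL

section PartOne

variable {k : Type} [Field k] [CharP k 5]

lemma cast_ne (n : ℕ) (h : ¬ 5 ∣ n) : (n : k) ≠ 0 := by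
  rwa [Ne, CharP.cast_eq_zero_iff k 5 n]

lemma exists_odd (H : Subgroup (Equiv.Perm (Fin 7))) (hI : HasIp k 5 H) :
    ∃ h ∈ H, Equiv.Perm.sign h = -1 := by
  classical
  by_contra hcon
  push Not at hcon
  have hH1 : ∀ h ∈ H, Equiv.Perm.sign h = 1 := fun h hh =>
    (Int.units_eq_one_or _).resolve_right (hcon h hh)
  let s : Equiv.Perm (Fin 7) := Equiv.swap 0 1
  have hs : Equiv.Perm.sign s = -1 := Equiv.Perm.sign_swap (by decide)
  let K := Subgroup.zpowers s
  have hso : orderOf s = 2 := by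
    refine orderOf_eq_prime ?_ ?_
    · rw [pow_two]; exact Equiv.swap_mul_self 0 1
    · intro h; rw [h, map_one] at hs; exact absurd hs (by decide)
  have hKc : Fintype.card K = 2 := by rw [← Nat.card_eq_fintype_card, Nat.card_zpowers, hso]
  have hHc : (Fintype.card H : k) ≠ 0 := by
    rw [← Nat.card_eq_fintype_card]; exact cast_ne _ hI.1
  let u : Equiv.Perm (Fin 7) ⧸ H → k := fun q => ((Equiv.Perm.sign q.out : ℤ) : k)
  have hu : ∀ g : Equiv.Perm (Fin 7), u (g : _ ⧸ H) = ((Equiv.Perm.sign g : ℤ) : k) := by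
    intro g
    obtain ⟨h, hh⟩ := QuotientGroup.mk_out_eq_mul H g
    simp only [u]
    rw [hh, Equiv.Perm.sign_mul, hH1 _ h.2, mul_one]
  have h2 : (2 : k) ≠ 0 := by exact_mod_cast cast_ne (k := k) 2 (by norm_num)
  have := fun_zero_of_indec K H (by rw [hKc]; exact_mod_cast h2) hHc hI.2 u ?_
  · have h1 := congrFun this ((1 : Equiv.Perm (Fin 7)) : _ ⧸ H)
    rw [hu] at h1
    simp at h1
  · intro g
    simp only [hu]
    have h3 := Equiv.sum_comp (Equiv.mulLeft (⟨s, Subgroup.mem_zpowers s⟩ : K))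
      (fun x : K => ((Equiv.Perm.sign (g * (x : Equiv.Perm (Fin 7))) : ℤ) : k))
    have h4 : ∀ x : K, ((Equiv.Perm.sign (g * ((Equiv.mulLeft (⟨s, Subgroup.mem_zpowers s⟩ : K) x : K)
       : Equiv.Perm (Fin 7))) : ℤ) : k) = - ((Equiv.Perm.sign (g * (x : Equiv.Perm (Fin 7))) : ℤ) : k) := by
      intro x
      simp [Equiv.Perm.sign_mul, hs]
    rw [Finset.sum_congr rfl (fun x _ => h4 x), Finset.sum_neg_distrib] at h3
    have h5 := neg_eq_iff_add_eq_zero.mp h3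
    rw [← two_mul] at h5
    exact (mul_eq_zero.mp h5).resolve_left h2

lemma fin7_ind (P : Fin 7 → Prop) (h0 : P 0) (hs : ∀ j, P j → P (finRotate 7 j)) : ∀ j, P j := by
  have e : ∀ j : Fin 7, finRotate 7 j = j + 1 := by decide
  have h1 := e 0 ▸ hs _ h0
  have h2 := e _ ▸ hs _ h1
  have h3 := e _ ▸ hs _ h2
  have h4 := e _ ▸ hs _ h3
  have h5 := e _ ▸ hs _ h4
  have h6 := e _ ▸ hs _ h5
  intro j
  fin_cases j
  exacts [h0, h1, h2, h3, h4, h5, h6]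

lemma pretrans (H : Subgroup (Equiv.Perm (Fin 7))) (hI : HasIp k 5 H) :
    ∀ j : Fin 7, ∃ h ∈ H, h 0 = j := by
  classical
  let c : Equiv.Perm (Fin 7) := finRotate 7
  let K := Subgroup.zpowers c
  have hKc : Fintype.card K = 7 := by
    rw [← Nat.card_eq_fintype_card, Nat.card_zpowers, ← Equiv.Perm.lcm_cycleType,
      cycleType_finRotate]
    rfl
  have hHc : (Fintype.card H : k) ≠ 0 := by
    rw [← Nat.card_eq_fintype_card]; exact cast_ne _ hI.1
  have h7 : (7 : k) ≠ 0 := by exact_mod_cast cast_ne (k := k) 7 (by norm_num)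
  let Om : Finset (Fin 7) := Finset.univ.filter (fun j => ∃ h ∈ H, h 0 = j)
  let v : Fin 7 → k := fun j => (if j ∈ Om then 7 else 0) - (Om.card : k)
  have hOm : ∀ h ∈ H, ∀ j, h j ∈ Om ↔ j ∈ Om := by
    intro h hh j
    simp only [Om, Finset.mem_filter, Finset.mem_univ, true_and]
    constructor
    · rintro ⟨x, hx, e⟩
      exact ⟨h⁻¹ * x, H.mul_mem (H.inv_mem hh) hx, by rw [Equiv.Perm.mul_apply, e]; simp⟩
    · rintro ⟨x, hx, e⟩
      exact ⟨h * x, H.mul_mem hh hx, by rw [Equiv.Perm.mul_apply, e]⟩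
  have hv : ∀ h ∈ H, ∀ j, v (h j) = v j := by
    intro h hh j
    simp only [v, hOm h hh j]
  have hsum : ∑ j, v j = 0 := by
    simp only [v, Finset.sum_sub_distrib, Finset.sum_ite_mem, Finset.univ_inter, Finset.sum_const]
    simp
    ring
  let u : Equiv.Perm (Fin 7) ⧸ H → k := fun q => v (q.out⁻¹ 0)
  have hu : ∀ g : Equiv.Perm (Fin 7), u (g : _ ⧸ H) = v (g⁻¹ 0) := by
    intro g
    obtain ⟨h, hh⟩ := QuotientGroup.mk_out_eq_mul H g
    simp only [u]
    rw [hh, mul_inv_rev, Equiv.Perm.mul_apply, hv _ (H.inv_mem h.2)]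
  let S : Fin 7 → k := fun j => ∑ x : K, v ((x : Equiv.Perm (Fin 7))⁻¹ j)
  have hS : ∀ j, S (c j) = S j := by
    intro j
    simp only [S]
    rw [← Equiv.sum_comp (Equiv.mulLeft (⟨c, Subgroup.mem_zpowers c⟩ : K))]
    refine Finset.sum_congr rfl fun x _ => ?_
    simp
  have hS0 : ∀ j, S j = S 0 := fin7_ind _ rfl (fun j hj => (hS j).trans hj)
  have hSsum : ∑ j, S j = 0 := by
    simp only [S]
    rw [Finset.sum_comm]
    refine Finset.sum_eq_zero fun x _ => ?_
    rw [Equiv.sum_comp (x : Equiv.Perm (Fin 7))⁻¹ v, hsum]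
  have hSz : S 0 = 0 := by
    rw [Finset.sum_congr rfl (fun j _ => hS0 j)] at hSsum
    simp only [Finset.sum_const, Finset.card_univ, Fintype.card_fin, nsmul_eq_mul] at hSsum
    exact (mul_eq_zero.mp hSsum).resolve_left (by exact_mod_cast h7)
  have hu0 := fun_zero_of_indec K H (by rw [hKc]; exact_mod_cast h7) hHc hI.2 u (by
    intro g
    simp only [hu, mul_inv_rev, Equiv.Perm.mul_apply]
    exact (hS0 _).trans hSz)
  have hvz : ∀ j, v j = 0 := by
    intro j
    have := congrFun hu0 ((Equiv.swap 0 j : Equiv.Perm (Fin 7)) : _ ⧸ H)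
    rw [hu] at this
    simpa using this
  intro j
  by_contra hj
  have hj' : j ∉ Om := by simpa [Om] using hj
  have h0' : (0 : Fin 7) ∈ Om := by
    simp only [Om, Finset.mem_filter, Finset.mem_univ, true_and]
    exact ⟨1, H.one_mem, rfl⟩
  have e1 := hvz j
  have e2 := hvz 0
  simp only [v, if_neg hj', if_pos h0'] at e1 e2
  apply h7
  linear_combination e2 - e1

lemma seven_dvd_s18 (H : Subgroup (Equiv.Perm (Fin 7))) (ht : ∀ j : Fin 7, ∃ h ∈ H, h 0 = j) :
    7 ∣ Nat.card H := by
  classical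
  have h := MulAction.card_orbit_mul_card_stabilizer_eq_card_group H (0 : Fin 7)
  have ho : MulAction.orbit H (0 : Fin 7) = Set.univ := by
    ext j
    simp only [Set.mem_univ, iff_true]
    obtain ⟨x, hx, e⟩ := ht j
    exact ⟨⟨x, hx⟩, e⟩
  rw [Nat.card_eq_fintype_card, ← h]
  refine Dvd.dvd.mul_right ?_ _
  rw [← Nat.card_eq_fintype_card, ho]
  simp

lemma exists_conj (H : Subgroup (Equiv.Perm (Fin 7))) (h7 : 7 ∣ Nat.card H) :
    ∃ τ : Equiv.Perm (Fin 7), finRotate 7 ∈ H.map (MulAut.conj τ).toMonoidHom := by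
  obtain ⟨x, hx⟩ := exists_prime_orderOf_dvd_card' 7 h7
  have hx' : orderOf (x : Equiv.Perm (Fin 7)) = 7 := by rw [Subgroup.orderOf_coe, hx]
  obtain ⟨n, hn⟩ := Equiv.Perm.cycleType_prime_order (σ := (x : Equiv.Perm (Fin 7)))
    (by rw [hx']; norm_num)
  have hs := Equiv.Perm.sum_cycleType (x : Equiv.Perm (Fin 7))
  have hle : (Equiv.Perm.support (x : Equiv.Perm (Fin 7))).card ≤ 7 :=
    (Finset.card_le_univ _).trans (by simp)
  rw [hn, hx', Multiset.sum_replicate, smul_eq_mul] at hs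
  have hn0 : n = 0 := by omega
  have hc : IsConj (x : Equiv.Perm (Fin 7)) (finRotate 7) := by
    rw [Equiv.Perm.isConj_iff_cycleType_eq, hn, hn0, hx', cycleType_finRotate]
    rfl
  obtain ⟨τ, hτ⟩ := isConj_iff.mp hc
  exact ⟨τ, x, x.2, hτ⟩

lemma affine_of_odd (H : Subgroup (Equiv.Perm (Fin 7))) (h5 : ¬ 5 ∣ Nat.card H)
    (hc : finRotate 7 ∈ H) (h : Equiv.Perm (Fin 7)) (hh : h ∈ H) (hodd : Equiv.Perm.sign h = -1)
    (h0 : h 0 = 0) : ∀ x, h x = h 1 * x := by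
  have hcp : ∀ i x : Fin 7, (finRotate 7 ^ (i : ℕ)) x = x + i := by decide +kernel
  have hne : ∀ a b : Fin 7, a ≠ b → h a ≠ h b := fun a b hab e => hab (h.injective e)
  have hn0 : ∀ a : Fin 7, a ≠ 0 → h a ≠ 0 := fun a ha => h0 ▸ hne a 0 ha
  have hd := dich_check (h 1) (hn0 _ (by decide)) (h 2) ⟨hn0 _ (by decide), hne _ _ (by decide)⟩
    (h 3) ⟨hn0 _ (by decide), hne _ _ (by decide), hne _ _ (by decide)⟩
    (h 4) ⟨hn0 _ (by decide), hne _ _ (by decide), hne _ _ (by decide), hne _ _ (by decide)⟩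
    (h 5) ⟨hn0 _ (by decide), hne _ _ (by decide), hne _ _ (by decide), hne _ _ (by decide),
      hne _ _ (by decide)⟩
    (h 6) ⟨hn0 _ (by decide), hne _ _ (by decide), hne _ _ (by decide), hne _ _ (by decide),
      hne _ _ (by decide), hne _ _ (by decide)⟩
  have hfun : (![0, h 1, h 2, h 3, h 4, h 5, h 6] : Fin 7 → Fin 7) = h := by
    funext x
    fin_cases x
    · exact h0.symm
    all_goals rfl
  rw [hfun] at hd
  have hsg : sgnF h = -1 := by
    rw [← hodd, Equiv.Perm.sign_eq_prod_prod_Iio]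
    rfl
  rcases hd hsg with h1 | ⟨i, j, hw, y, hy⟩
  · exact h1
  · exfalso
    apply h5
    set w : Equiv.Perm (Fin 7) := finRotate 7 ^ (i : ℕ) * (h * (finRotate 7 ^ (j : ℕ) * h)) with hwd
    have hwm : w ∈ H := H.mul_mem (H.pow_mem hc _) (H.mul_mem hh (H.mul_mem (H.pow_mem hc _) hh))
    have hwa : ∀ x, w x = wordF h i j x := by
      intro x
      simp only [hwd, Equiv.Perm.mul_apply, hcp, wordF]
    have hw5 : w ^ 5 = 1 := by
      apply Equiv.ext
      intro x
      simp only [pow_succ, pow_zero, one_mul, Equiv.Perm.mul_apply, hwa]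
      exact hw x
    have hw1 : w ≠ 1 := by
      intro e
      apply hy
      rw [← hwa, e]
      rfl
    haveI : Fact (Nat.Prime 5) := ⟨by norm_num⟩
    have ho := orderOf_eq_prime hw5 hw1
    rw [← ho, ← Subgroup.orderOf_mk w hwm]
    exact orderOf_dvd_natCard _

lemma odd_det (H : Subgroup (Equiv.Perm (Fin 7))) (h5 : ¬ 5 ∣ Nat.card H)
    (hc : finRotate 7 ∈ H) (h : Equiv.Perm (Fin 7)) (hh : h ∈ H)
    (hodd : Equiv.Perm.sign h = -1) : ∀ x, h x = (h 1 - h 0) * x + h 0 := by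
  have hcp : ∀ i x : Fin 7, (finRotate 7 ^ (i : ℕ)) x = x + i := by decide +kernel
  set c' : Equiv.Perm (Fin 7) := finRotate 7 ^ ((-h 0 : Fin 7) : ℕ) with hc'
  have hsc : Equiv.Perm.sign c' = 1 := by
    rw [hc', map_pow, sign_finRotate, Even.neg_one_pow (by decide), one_pow]
  have := affine_of_odd H h5 hc (c' * h) (H.mul_mem (H.pow_mem hc _) hh)
    (by rw [Equiv.Perm.sign_mul, hsc, hodd, one_mul])
    (by rw [Equiv.Perm.mul_apply, hc', hcp, add_neg_cancel])
  intro x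
  have hx := this x
  simp only [Equiv.Perm.mul_apply, hc', hcp] at hx
  rw [sub_eq_add_neg, ← hx, neg_add_cancel_right]

lemma card_le_98 (H : Subgroup (Equiv.Perm (Fin 7))) (h5 : ¬ 5 ∣ Nat.card H)
    (hc : finRotate 7 ∈ H) (h0 : Equiv.Perm (Fin 7)) (hh0 : h0 ∈ H)
    (hodd : Equiv.Perm.sign h0 = -1) : Nat.card H ≤ 98 := by
  classical
  have key : ∀ a b : Equiv.Perm (Fin 7), a ∈ H → b ∈ H → Equiv.Perm.sign a = -1 →
      Equiv.Perm.sign b = -1 → a 0 = b 0 → a 1 = b 1 → a = b := by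
    intro a b ha hb hsa hsb e0 e1
    apply Equiv.ext
    intro x
    rw [odd_det H h5 hc a ha hsa, odd_det H h5 hc b hb hsb, e0, e1]
  let o : H → Equiv.Perm (Fin 7) := fun h =>
    if Equiv.Perm.sign (h : Equiv.Perm (Fin 7)) = -1 then h else h * h0
  have ho : ∀ h : H, o h ∈ H ∧ Equiv.Perm.sign (o h) = -1 := by
    intro h
    simp only [o]
    split_ifs with hs
    · exact ⟨h.2, hs⟩
    · refine ⟨H.mul_mem h.2 hh0, ?_⟩
      rw [Equiv.Perm.sign_mul, (Int.units_eq_one_or _).resolve_right hs, hodd, one_mul]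
  let f : H → (Fin 7 × Fin 7) × ℤˣ := fun h =>
    ((o h 0, o h 1), Equiv.Perm.sign (h : Equiv.Perm (Fin 7)))
  have hf : Function.Injective f := by
    intro a b hab
    have e1 : o a 0 = o b 0 := congrArg (fun t => t.1.1) hab
    have e2 : o a 1 = o b 1 := congrArg (fun t => t.1.2) hab
    have e3 : Equiv.Perm.sign (a : Equiv.Perm (Fin 7)) = Equiv.Perm.sign (b : Equiv.Perm (Fin 7)) :=
      congrArg (fun t => t.2) hab
    have e := key _ _ (ho a).1 (ho b).1 (ho a).2 (ho b).2 e1 e2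
    simp only [o, e3] at e
    apply Subtype.ext
    split_ifs at e with hs
    · exact e
    · exact mul_right_cancel e
  refine (Nat.card_le_card_of_injective f hf).trans ?_
  rw [Nat.card_eq_fintype_card]
  decide

lemma card_ge_168 (H : Subgroup (Equiv.Perm (Fin 7))) (hI : HasIp k 5 H) : 168 ≤ Nat.card H := by
  classical
  let K : Subgroup (Equiv.Perm (Fin 7)) := H168.map (alternatingGroup (Fin 7)).subtype
  have hK : Nat.card K = 168 := by
    rw [← card_H168]
    exact Subgroup.card_map_of_injective Subtype.val_injective
  have hHc : (Fintype.card H : k) ≠ 0 := by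
    rw [← Nat.card_eq_fintype_card]; exact cast_ne _ hI.1
  have := card_le_of_indec K H (k := k)
    (by rw [← Nat.card_eq_fintype_card, hK]; exact cast_ne _ (by norm_num)) hHc hI.2
  rwa [hK] at this

end PartOne

/-- The symmetric group `S_7` does not have property `(I_5)` with respect to any subgroup,
although its index-two subgroup `A_7` has property `(I_5)` with respect to a subgroup
isomorphic to `PSL_2(7)` (of order `168`). -/
theorem stmt18 (k : Type) [Field k] [IsAlgClosed k] [CharP k 5] :
    (∀ H : Subgroup (Equiv.Perm (Fin 7)), ¬ HasIp k 5 H) ∧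
    ((alternatingGroup (Fin 7)).index = 2 ∧
      ∃ H : Subgroup ↥(alternatingGroup (Fin 7)),
        Nat.card H = 168 ∧ Nonempty (↥H ≃* PSL27) ∧ HasIp k 5 H) := by
  refine ⟨?_, alternatingGroup.index_eq_two, H168, card_H168, H168_equiv, ?_, ?_⟩
  · intro H hI
    obtain ⟨τ, hτ⟩ := exists_conj H (seven_dvd_s18 H (pretrans H hI))
    obtain ⟨h, hh, hodd⟩ := exists_odd H hI
    have hcard : Nat.card (H.map (MulAut.conj τ).toMonoidHom) = Nat.card H :=
      Subgroup.card_map_of_injective (MulAut.conj τ).injective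
    have h1 := card_le_98 (H.map (MulAut.conj τ).toMonoidHom) (by rw [hcard]; exact hI.1) hτ
      (τ * h * τ⁻¹) ⟨h, hh, rfl⟩ (by
        rw [Equiv.Perm.sign_mul, Equiv.Perm.sign_mul, Equiv.Perm.sign_inv, mul_right_comm,
          Int.units_mul_self, one_mul, hodd])
    have h2 := card_ge_168 H hI
    omega
  · rw [card_H168]; norm_num
  · refine indec_of_two_transitive H168 ?_ xA xA_not_mem H168_trans
    rw [card_quot, CharP.cast_eq_zero_iff k 5]
    norm_num
end
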